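/- Up to a scalar multiple, there is exactly one nonzero Conway invariant holomorphic Jacobi form of singular weight 12, index t ≤ 3, and non-trivial character v_η^d (d even, d not divisible by 24): it occurs only for index t = 3 with character v_η^{16}, and its Fourier expansion begins (q^{2/3}/8096)·(8096·O₂ + 77·O₅·q + (8096·O_{8a} − 4·O_{8b} + 77·O_{8c})·q² + O(q³)). In particular, no such form exists for indices 1 and 2. -/

import Mathlib

open Complex Matrix UpperHalfPlane
open scoped Manifold MatrixGroups Real Topology BigOperators

noncomputable section

/-- Vectors of the rank-24 lattice (coordinates w.r.t. a fixed basis). -/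
abbrev LV := Fin 24 → ℤ

/-- Complexified vectors. -/
abbrev CV := Fin 24 → ℂ

/-- The bilinear form attached to a Gram matrix `B`. -/
def pairZ (B : Matrix (Fin 24) (Fin 24) ℤ) (v u : LV) : ℤ := v ⬝ᵥ B.mulVec u

/-- The complex bilinear extension of the form. -/
def pairC (B : Matrix (Fin 24) (Fin 24) ℤ) (z w : CV) : ℂ :=
  z ⬝ᵥ ((B.map (Int.cast : ℤ → ℂ)).mulVec w)

/-- Inclusion of lattice vectors into complexified vectors. -/
def liftC (v : LV) : CV := fun i => (v i : ℂ)

/-- `B` is a Gram matrix of the Leech lattice: even, unimodular, positive definite of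
rank 24, with no vectors of norm 2 (no roots). -/
def IsLeech (B : Matrix (Fin 24) (Fin 24) ℤ) : Prop :=
  B.IsSymm ∧ B.det = 1 ∧ (∀ v : LV, v ≠ 0 → 0 < pairZ B v v) ∧
    (∀ v : LV, Even (pairZ B v v)) ∧ (∀ v : LV, pairZ B v v ≠ 2)

/-- The automorphism group `Co₀ = Aut(Λ)` of the lattice, as a set of integral matrices. -/
def ConwayGroup (B : Matrix (Fin 24) (Fin 24) ℤ) : Set (Matrix (Fin 24) (Fin 24) ℤ) :=
  {σ | IsUnit σ.det ∧ σᵀ * B * σ = B}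

/-- Action of an integral matrix on complexified vectors. -/
def actC (σ : Matrix (Fin 24) (Fin 24) ℤ) (z : CV) : CV :=
  (σ.map (Int.cast : ℤ → ℂ)).mulVec z

/-- `e(x) = exp(2πix)`. -/
def eC (x : ℂ) : ℂ := Complex.exp (2 * (Real.pi : ℂ) * Complex.I * x)

/-- The Fourier term `qⁿ ζ^ℓ`. -/
def fterm (B : Matrix (Fin 24) (Fin 24) ℤ) (n : ℕ) (ℓ : LV) (τ : UpperHalfPlane) (z : CV) : ℂ :=
  eC ((n : ℂ) * (τ : ℂ)) * eC (pairC B (liftC ℓ) z)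

/-- Lower-left entry of `A ∈ SL(2,ℤ)`, as a complex number. -/
def slc (A : SL(2, ℤ)) : ℂ := ((A : Matrix (Fin 2) (Fin 2) ℤ) 1 0 : ℤ)

/-- Lower-right entry of `A ∈ SL(2,ℤ)`, as a complex number. -/
def sld (A : SL(2, ℤ)) : ℂ := ((A : Matrix (Fin 2) (Fin 2) ℤ) 1 1 : ℤ)

/-- The automorphy factor `cτ + d`. -/
def jfactor (A : SL(2, ℤ)) (τ : UpperHalfPlane) : ℂ := slc A * (τ : ℂ) + sld A

/-- `φ : ℍ × (Λ⊗ℂ) → ℂ` is a Conway invariant weak Jacobi form of weight `k` and index `t`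
with Fourier coefficients `f`. -/
structure IsJacobiFormWith (B : Matrix (Fin 24) (Fin 24) ℤ) (k : ℤ) (t : ℕ)
    (φ : UpperHalfPlane → CV → ℂ) (f : ℕ → LV → ℂ) : Prop where
  holo_tau : ∀ z : CV, MDifferentiable 𝓘(ℂ) 𝓘(ℂ) fun τ : UpperHalfPlane => φ τ z
  holo_z : ∀ τ : UpperHalfPlane, Differentiable ℂ (φ τ)
  conway_invar : ∀ σ ∈ ConwayGroup B, ∀ (τ : UpperHalfPlane) (z : CV), φ τ (actC σ z) = φ τ z
  quasi_periodic : ∀ (x y : LV) (τ : UpperHalfPlane) (z : CV),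
    φ τ (z + (τ : ℂ) • liftC x + liftC y) =
      Complex.exp (-(t : ℂ) * (Real.pi : ℂ) * Complex.I * (pairZ B x x : ℂ) * (τ : ℂ)
        - 2 * (t : ℂ) * (Real.pi : ℂ) * Complex.I * pairC B (liftC x) z) * φ τ z
  modular : ∀ (A : SL(2, ℤ)) (τ : UpperHalfPlane) (z : CV),
    φ (A • τ) ((jfactor A τ)⁻¹ • z) =
      (jfactor A τ) ^ k *
        Complex.exp ((t : ℂ) * (Real.pi : ℂ) * Complex.I * slc A * pairC B z z / jfactor A τ) *
        φ τ z
  expansion : ∀ (τ : UpperHalfPlane) (z : CV),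
    HasSum (fun p : ℕ × LV => f p.1 p.2 * fterm B p.1 p.2 τ z) (φ τ z)

/-- Conway invariant weak Jacobi forms. -/
def IsWeakJacobiForm (B : Matrix (Fin 24) (Fin 24) ℤ) (k : ℤ) (t : ℕ)
    (φ : UpperHalfPlane → CV → ℂ) : Prop :=
  ∃ f, IsJacobiFormWith B k t φ f

/-- Conway invariant holomorphic Jacobi forms. -/
def IsHolJacobiForm (B : Matrix (Fin 24) (Fin 24) ℤ) (k : ℤ) (t : ℕ)
    (φ : UpperHalfPlane → CV → ℂ) : Prop :=
  ∃ f, IsJacobiFormWith B k t φ f ∧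
    ∀ (n : ℕ) (ℓ : LV), 2 * (n : ℤ) * t - pairZ B ℓ ℓ < 0 → f n ℓ = 0

/-- Modular forms of weight `k` on `SL₂(ℤ)`; the ring of all of them is `ℂ[E₄,E₆]`. -/
abbrev MForm (k : ℤ) := ModularForm (CongruenceSubgroup.Gamma 1) k

/-- The family `φ i` (of weights `w i`) freely generates the module of all forms satisfying
`P` over the ring `M_*(SL₂(ℤ)) = ℂ[E₄,E₆]` of modular forms on `SL₂(ℤ)`. -/
def FreelyGenerates (P : ℤ → (UpperHalfPlane → CV → ℂ) → Prop) {n : ℕ}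
    (w : Fin n → ℤ) (φ : Fin n → UpperHalfPlane → CV → ℂ) : Prop :=
  (∀ i, P (w i) (φ i)) ∧
  ∀ (k : ℤ) (ψ : UpperHalfPlane → CV → ℂ), P k ψ →
    ∃! g : (i : Fin n) → MForm (k - w i),
      ∀ (τ : UpperHalfPlane) (z : CV), ψ τ z = ∑ i, (g i) τ * φ i τ z

/-- The point `(aτ+b)/d` of the upper half-plane (for `a, d > 0`). -/
def heckePt (a d b : ℕ) (τ : UpperHalfPlane) : UpperHalfPlane :=
  if h : 0 < ((((a : ℂ) * (τ : ℂ) + (b : ℂ)) / (d : ℂ)).im) then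
    ⟨((a : ℂ) * (τ : ℂ) + (b : ℂ)) / (d : ℂ), h⟩ else τ

/-- The Hecke operator `T₋(m)` on Jacobi forms of weight `k`. -/
def heckeOp (k : ℤ) (m : ℕ) (φ : UpperHalfPlane → CV → ℂ) : UpperHalfPlane → CV → ℂ :=
  fun τ z => (m : ℂ)⁻¹ * ∑ d ∈ m.divisors, ∑ b ∈ Finset.range d,
    ((m / d : ℕ) : ℂ) ^ k * φ (heckePt (m / d) d b τ) (((m / d : ℕ) : ℂ) • z)

/-- The Jacobi theta function `Θ_Λ = A₁` of the lattice. -/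
def thetaLeech (B : Matrix (Fin 24) (Fin 24) ℤ) : UpperHalfPlane → CV → ℂ := fun τ z =>
  ∑' ℓ : LV, Complex.exp ((Real.pi : ℂ) * Complex.I * (pairZ B ℓ ℓ : ℂ) * (τ : ℂ)
    + 2 * (Real.pi : ℂ) * Complex.I * pairC B (liftC ℓ) z)

/-- `σ_k(n) = Σ_{d ∣ n} d^k`. -/
def sigmaNat (k n : ℕ) : ℕ := ∑ d ∈ n.divisors, d ^ k

/-- `A_t = σ₁₁(t)⁻¹ (A₁ | T₋(t))`, a holomorphic Jacobi form of weight 12 and index `t`. -/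
def Aform (B : Matrix (Fin 24) (Fin 24) ℤ) (t : ℕ) : UpperHalfPlane → CV → ℂ := fun τ z =>
  ((sigmaNat 11 t : ℂ))⁻¹ * heckeOp 12 t (thetaLeech B) τ z

/-- The quasimodular Eisenstein series `E₂`. -/
def E2 : UpperHalfPlane → ℂ := fun τ =>
  1 - 24 * ∑' n : ℕ, (sigmaNat 1 (n + 1) : ℂ) * eC (((n : ℂ) + 1) * (τ : ℂ))

/-- The discriminant cusp form `Δ(τ) = q ∏ (1-qⁿ)^24`. -/
def DeltaForm : UpperHalfPlane → ℂ := fun τ =>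
  eC (τ : ℂ) * ∏' n : ℕ, (1 - eC (((n : ℂ) + 1) * (τ : ℂ))) ^ 24

/-- `aτ`. -/
def scaleH (a : ℕ) (τ : UpperHalfPlane) : UpperHalfPlane := heckePt a 1 0 τ

/-- `(τ+j)/t`. -/
def sliceH (t j : ℕ) (τ : UpperHalfPlane) : UpperHalfPlane := heckePt 1 t j τ

/-- `f₂(τ) = (tE₂(tτ) - E₂(τ))/(t-1)`, a modular form of weight 2 on `Γ₀(t)`. -/
def f2w (t : ℕ) (τ : UpperHalfPlane) : ℂ := ((t : ℂ) * E2 (scaleH t τ) - E2 τ) / ((t : ℂ) - 1)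

/-- `B_t`, a holomorphic Jacobi form of weight 14 and index `t` (for `t` prime). -/
def Bform (B : Matrix (Fin 24) (Fin 24) ℤ) (t : ℕ) : UpperHalfPlane → CV → ℂ := fun τ z =>
  ((t : ℂ) ^ 12 / ((t : ℂ) ^ 12 - 1)) *
    (f2w t τ * thetaLeech B (scaleH t τ) ((t : ℂ) • z)
      - (t : ℂ) ^ (-13 : ℤ) *
        ∑ j ∈ Finset.range t, f2w t (sliceH t j τ) * thetaLeech B (sliceH t j τ) z)

/-- Fourier coefficients of `E₂`. -/
def e2coeff : ℕ → ℂ := fun m => if m = 0 then 1 else -24 * (sigmaNat 1 m : ℂ)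

/-- Fourier coefficients of the image `H_k(φ)` of the modified heat operator applied to a
Jacobi form of weight `k` and index `t` with Fourier coefficients `f`:
`H_k(φ) = 𝓗(φ) + ((12-k)/12)E₂φ` where `𝓗` multiplies `f(n,ℓ)` by `n - (ℓ,ℓ)/(2t)`. -/
def heatCoeff (B : Matrix (Fin 24) (Fin 24) ℤ) (k : ℤ) (t : ℕ) (f : ℕ → LV → ℂ) :
    ℕ → LV → ℂ := fun n ℓ =>
  ((n : ℂ) - (pairZ B ℓ ℓ : ℂ) / (2 * (t : ℂ))) * f n ℓ +
    ((12 - k : ℤ) : ℂ) / 12 * ∑ m ∈ Finset.range (n + 1), e2coeff m * f (n - m) ℓ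

/-- The function with Fourier coefficients `f`. -/
def fourierSeries (B : Matrix (Fin 24) (Fin 24) ℤ) (f : ℕ → LV → ℂ) :
    UpperHalfPlane → CV → ℂ := fun τ z =>
  ∑' p : ℕ × LV, f p.1 p.2 * fterm B p.1 p.2 τ z

/-- The family `Φ m = Φ_{12,m}` of Fourier–Jacobi coefficients of the Borcherds form `Φ₁₂`
at the Leech cusp:
`Δ(τ)·exp(−Σ_{m≥1}((Δ⁻¹A₁)|T₋(m))(τ,𝔷)e^{2πimω}) = Σ_{m≥0} Φ_{12,m}(τ,𝔷)e^{2πimω}`. -/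
def IsFJExpansionOfPhi12 (B : Matrix (Fin 24) (Fin 24) ℤ)
    (Φ : ℕ → UpperHalfPlane → CV → ℂ) : Prop :=
  ∀ (τ ω : UpperHalfPlane) (z : CV),
    HasSum (fun m : ℕ => Φ m τ z * eC ((m : ℂ) * (ω : ℂ)))
      (DeltaForm τ * Complex.exp
        (- ∑' m : ℕ, heckeOp 0 (m + 1) (fun σ w => thetaLeech B σ w / DeltaForm σ) τ z *
            eC (((m : ℂ) + 1) * (ω : ℂ))))

/-- `S_t`: the set of lattice vectors of minimal norm in their coset modulo `tΛ`. -/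
def minimalSet (B : Matrix (Fin 24) (Fin 24) ℤ) (t : ℕ) : Set LV :=
  {v | ∀ u : LV, (∃ w : LV, u = v + (t : ℤ) • w) → pairZ B v v ≤ pairZ B u u}

/-- `v` and `u` are conjugate modulo `tΛ` up to the Conway group. -/
def conjModT (B : Matrix (Fin 24) (Fin 24) ℤ) (t : ℕ) (v u : LV) : Prop :=
  ∃ σ ∈ ConwayGroup B, ∃ w : LV, v - σ.mulVec u = (t : ℤ) • w

/-- `s(t) = |(S_t/Co₀)/tΛ|`. -/
def sRank (B : Matrix (Fin 24) (Fin 24) ℤ) (t : ℕ) : ℕ :=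
  Nat.card (Quot (fun v u : minimalSet B t => conjModT B t v.1 u.1))

/-- `R` is a system of representatives for `(S_t/Co₀)/tΛ` (of minimal length). -/
def IsRepSystem (B : Matrix (Fin 24) (Fin 24) ℤ) (t : ℕ) (R : Finset LV) : Prop :=
  (↑R ⊆ minimalSet B t) ∧ ∀ v ∈ minimalSet B t, ∃! r, r ∈ R ∧ conjModT B t v r

/-- The Conway orbit of a lattice vector. -/
def orbitOf (B : Matrix (Fin 24) (Fin 24) ℤ) (v : LV) : Set LV :=
  {u | ∃ σ ∈ ConwayGroup B, u = σ.mulVec v}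

/-- `O` is a Conway orbit of Leech vectors of type `x` (i.e. norm `2x`) with `c` elements. -/
def OrbitData (B : Matrix (Fin 24) (Fin 24) ℤ) (O : Set LV) (x c : ℕ) : Prop :=
  (∃ v : LV, O = orbitOf B v) ∧ (∀ v ∈ O, pairZ B v v = 2 * (x : ℤ)) ∧ Nat.card O = c

/-- `W` is a `d`-dimensional subspace of the space of functions `ℍ × (Λ⊗ℂ) → ℂ`. -/
def SpanDimIs (W : (UpperHalfPlane → CV → ℂ) → Prop) (d : ℕ) : Prop :=
  ∃ φ : Fin d → UpperHalfPlane → CV → ℂ, (∀ i, W (φ i)) ∧ LinearIndependent ℂ φ ∧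
    ∀ ψ, W ψ → ∃ c : Fin d → ℂ, ψ = ∑ i, c i • φ i


/-- The Dedekind eta function `η(τ) = q^{1/24} ∏_{n≥1} (1 - qⁿ)`. -/
def etaF : UpperHalfPlane → ℂ := fun τ =>
  eC ((τ : ℂ) / 24) * ∏' n : ℕ, (1 - eC (((n : ℂ) + 1) * (τ : ℂ)))

/-- The Fourier term `q^r ζ^ℓ` with rational exponent. -/
def ftermQ (B : Matrix (Fin 24) (Fin 24) ℤ) (r : ℂ) (ℓ : LV) (τ : UpperHalfPlane)
    (z : CV) : ℂ :=
  eC (r * (τ : ℂ)) * eC (pairC B (liftC ℓ) z)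

/-- `φ` is a Conway invariant holomorphic Jacobi form of singular weight 12, index `t` and
character `v_η^d` (for an even integer `d`), with Fourier coefficients `f`: the coefficient
`f j ℓ` corresponds to the exponent `n = (d + 24j)/24 ∈ d/24 + ℤ`, and is supported on
`n ≥ 0` and `(ℓ,ℓ) = 2nt` (the singular-weight support condition). Since `d` is even, the
automorphy factor `v_η(A)^d (cτ+d)^{12}` equals `(η(Aτ)/η(τ))^d (cτ+d)^{12-d/2}`. -/
structure IsSingularJacobiCharWith (B : Matrix (Fin 24) (Fin 24) ℤ) (t : ℕ) (d : ℤ)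
    (φ : UpperHalfPlane → CV → ℂ) (f : ℤ → LV → ℂ) : Prop where
  holo_tau : ∀ z : CV, MDifferentiable 𝓘(ℂ) 𝓘(ℂ) fun τ : UpperHalfPlane => φ τ z
  holo_z : ∀ τ : UpperHalfPlane, Differentiable ℂ (φ τ)
  conway_invar : ∀ σ ∈ ConwayGroup B, ∀ (τ : UpperHalfPlane) (z : CV), φ τ (actC σ z) = φ τ z
  quasi_periodic : ∀ (x y : LV) (τ : UpperHalfPlane) (z : CV),
    φ τ (z + (τ : ℂ) • liftC x + liftC y) =
      Complex.exp (-(t : ℂ) * (Real.pi : ℂ) * Complex.I * (pairZ B x x : ℂ) * (τ : ℂ)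
        - 2 * (t : ℂ) * (Real.pi : ℂ) * Complex.I * pairC B (liftC x) z) * φ τ z
  modular : ∀ (A : SL(2, ℤ)) (τ : UpperHalfPlane) (z : CV),
    φ (A • τ) ((jfactor A τ)⁻¹ • z) =
      (etaF (A • τ) / etaF τ) ^ d * (jfactor A τ) ^ (12 - d / 2) *
        Complex.exp ((t : ℂ) * (Real.pi : ℂ) * Complex.I * slc A * pairC B z z / jfactor A τ) *
        φ τ z
  support : ∀ (j : ℤ) (ℓ : LV), f j ℓ ≠ 0 →
    0 ≤ d + 24 * j ∧ 12 * pairZ B ℓ ℓ = t * (d + 24 * j)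
  expansion : ∀ (τ : UpperHalfPlane) (z : CV),
    HasSum (fun p : ℤ × LV =>
      f p.1 p.2 * ftermQ B (((d + 24 * p.1 : ℤ) : ℂ) / 24) p.2 τ z) (φ τ z)

abbrev MZ := Matrix (Fin 24) (Fin 24) ℤ

section basics
variable {B : MZ}

lemma pairZ_add_left (u v w : LV) : pairZ B (u + v) w = pairZ B u w + pairZ B v w := by
  simp [pairZ, add_dotProduct]
lemma pairZ_add_right (u v w : LV) : pairZ B u (v + w) = pairZ B u v + pairZ B u w := by
  simp [pairZ, mulVec_add, dotProduct_add]
lemma pairZ_smul_left (a : ℤ) (v w : LV) : pairZ B (a • v) w = a * pairZ B v w := by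
  unfold pairZ; rw [smul_dotProduct]; rfl
lemma pairZ_smul_right (a : ℤ) (v w : LV) : pairZ B v (a • w) = a * pairZ B v w := by
  unfold pairZ; rw [mulVec_smul, dotProduct_smul]; rfl
lemma pairZ_neg_left (v w : LV) : pairZ B (-v) w = - pairZ B v w := by
  simp [pairZ, neg_dotProduct]
lemma pairZ_neg_right (v w : LV) : pairZ B v (-w) = - pairZ B v w := by
  simp [pairZ, mulVec_neg, dotProduct_neg]
lemma pairZ_sub_left (u v w : LV) : pairZ B (u - v) w = pairZ B u w - pairZ B v w := by
  simp [pairZ, sub_dotProduct]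
lemma pairZ_sub_right (u v w : LV) : pairZ B u (v - w) = pairZ B u v - pairZ B u w := by
  simp [pairZ, mulVec_sub, dotProduct_sub]
lemma pairZ_zero_left (w : LV) : pairZ B 0 w = 0 := by simp [pairZ]
lemma pairZ_zero_right (w : LV) : pairZ B w 0 = 0 := by simp [pairZ]
lemma pairZ_sum_left {ι : Type*} (s : Finset ι) (f : ι → LV) (w : LV) :
    pairZ B (∑ i ∈ s, f i) w = ∑ i ∈ s, pairZ B (f i) w := by
  simp [pairZ, sum_dotProduct]
lemma pairZ_sum_right {ι : Type*} (s : Finset ι) (f : ι → LV) (w : LV) :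
    pairZ B w (∑ i ∈ s, f i) = ∑ i ∈ s, pairZ B w (f i) := by
  simp [pairZ, Matrix.mulVec_sum, dotProduct_sum]
lemma IsLeech.comm (hB : IsLeech B) (u v : LV) : pairZ B u v = pairZ B v u := by
  unfold pairZ
  rw [dotProduct_mulVec, dotProduct_comm, ← mulVec_transpose, hB.1.eq]

lemma IsLeech.pos (hB : IsLeech B) {v : LV} (hv : v ≠ 0) : 4 ≤ pairZ B v v := by
  have h1 := hB.2.2.1 v hv
  have h2 := hB.2.2.2.1 v
  have h3 := hB.2.2.2.2 v
  obtain ⟨k, hk⟩ := h2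
  lia
lemma IsLeech.nonneg (hB : IsLeech B) (v : LV) : 0 ≤ pairZ B v v := by
  by_cases h : v = 0
  · simp [h, pairZ_zero_left]
  · have := hB.pos h; lia
lemma IsLeech.eq_zero (hB : IsLeech B) {v : LV} (h : pairZ B v v < 4) : v = 0 := by
  by_contra h'
  have := hB.pos h'; lia
lemma IsLeech.even (hB : IsLeech B) (v : LV) : ∃ k, pairZ B v v = 2 * k := by
  obtain ⟨k, hk⟩ := hB.2.2.2.1 v
  exact ⟨k, by lia⟩

lemma IsLeech.norm_sub (hB : IsLeech B) (u v : LV) :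
    pairZ B (u - v) (u - v) = pairZ B u u - 2 * pairZ B u v + pairZ B v v := by
  rw [pairZ_sub_left, pairZ_sub_right, pairZ_sub_right, hB.comm v u]; ring
lemma IsLeech.norm_add (hB : IsLeech B) (u v : LV) :
    pairZ B (u + v) (u + v) = pairZ B u u + 2 * pairZ B u v + pairZ B v v := by
  rw [pairZ_add_left, pairZ_add_right, pairZ_add_right, hB.comm v u]; ring

end basics

def pairR (B : MZ) (x y : Fin 24 → ℝ) : ℝ :=
  x ⬝ᵥ ((B.map (Int.cast : ℤ → ℝ)).mulVec y)

section real
variable {B : MZ}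

lemma pairR_cast (v w : LV) : pairR B (fun i => (v i : ℝ)) (fun i => (w i : ℝ)) = pairZ B v w := by
  simp [pairR, pairZ, dotProduct, mulVec]

lemma pairR_smul (a : ℝ) (v : Fin 24 → ℝ) : pairR B (a • v) (a • v) = a ^ 2 * pairR B v v := by
  simp [pairR, mulVec_smul, dotProduct_smul, smul_dotProduct]; ring

lemma continuous_pairR : Continuous (fun x : Fin 24 → ℝ => pairR B x x) := by
  unfold pairR dotProduct mulVec dotProduct
  fun_prop

lemma pairR_nonneg (hB : IsLeech B) (x : Fin 24 → ℝ) : 0 ≤ pairR B x x := by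
  have hd : DenseRange (Pi.map (fun (_ : Fin 24) (q : ℚ) => (q : ℝ))) :=
    DenseRange.piMap (fun _ => Rat.denseRange_cast)
  refine hd.induction_on (p := fun x => 0 ≤ pairR B x x) x
    (isClosed_le continuous_const continuous_pairR) ?_
  intro q
  obtain ⟨b, hb⟩ := IsLocalization.exist_integer_multiples (nonZeroDivisors ℤ) Finset.univ q
  choose! n hn using hb
  have hb0 : ((b : ℤ) : ℝ) ≠ 0 := by
    have := nonZeroDivisors.coe_ne_zero b
    exact_mod_cast this
  have : (fun i => ((n i : ℤ) : ℝ)) = ((b : ℤ) : ℝ) • (Pi.map (fun (_ : Fin 24) (q : ℚ) => (q : ℝ)) q) := by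
    ext i
    have h := hn i (Finset.mem_univ _)
    have h' : ((n i : ℤ) : ℚ) = ((b : ℤ) : ℚ) * q i := by
      simpa using h
    simp only [Pi.smul_apply, Pi.map_apply, smul_eq_mul]
    exact_mod_cast h'
  have h2 := pairR_cast (B := B) n n
  rw [this, pairR_smul] at h2
  have h3 : (0 : ℝ) ≤ pairZ B n n := by exact_mod_cast hB.nonneg n
  rw [← h2] at h3
  have : 0 < ((b : ℤ) : ℝ) ^ 2 := by positivity
  exact nonneg_of_mul_nonneg_right h3 this

lemma posDef_real (hB : IsLeech B) : (B.map (Int.cast : ℤ → ℝ)).PosDef := by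
  have hps : (B.map (Int.cast : ℤ → ℝ)).PosSemidef := by
    refine Matrix.PosSemidef.of_dotProduct_mulVec_nonneg ?_ ?_
    · have := hB.1
      ext i j
      simp [Matrix.conjTranspose_apply]
      exact congrFun (congrFun this i) j
    · intro x
      simpa [pairR] using pairR_nonneg hB x
  rw [hps.posDef_iff_isUnit, Matrix.isUnit_iff_isUnit_det]
  have : (B.map (Int.cast : ℤ → ℝ)).det = ((B.det : ℤ) : ℝ) := by
    have := RingHom.map_det (Int.castRingHom ℝ) B
    simpa [RingHom.mapMatrix_apply] using this.symm
  rw [this, hB.2.1]; simp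

open scoped MatrixOrder in
lemma exists_factor (hB : IsLeech B) : ∃ M : Matrix (Fin 24) (Fin 24) ℝ,
    Mᵀ * M = B.map (Int.cast : ℤ → ℝ) ∧ |M.det| = 1 := by
  obtain ⟨M, hM⟩ := CStarAlgebra.nonneg_iff_eq_star_mul_self.mp (posDef_real hB).posSemidef.nonneg
  have hM' : Mᵀ * M = B.map (Int.cast : ℤ → ℝ) := by
    rw [hM, star_eq_conjTranspose]; simp
  refine ⟨M, hM', ?_⟩
  have h := congrArg Matrix.det hM'
  have : (B.map (Int.cast : ℤ → ℝ)).det = ((B.det : ℤ) : ℝ) := by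
    have := RingHom.map_det (Int.castRingHom ℝ) B
    simpa [RingHom.mapMatrix_apply] using this.symm
  rw [this, hB.2.1, det_mul, det_transpose] at h
  have : |M.det| * |M.det| = 1 := by rw [abs_mul_abs_self]; simpa using h
  nlinarith [abs_nonneg M.det]

lemma exists_lower (hB : IsLeech B) : ∃ c : ℝ, 0 < c ∧ ∀ x : Fin 24 → ℝ, c * ∑ i, x i ^ 2 ≤ pairR B x x := by
  obtain ⟨M, hM, hd⟩ := exists_factor hB
  have hu : IsUnit M.det := by
    rw [isUnit_iff_ne_zero]; intro h; simp [h] at hd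
  set N := M⁻¹
  set K : ℝ := ∑ i, ∑ j, N i j ^ 2
  have hK : 0 ≤ K := by positivity
  refine ⟨(K + 1)⁻¹, by positivity, fun x => ?_⟩
  have h1 : pairR B x x = ∑ i, (M.mulVec x) i ^ 2 := by
    unfold pairR
    rw [← hM, ← Matrix.mulVec_mulVec, dotProduct_mulVec, ← Matrix.mulVec_transpose, transpose_transpose]
    simp [dotProduct, sq]
  have h2 : x = N.mulVec (M.mulVec x) := by
    rw [Matrix.mulVec_mulVec, Matrix.nonsing_inv_mul _ hu, one_mulVec]
  rw [h1]
  set y := M.mulVec x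
  have h3 : ∑ i, x i ^ 2 ≤ K * ∑ i, y i ^ 2 := by
    rw [h2]
    simp only [mulVec, dotProduct, K]
    rw [Finset.sum_mul]
    refine Finset.sum_le_sum fun i _ => ?_
    exact Finset.sum_mul_sq_le_sq_mul_sq _ _ _
  have h4 : 0 ≤ ∑ i, y i ^ 2 := by positivity
  rw [inv_mul_le_iff₀ (by positivity)]
  nlinarith

lemma summable_pi_prod (g : ℤ → ℝ) (hg0 : ∀ k, 0 ≤ g k) (hg : Summable g) (n : ℕ) :
    Summable (fun v : Fin n → ℤ => ∏ i, g (v i)) := by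
  induction n with
  | zero => exact Summable.of_finite
  | succ n ih =>
    rw [← (Fin.consEquiv (fun _ => ℤ)).summable_iff]
    have := hg.mul_of_nonneg ih hg0 (fun v => Finset.prod_nonneg fun i _ => hg0 _)
    refine this.congr fun p => ?_
    simp [Fin.prod_univ_succ]

lemma summable_gauss_int {c : ℝ} (hc : 0 < c) (C : ℝ) :
    Summable (fun k : ℤ => Real.exp (-c * (k : ℝ) ^ 2 + C * |(k : ℝ)|)) := by
  have h : Summable (fun k : ℤ => Real.exp (-|(k : ℝ)|)) := by
    refine Summable.of_nat_of_neg ?_ ?_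
    · simpa using Real.summable_exp_neg_nat
    · simpa using Real.summable_exp_neg_nat
  refine Summable.of_nonneg_of_le (fun k => (Real.exp_pos _).le) (fun k => ?_)
    (h.mul_left (Real.exp ((C + 1) ^ 2 / (4 * c))))
  rw [← Real.exp_add]
  apply Real.exp_le_exp.mpr
  have h1 : 0 ≤ (2 * c * |(k : ℝ)| - (C + 1)) ^ 2 / (4 * c) := by positivity
  have h2 : (2 * c * |(k : ℝ)| - (C + 1)) ^ 2 / (4 * c) =
    c * (k : ℝ) ^ 2 - (C + 1) * |(k : ℝ)| + (C + 1) ^ 2 / (4 * c) := by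
    field_simp
    rw [← sq_abs (k : ℝ)]; ring
  linarith

def l1 (v : LV) : ℝ := ∑ i, |(v i : ℝ)|

lemma l1_nonneg (v : LV) : 0 ≤ l1 v := by unfold l1; positivity

lemma summable_gauss_sq {c : ℝ} (hc : 0 < c) (C : ℝ) :
    Summable (fun v : LV => Real.exp (-c * ∑ i, (v i : ℝ) ^ 2 + C * l1 v)) := by
  have := summable_pi_prod _ (fun k => (Real.exp_pos _).le) (summable_gauss_int hc C) 24
  refine this.congr fun v => ?_
  rw [← Real.exp_sum, Finset.sum_add_distrib, ← Finset.mul_sum, ← Finset.mul_sum, l1]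

lemma summable_gauss (hB : IsLeech B) {s : ℝ} (hs : 0 < s) (C : ℝ) :
    Summable (fun v : LV => Real.exp (-s * (pairZ B v v : ℝ) + C * l1 v)) := by
  obtain ⟨c, hc, h⟩ := exists_lower hB
  refine Summable.of_nonneg_of_le (fun k => (Real.exp_pos _).le) (fun v => ?_)
    (summable_gauss_sq (mul_pos hs hc) C)
  apply Real.exp_le_exp.mpr
  have := h (fun i => (v i : ℝ))
  rw [pairR_cast] at this
  nlinarith

end real

section poisson
open MeasureTheory

def cubeAt (v : LV) : Set (Fin 24 → ℝ) := {x | ∀ i, x i ∈ Set.Ioc (v i : ℝ) ((v i : ℝ) + 1)}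

def liftR (v : LV) : Fin 24 → ℝ := fun i => (v i : ℝ)

lemma measurable_cubeAt (v : LV) : MeasurableSet (cubeAt v) :=
  MeasurableSet.univ_pi' (fun _ => measurableSet_Ioc)

lemma cubeAt_disjoint : Pairwise (Function.onFun Disjoint cubeAt) := by
  intro v w hvw
  rw [Function.onFun, Set.disjoint_left]
  intro x hx hy
  apply hvw
  ext i
  have h1 := hx i
  have h2 := hy i
  simp only [Set.mem_Ioc] at h1 h2
  have h3 : v i < w i + 1 := by exact_mod_cast (h1.1.trans_le h2.2)
  have h4 : w i < v i + 1 := by exact_mod_cast (h2.1.trans_le h1.2)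
  lia

lemma cubeAt_union : (⋃ v, cubeAt v) = Set.univ := by
  rw [Set.eq_univ_iff_forall]
  intro x
  rw [Set.mem_iUnion]
  refine ⟨fun i => ⌈x i⌉ - 1, fun i => ?_⟩
  have h1 := Int.ceil_lt_add_one (x i)
  have h2 := Int.le_ceil (x i)
  simp only [Set.mem_Ioc, Int.cast_sub, Int.cast_one]
  constructor <;> linarith

lemma integral_cubeAt {E : Type*} [NormedAddCommGroup E] [NormedSpace ℝ E]
    (G : (Fin 24 → ℝ) → E) (v : LV) :
    ∫ x in cubeAt v, G x = ∫ x in cubeAt 0, G (x + liftR v) := by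
  have h := (measurePreserving_add_right volume (liftR v)).setIntegral_preimage_emb
    (MeasurableEquiv.addRight (liftR v)).measurableEmbedding G (cubeAt v)
  rw [← h]
  congr 2
  ext x
  simp only [cubeAt, Set.mem_preimage, Set.mem_ofPred_eq, liftR, Set.mem_Ioc, Pi.add_apply,
    Pi.zero_apply, Int.cast_zero]
  refine forall_congr' fun i => ?_
  constructor <;> rintro ⟨a, b⟩ <;> constructor <;> linarith

lemma unfold_integral {G : (Fin 24 → ℝ) → ℂ} (hG : Integrable G) :
    ∫ x in cubeAt 0, ∑' v : LV, G (x + liftR v) = ∫ x, G x := by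
  have h1 : HasSum (fun v => ∫ x in cubeAt v, G x) (∫ x in ⋃ v, cubeAt v, G x) :=
    hasSum_integral_iUnion measurable_cubeAt cubeAt_disjoint hG.integrableOn
  have h2 : HasSum (fun v => ∫ x in cubeAt v, ‖G x‖) (∫ x in ⋃ v, cubeAt v, ‖G x‖) :=
    hasSum_integral_iUnion measurable_cubeAt cubeAt_disjoint hG.norm.integrableOn
  simp_rw [cubeAt_union] at h1 h2
  have e1 := funext (fun v => integral_cubeAt G v)
  have e2 := funext (fun v => integral_cubeAt (fun x => ‖G x‖) v)
  rw [e1] at h1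
  rw [e2] at h2
  rw [setIntegral_univ] at h1
  have h3 := hasSum_integral_of_summable_integral_norm (μ := volume.restrict (cubeAt 0))
    (F := fun (v : LV) x => G (x + liftR v)) (fun v => (hG.comp_add_right _).integrableOn) h2.summable
  exact h3.unique h1

lemma isOpenQuotient_torus : IsOpenQuotientMap (fun (x : Fin 24 → ℝ) => (fun i => (x i : UnitAddCircle))) := by
  have := IsOpenQuotientMap.piMap (fun (_ : Fin 24) =>
    (QuotientAddGroup.isOpenQuotientMap_mk (N := AddSubgroup.zmultiples (1 : ℝ))))
  exact this

lemma mFourier_coe (n : LV) (x : Fin 24 → ℝ) :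
    UnitAddTorus.mFourier n (fun i => (x i : UnitAddCircle)) =
      cexp (2 * π * Complex.I * ∑ i, (n i : ℂ) * (x i : ℂ)) := by
  simp only [UnitAddTorus.mFourier, ContinuousMap.coe_mk]
  rw [Finset.mul_sum, Complex.exp_sum]
  refine Finset.prod_congr rfl fun i _ => ?_
  rw [fourier_coe_apply]
  congr 1
  push_cast; ring

lemma poisson_aux {g : (Fin 24 → ℝ) → ℂ} (hg : Continuous g) (hi : Integrable g)
    (hloc : ∀ R : ℝ, ∃ u : LV → ℝ, Summable u ∧ ∀ x : Fin 24 → ℝ, (∀ i, |x i| < R) →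
      ∀ v : LV, ‖g (x + liftR v)‖ ≤ u v)
    (hs : Summable (fun n : LV => ∫ x, g x * cexp (-(2 * π * Complex.I * ∑ i, (n i : ℂ) * (x i : ℂ))))) :
    ∑' v : LV, g (liftR v) = ∑' n : LV, ∫ x, g x * cexp (-(2 * π * Complex.I * ∑ i, (n i : ℂ) * (x i : ℂ))) := by
  set f : (Fin 24 → ℝ) → ℂ := fun x => ∑' v : LV, g (x + liftR v) with hf
  have hfc : Continuous f := by
    rw [continuous_iff_continuousAt]
    intro x
    obtain ⟨u, hu, hb⟩ := hloc (‖x‖ + 1)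
    have hc : ContinuousOn f {y | ‖y‖ < ‖x‖ + 1} := by
      refine continuousOn_tsum (fun v => (by fun_prop)) hu ?_
      intro v y hy
      refine hb y (fun i => ?_) v
      have h1 := norm_le_pi_norm y i
      rw [Real.norm_eq_abs] at h1
      exact lt_of_le_of_lt h1 hy
    refine hc.continuousAt ((isOpen_lt continuous_norm continuous_const).mem_nhds ?_)
    simp
  have hper : ∀ x (w : LV), f (x + liftR w) = f x := by
    intro x w
    simp only [hf]
    rw [← (Equiv.addLeft w).tsum_eq (fun v => g (x + liftR v))]
    refine tsum_congr fun v => ?_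
    congr 1
    ext i; simp [liftR]; ring
  let F0 : UnitAddTorus (Fin 24) → ℂ := fun t => f (fun i => (AddCircle.equivIoc 1 0 (t i) : ℝ))
  have hF0 : ∀ x : Fin 24 → ℝ, F0 (fun i => (x i : UnitAddCircle)) = f x := by
    intro x
    have : ∀ i, ∃ k : ℤ, (AddCircle.equivIoc 1 0 ((x i : UnitAddCircle)) : ℝ) = x i + k := by
      intro i
      have h1 : (((AddCircle.equivIoc 1 0 ((x i : UnitAddCircle)) : ℝ)) : UnitAddCircle) = (x i : UnitAddCircle) :=
        (AddCircle.equivIoc (1 : ℝ) 0).symm_apply_apply _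
      rw [← sub_eq_zero, ← AddCircle.coe_sub, AddCircle.coe_eq_zero_iff] at h1
      obtain ⟨k, hk⟩ := h1
      refine ⟨k, ?_⟩
      rw [zsmul_one] at hk
      linarith
    choose k hk using this
    rw [← hper x k]
    simp only [F0]
    congr 1
    ext i
    simp [hk, liftR]
  have hF0c : Continuous F0 := by
    rw [isOpenQuotient_torus.isQuotientMap.continuous_iff]
    refine hfc.congr fun x => ?_
    simp only [Function.comp]
    exact (hF0 x).symm
  let F : C(UnitAddTorus (Fin 24), ℂ) := ⟨F0, hF0c⟩
  have hcoef : ∀ n : LV, UnitAddTorus.mFourierCoeff F n =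
      ∫ x, g x * cexp (-(2 * π * Complex.I * ∑ i, (n i : ℂ) * (x i : ℂ))) := by
    intro n
    rw [UnitAddTorus.mFourierCoeff_eq_integral F n 0]
    have hint : Integrable (fun x : Fin 24 → ℝ => g x * cexp (-(2 * π * Complex.I * ∑ i, (n i : ℂ) * (x i : ℂ)))) := by
      refine hi.mul_bdd (c := 1) (Continuous.aestronglyMeasurable (by fun_prop)) (Filter.Eventually.of_forall fun x => ?_)
      have : -(2 * π * Complex.I * ∑ i, (n i : ℂ) * (x i : ℂ)) = ((-(2 * π * ∑ i, (n i : ℝ) * x i) : ℝ) : ℂ) * Complex.I := by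
        push_cast; ring
      rw [this, Complex.norm_exp_ofReal_mul_I]
    rw [← unfold_integral hint]
    have hset : {x : Fin 24 → ℝ | ∀ i, x i ∈ Set.Ioc ((0 : Fin 24 → ℝ) i) ((0 : Fin 24 → ℝ) i + 1)} = cubeAt 0 := by
      simp [cubeAt]
    rw [hset]
    refine setIntegral_congr_fun (measurable_cubeAt 0) fun x _ => ?_
    simp only [mFourier_coe]
    have : F (fun i => (x i : UnitAddCircle)) = f x := hF0 x
    rw [this, smul_eq_mul, hf, ← tsum_mul_left]
    refine tsum_congr fun v => ?_
    rw [mul_comm]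
    congr 1
    have h1 : (-(2 * π * Complex.I * ∑ i, (n i : ℂ) * (((x + liftR v) i : ℝ) : ℂ))) =
      2 * π * Complex.I * ∑ i, ((-n) i : ℤ) * (x i : ℂ) + ((-(∑ i, n i * v i) : ℤ) : ℂ) * (2 * π * Complex.I) := by
      simp only [Pi.add_apply, liftR, Pi.neg_apply]
      push_cast
      rw [← sub_eq_zero]
      simp only [mul_add, Finset.sum_add_distrib, neg_mul, Finset.sum_neg_distrib]
      ring
    rw [h1, Complex.exp_add, Complex.exp_int_mul_two_pi_mul_I, mul_one]
  have hsum := UnitAddTorus.hasSum_mFourier_series_apply_of_summable (f := F)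
    (by rw [show UnitAddTorus.mFourierCoeff F = _ from funext hcoef]; exact hs) 0
  have h0 : F 0 = ∑' v : LV, g (liftR v) := by
    have := hF0 0
    simp only [hf, zero_add] at this
    rw [← this]
    rfl
  rw [h0] at hsum
  rw [← hsum.tsum_eq]
  refine tsum_congr fun n => ?_
  rw [hcoef]
  have := mFourier_coe n 0
  simp only [Pi.zero_apply, ofReal_zero, mul_zero, Finset.sum_const_zero, Complex.exp_zero] at this
  have h3 : UnitAddTorus.mFourier n 0 = 1 := by rw [← this]; rfl
  rw [h3]; simp
end poisson

section pairCsec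
variable {B : MZ}

lemma pairC_add_left (u v w : CV) : pairC B (u + v) w = pairC B u w + pairC B v w := by
  simp [pairC, add_dotProduct]
lemma pairC_add_right (u v w : CV) : pairC B u (v + w) = pairC B u v + pairC B u w := by
  simp [pairC, mulVec_add, dotProduct_add]
lemma pairC_smul_left (a : ℂ) (v w : CV) : pairC B (a • v) w = a * pairC B v w := by
  unfold pairC; rw [smul_dotProduct]; rfl
lemma pairC_smul_right (a : ℂ) (v w : CV) : pairC B v (a • w) = a * pairC B v w := by
  unfold pairC; rw [mulVec_smul, dotProduct_smul]; rfl
lemma pairC_sub_left (u v w : CV) : pairC B (u - v) w = pairC B u w - pairC B v w := by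
  simp [pairC, sub_dotProduct]
lemma pairC_sub_right (u v w : CV) : pairC B u (v - w) = pairC B u v - pairC B u w := by
  simp [pairC, mulVec_sub, dotProduct_sub]
lemma pairC_neg_left (v w : CV) : pairC B (-v) w = - pairC B v w := by
  simp [pairC, neg_dotProduct]
lemma pairC_zero_right (w : CV) : pairC B w 0 = 0 := by simp [pairC]
lemma IsLeech.commC (hB : IsLeech B) (u v : CV) : pairC B u v = pairC B v u := by
  unfold pairC
  rw [dotProduct_mulVec, dotProduct_comm, ← mulVec_transpose, ← Matrix.transpose_map, hB.1.eq]
lemma pairC_lift (v w : LV) : pairC B (liftC v) (liftC w) = (pairZ B v w : ℂ) := by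
  simp [pairC, pairZ, liftC, dotProduct, mulVec]
lemma liftC_add (v w : LV) : liftC (v + w) = liftC v + liftC w := by ext i; simp [liftC]
lemma liftC_sub (v w : LV) : liftC (v - w) = liftC v - liftC w := by ext i; simp [liftC]
lemma liftC_neg (v : LV) : liftC (-v) = - liftC v := by ext i; simp [liftC]
lemma liftC_smul (a : ℤ) (v : LV) : liftC (a • v) = (a : ℂ) • liftC v := by ext i; simp [liftC]

def KB (B : MZ) : ℝ := ∑ i, ∑ j, |(B i j : ℝ)|

lemma KB_nonneg : 0 ≤ KB B := by unfold KB; positivity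

lemma norm_pairC_lift_le (v : LV) (y : CV) : ‖pairC B (liftC v) y‖ ≤ KB B * ‖y‖ * l1 v := by
  unfold pairC dotProduct mulVec dotProduct
  refine (norm_sum_le _ _).trans ?_
  have h : ∀ i, ‖liftC v i * ∑ j, (B.map (Int.cast : ℤ → ℂ)) i j * y j‖ ≤
      |(v i : ℝ)| * (∑ j, |(B i j : ℝ)|) * ‖y‖ := by
    intro i
    rw [norm_mul, mul_assoc]
    have h1 : ‖liftC v i‖ = |(v i : ℝ)| := by simp [liftC]
    rw [h1]
    refine mul_le_mul_of_nonneg_left ?_ (abs_nonneg _)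
    refine (norm_sum_le _ _).trans ?_
    rw [Finset.sum_mul]
    refine Finset.sum_le_sum fun j _ => ?_
    rw [norm_mul]
    have : ‖(B.map (Int.cast : ℤ → ℂ)) i j‖ = |(B i j : ℝ)| := by simp
    rw [this]
    exact mul_le_mul_of_nonneg_left (norm_le_pi_norm y j) (abs_nonneg _)
  refine (Finset.sum_le_sum fun i _ => h i).trans ?_
  rw [← Finset.sum_mul, mul_comm (KB B), mul_assoc, mul_comm _ ‖y‖]
  refine mul_le_mul_of_nonneg_left ?_ (norm_nonneg _)
  unfold KB l1
  rw [mul_comm, Finset.sum_mul]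
  refine Finset.sum_le_sum fun i _ => ?_
  refine mul_le_mul_of_nonneg_left ?_ (abs_nonneg _)
  exact Finset.single_le_sum (f := fun i => ∑ j, |(B i j : ℝ)|) (fun i _ => by positivity) (Finset.mem_univ i)

lemma norm_pairC_le (x y : CV) : ‖pairC B x y‖ ≤ KB B * ‖x‖ * ‖y‖ := by
  unfold pairC dotProduct mulVec dotProduct KB
  refine (norm_sum_le _ _).trans ?_
  rw [Finset.sum_mul, Finset.sum_mul]
  refine Finset.sum_le_sum fun i _ => ?_
  rw [Finset.mul_sum, Finset.sum_mul, Finset.sum_mul]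
  refine (norm_sum_le _ _).trans ?_
  refine Finset.sum_le_sum fun j _ => ?_
  rw [norm_mul, norm_mul]
  have : ‖(B.map (Int.cast : ℤ → ℂ)) i j‖ = |(B i j : ℝ)| := by simp
  rw [this]
  have h1 := norm_le_pi_norm x i
  have h2 := norm_le_pi_norm y j
  have h3 := abs_nonneg (B i j : ℝ)
  calc ‖x i‖ * (|(B i j : ℝ)| * ‖y j‖) = |(B i j : ℝ)| * (‖x i‖ * ‖y j‖) := by ring
    _ ≤ |(B i j : ℝ)| * (‖x‖ * ‖y‖) := by gcongr
    _ = _ := by ring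

lemma IsLeech.mulVec_bij (hB : IsLeech B) : Function.Bijective (B.mulVec : LV → LV) := by
  have hu : IsUnit B := by rw [Matrix.isUnit_iff_isUnit_det, hB.2.1]; exact isUnit_one
  exact ⟨Matrix.mulVec_injective_of_isUnit hu, Matrix.mulVec_surjective_iff_isUnit.mpr hu⟩

def IsLeech.eqv (hB : IsLeech B) : LV ≃ LV := Equiv.ofBijective _ hB.mulVec_bij

end pairCsec

section thetaInv
open MeasureTheory
variable {B : MZ}

def thT (B : MZ) (τ : ℂ) (z : CV) (v : LV) : ℂ :=
  cexp (π * Complex.I * (pairZ B v v : ℂ) * τ + 2 * π * Complex.I * pairC B (liftC v) z)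

lemma norm_thT_le (τ : ℂ) (z : CV) (v : LV) :
    ‖thT B τ z v‖ ≤ Real.exp (-(π * τ.im) * (pairZ B v v : ℝ) + (2 * π * KB B * ‖z‖) * l1 v) := by
  unfold thT
  rw [Complex.norm_exp]
  apply Real.exp_le_exp.mpr
  have h1 : (π * Complex.I * (pairZ B v v : ℂ) * τ + 2 * π * Complex.I * pairC B (liftC v) z).re =
      -(π * τ.im) * (pairZ B v v : ℝ) - 2 * π * (pairC B (liftC v) z).im := by
    simp; ring
  rw [h1]
  have h2 := norm_pairC_lift_le (B := B) v z
  have h3 := (abs_le.mp ((Complex.abs_im_le_norm (pairC B (liftC v) z)))).1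
  nlinarith [Real.pi_pos]

lemma summable_thT (hB : IsLeech B) {τ : ℂ} (hτ : 0 < τ.im) (z : CV) : Summable (thT B τ z) :=
  Summable.of_norm_bounded (summable_gauss hB (mul_pos Real.pi_pos hτ) _) (norm_thT_le τ z)

def gG (B : MZ) (b : ℂ) (z : CV) (x : Fin 24 → ℝ) : ℂ :=
  cexp (-b * pairC B ((fun i => (x i : ℂ)) - z) ((fun i => (x i : ℂ)) - z))

lemma pairC_factor {M : Matrix (Fin 24) (Fin 24) ℝ} (hM : Mᵀ * M = B.map (Int.cast : ℤ → ℝ)) (x y : CV) :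
    pairC B x y = ∑ i, ((M.map ofReal).mulVec x) i * ((M.map ofReal).mulVec y) i := by
  have : B.map (Int.cast : ℤ → ℂ) = (M.map ofReal)ᵀ * (M.map ofReal) := by
    have h : B.map (Int.cast : ℤ → ℂ) = (B.map (Int.cast : ℤ → ℝ)).map ofReal := by ext i j; simp
    rw [h, ← hM]
    ext i j; simp [Matrix.mul_apply]
  unfold pairC
  rw [this, ← Matrix.mulVec_mulVec, dotProduct_mulVec, ← Matrix.mulVec_transpose, transpose_transpose]
  rfl

lemma mulVec_ofReal (M : Matrix (Fin 24) (Fin 24) ℝ) (x : Fin 24 → ℝ) :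
    (M.map ofReal).mulVec (fun i => (x i : ℂ)) = fun i => ((M.mulVec x i : ℝ) : ℂ) := by
  ext i; simp [mulVec, dotProduct]

lemma mp_of_det {M : Matrix (Fin 24) (Fin 24) ℝ} (hd : |M.det| = 1) :
    MeasurePreserving (fun x : Fin 24 → ℝ => M.mulVec x) := by
  have h0 : M.det ≠ 0 := by intro h; simp [h] at hd
  refine ⟨(by fun_prop : Continuous fun x : Fin 24 → ℝ => M.mulVec x).measurable, ?_⟩
  have := Real.map_matrix_volume_pi_eq_smul_volume_pi h0
  rw [abs_inv, hd] at this
  have hf : (⇑(Matrix.toLin' M) : (Fin 24 → ℝ) → (Fin 24 → ℝ)) = fun x => M.mulVec x := by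
    ext x; simp [Matrix.toLin'_apply]
  rw [hf] at this
  rw [this]; simp

lemma integral_gG_aux (b : ℂ) (w k : Fin 24 → ℂ) (y : Fin 24 → ℝ) :
   cexp (-b * ∑ i, ((y i : ℂ) - w i) * ((y i : ℂ) - w i)) * cexp (-(2 * π * Complex.I * ∑ i, k i * (y i : ℂ)))
    = cexp (-b * ∑ i, w i * w i) * cexp (-b * ∑ i, (y i : ℂ) ^ 2 + ∑ i, (2 * b * w i - 2 * π * Complex.I * k i) * (y i : ℂ)) := by
  rw [← Complex.exp_add, ← Complex.exp_add]
  congr 1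
  simp only [Finset.mul_sum, ← Finset.sum_neg_distrib, ← Finset.sum_add_distrib]
  refine Finset.sum_congr rfl fun i _ => ?_
  ring

lemma integral_gG (hB : IsLeech B) {b : ℂ} (hb : 0 < b.re) (z : CV) (m : LV) :
    Integrable (gG B b z) ∧ ∫ x, gG B b z x * cexp (-(2 * π * Complex.I * ∑ i, (B.mulVec m i : ℂ) * (x i : ℂ))) =
      (π / b) ^ 12 * cexp (- (π ^ 2 / b) * (pairZ B m m : ℂ) - 2 * π * Complex.I * pairC B (liftC m) z) := by
  obtain ⟨M, hM, hd⟩ := exists_factor hB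
  set w : CV := (M.map ofReal).mulVec z with hw
  set k : CV := (M.map ofReal).mulVec (liftC m) with hk
  have hb0 : b ≠ 0 := by intro h; simp [h] at hb
  have e1 : ∀ x, gG B b z x = (fun y : Fin 24 → ℝ => cexp (-b * ∑ i, ((y i : ℂ) - w i) * ((y i : ℂ) - w i))) (M.mulVec x) := by
    intro x
    simp only [gG]
    rw [pairC_factor hM, mulVec_sub, mulVec_ofReal]
    rfl
  have e2 : ∀ x : Fin 24 → ℝ, ∑ i, (B.mulVec m i : ℂ) * (x i : ℂ) = ∑ i, k i * ((M.mulVec x i : ℝ) : ℂ) := by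
    intro x
    have h1 := pairC_factor hM (liftC m) (fun i => (x i : ℂ))
    rw [mulVec_ofReal] at h1
    rw [hk, ← h1, hB.commC]
    unfold pairC dotProduct
    refine Finset.sum_congr rfl fun i _ => ?_
    rw [mul_comm]
    congr 1
    simp [mulVec, dotProduct, liftC]
  constructor
  · rw [show gG B b z = _ from funext e1]
    have := (mp_of_det hd).integrable_comp (g := (fun y : Fin 24 → ℝ => cexp (-b * ∑ i, ((y i : ℂ) - w i) * ((y i : ℂ) - w i))))
      (Continuous.aestronglyMeasurable (by fun_prop))
    refine this.mpr ?_
    have h2 : Integrable (fun v : Fin 24 → ℝ => cexp (-b * ∑ i, w i * w i) * cexp (-b * ∑ i, (v i : ℂ) ^ 2 + ∑ i, (2 * b * w i - 2 * π * Complex.I * (0 : CV) i) * v i)) :=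
      (GaussianFourier.integrable_cexp_neg_mul_sum_add hb _).const_mul _
    refine h2.congr (Filter.Eventually.of_forall fun y => ?_)
    simp only []
    rw [← integral_gG_aux]
    simp
  · simp_rw [e1, e2]
    have := integral_map (μ := volume) (φ := fun x : Fin 24 → ℝ => M.mulVec x) (mp_of_det hd).measurable.aemeasurable
      (f := fun y : Fin 24 → ℝ => cexp (-b * ∑ i, ((y i : ℂ) - w i) * ((y i : ℂ) - w i)) * cexp (-(2 * π * Complex.I * ∑ i, k i * ((y i : ℝ) : ℂ))))
      (Continuous.aestronglyMeasurable (by fun_prop))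
    rw [(mp_of_det hd).map_eq] at this
    rw [← this]
    simp_rw [integral_gG_aux]
    rw [integral_const_mul, GaussianFourier.integral_cexp_neg_mul_sum_add hb]
    have h12 : ((Fintype.card (Fin 24) : ℂ) / 2) = ((12 : ℕ) : ℂ) := by simp; norm_num
    rw [h12, Complex.cpow_natCast, mul_left_comm, ← Complex.exp_add]
    congr 2
    have p1 : pairC B (liftC m) z = ∑ i, k i * w i := pairC_factor hM _ _
    have p2 : (pairZ B m m : ℂ) = ∑ i, k i * k i := by rw [← pairC_lift]; exact pairC_factor hM _ _
    rw [p1, p2, Finset.sum_div, Finset.mul_sum, Finset.mul_sum, Finset.mul_sum, ← Finset.sum_add_distrib, ← Finset.sum_sub_distrib]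
    refine Finset.sum_congr rfl fun i _ => ?_
    field_simp
    ring_nf
    rw [Complex.I_sq]; ring

lemma gG_loc (hB : IsLeech B) {b : ℂ} (hb : 0 < b.re) (z : CV) (R : ℝ) :
    ∃ u : LV → ℝ, Summable u ∧ ∀ x : Fin 24 → ℝ, (∀ i, |x i| < R) →
      ∀ v : LV, ‖gG B b z (x + liftR v)‖ ≤ u v := by
  set S : ℝ := |R| + ‖z‖
  have hS : 0 ≤ S := by positivity
  refine ⟨fun v => Real.exp (‖b‖ * (KB B * S * S)) * Real.exp (-b.re * (pairZ B v v : ℝ) + (2 * ‖b‖ * (KB B * S)) * l1 v), (summable_gauss hB hb _).mul_left _, ?_⟩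
  intro x hx v
  set y : CV := (fun i => (x i : ℂ)) - z with hy
  have hyS : ‖y‖ ≤ S := by
    refine (norm_sub_le _ _).trans (add_le_add ?_ le_rfl)
    rw [pi_norm_le_iff_of_nonneg (abs_nonneg _)]
    intro i
    simpa using (hx i).le.trans (le_abs_self R)
  have h1 : (fun i => (((x + liftR v) i : ℝ) : ℂ)) - z = liftC v + y := by
    ext i; simp [hy, liftC, liftR]; ring
  unfold gG
  rw [h1, pairC_add_left, pairC_add_right, pairC_add_right, hB.commC y (liftC v), pairC_lift,
    Complex.norm_exp]
  show _ ≤ Real.exp _ * Real.exp _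
  rw [← Real.exp_add]
  apply Real.exp_le_exp.mpr
  have h2 : (-b * ((pairZ B v v : ℂ) + pairC B (liftC v) y + (pairC B (liftC v) y + pairC B y y))).re
    = -b.re * (pairZ B v v : ℝ) + (-(2 * (b * pairC B (liftC v) y))).re + (-(b * pairC B y y)).re := by
    simp; ring
  rw [h2]
  have h3 : (-(2 * (b * pairC B (liftC v) y))).re ≤ 2 * ‖b‖ * (KB B * S) * l1 v := by
    refine (Complex.re_le_norm _).trans ?_
    rw [norm_neg, norm_mul, norm_mul]
    have h4 := norm_pairC_lift_le (B := B) v y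
    have h5 : KB B * ‖y‖ * l1 v ≤ KB B * S * l1 v := by
      have := l1_nonneg v; have := KB_nonneg (B := B); gcongr
    have : ‖(2 : ℂ)‖ = 2 := by simp
    rw [this]
    have := norm_nonneg b
    nlinarith [mul_le_mul_of_nonneg_left (h4.trans h5) this]
  have h6 : (-(b * pairC B y y)).re ≤ ‖b‖ * (KB B * S * S) := by
    refine (Complex.re_le_norm _).trans ?_
    rw [norm_neg, norm_mul]
    refine mul_le_mul_of_nonneg_left ?_ (norm_nonneg _)
    refine (norm_pairC_le _ _).trans ?_
    have := KB_nonneg (B := B); gcongr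
  linarith

lemma continuous_gG (b : ℂ) (z : CV) : Continuous (gG B b z) := by
  unfold gG pairC dotProduct mulVec dotProduct
  fun_prop

theorem theta_inversion (hB : IsLeech B) {τ : ℂ} (hτ : 0 < τ.im) (z : CV) :
    ∑' v : LV, thT B (-1 / τ) ((τ⁻¹ : ℂ) • z) v =
      τ ^ 12 * cexp (π * Complex.I * pairC B z z / τ) * ∑' v : LV, thT B τ z v := by
  have hτ0 : τ ≠ 0 := by intro h; simp [h] at hτ
  set b : ℂ := π * Complex.I / τ with hbdef
  have hb : 0 < b.re := by
    rw [hbdef, Complex.div_re]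
    simp only [mul_re, ofReal_re, Complex.I_re, mul_zero, ofReal_im, Complex.I_im, mul_one, sub_zero, mul_im]
    have := Complex.normSq_pos.mpr hτ0
    have := Real.pi_pos
    simp; positivity
  have hpb : (π : ℂ) / b = τ / Complex.I := by
    rw [hbdef]; have : (π : ℂ) ≠ 0 := by exact_mod_cast Real.pi_ne_zero
    field_simp
  have hpb2 : -((π : ℂ) ^ 2 / b) = π * Complex.I * τ := by
    rw [sq, mul_div_assoc, hpb]; field_simp; rw [Complex.I_sq]
  have hcoef : ∀ m : LV, ∫ x, gG B b z x * cexp (-(2 * π * Complex.I * ∑ i, (B.mulVec m i : ℂ) * (x i : ℂ))) =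
      τ ^ 12 * thT B τ z (-m) := by
    intro m
    rw [(integral_gG hB hb z m).2, hpb, hpb2]
    have : (τ / Complex.I) ^ 12 = τ ^ 12 := by
      rw [div_pow]
      have : Complex.I ^ 12 = 1 := by rw [show (12 : ℕ) = 4 * 3 by norm_num, pow_mul, Complex.I_pow_four, one_pow]
      rw [this, div_one]
    rw [this, thT, liftC_neg, pairC_neg_left, pairZ_neg_left, pairZ_neg_right, neg_neg]
    congr 2; ring
  have hsm : Summable (fun m : LV => τ ^ 12 * thT B τ z (-m)) :=
    (((Equiv.neg LV).summable_iff).mpr (summable_thT hB hτ z)).mul_left _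
  have hs : Summable (fun n : LV => ∫ x, gG B b z x * cexp (-(2 * π * Complex.I * ∑ i, (n i : ℂ) * (x i : ℂ)))) := by
    rw [← hB.eqv.summable_iff]
    refine hsm.congr fun m => ?_
    rw [← hcoef m]; rfl
  have hP := poisson_aux (continuous_gG b z) (integral_gG hB hb z 0).1 (gG_loc hB hb z) hs
  replace hP := hP.trans (hB.eqv.tsum_eq _).symm
  have e1 : ∀ m : LV, (∫ x, gG B b z x * cexp (-(2 * π * Complex.I * ∑ i, (hB.eqv m i : ℂ) * (x i : ℂ)))) =
      τ ^ 12 * thT B τ z (-m) := hcoef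
  replace hP := hP.trans (tsum_congr e1)
  rw [tsum_mul_left] at hP
  have hneg : ∑' m : LV, thT B τ z (-m) = ∑' m : LV, thT B τ z m := (Equiv.neg LV).tsum_eq (fun m => thT B τ z m)
  rw [hneg] at hP
  rw [mul_right_comm, ← hP, mul_comm, ← tsum_mul_left]
  refine tsum_congr fun v => ?_
  unfold thT gG
  rw [← Complex.exp_add]
  congr 1
  have h1 : (fun i => ((liftR v i : ℝ) : ℂ)) = liftC v := by ext i; simp [liftR, liftC]
  rw [h1, pairC_sub_left, pairC_sub_right, pairC_sub_right, hB.commC z (liftC v), pairC_lift,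
    pairC_smul_right, hbdef]
  field_simp
  ring

end thetaInv

section hasQ

lemma eC_add (x y : ℂ) : eC (x + y) = eC x * eC y := by
  unfold eC; rw [← Complex.exp_add]; congr 1; ring
lemma eC_zero : eC 0 = 1 := by simp [eC]
lemma eC_neg (x : ℂ) : eC (-x) = (eC x)⁻¹ := by
  unfold eC; rw [← Complex.exp_neg]; congr 1; ring
lemma eC_nat_mul (n : ℕ) (x : ℂ) : eC (n * x) = eC x ^ n := by
  unfold eC; rw [← Complex.exp_nat_mul]; congr 1; ring
lemma eC_int_mul (n : ℤ) (x : ℂ) : eC (n * x) = eC x ^ n := by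
  unfold eC; rw [← Complex.exp_int_mul]; congr 1; ring
lemma eC_int (n : ℤ) : eC n = 1 := by
  unfold eC; rw [Complex.exp_eq_one_iff]; exact ⟨n, by ring⟩
lemma eC_ne_zero (x : ℂ) : eC x ≠ 0 := Complex.exp_ne_zero _
lemma norm_eC (x : ℂ) : ‖eC x‖ = Real.exp (-2 * π * x.im) := by
  unfold eC; rw [Complex.norm_exp]; congr 1; simp

def qq (h : ℕ) (τ : ℍ) : ℂ := eC ((τ : ℂ) / h)

lemma norm_qq {h : ℕ} (_hh : 0 < h) (τ : ℍ) : ‖qq h τ‖ = Real.exp (-2 * π * (τ.im / h)) := by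
  unfold qq; rw [norm_eC]
  congr 2
  rw [Complex.div_natCast_im]; rfl

lemma qq_ne {h : ℕ} (τ : ℍ) : qq h τ ≠ 0 := eC_ne_zero _

lemma norm_qq_lt {h : ℕ} (hh : 0 < h) (τ : ℍ) : ‖qq h τ‖ < 1 := by
  rw [norm_qq hh, Real.exp_lt_one_iff]
  have := τ.im_pos; have := Real.pi_pos
  have : 0 < τ.im / h := by positivity
  nlinarith

def iy (y : ℝ) (hy : 0 < y) : ℍ := ⟨y * Complex.I, by simpa using hy⟩
lemma iy_im (y : ℝ) (hy : 0 < y) : (iy y hy).im = y := by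
  show ((y : ℂ) * Complex.I).im = y
  simp

def HasQ (h : ℕ) (F : ℍ → ℂ) (p : PowerSeries ℂ) : Prop :=
  ∀ τ : ℍ, HasSum (fun m : ℕ => p.coeff m * qq h τ ^ m) (F τ)

variable {h : ℕ} {F G : ℍ → ℂ} {p r : PowerSeries ℂ}

lemma HasQ.add (hF : HasQ h F p) (hG : HasQ h G r) : HasQ h (fun τ => F τ + G τ) (p + r) := by
  intro τ
  refine ((hF τ).add (hG τ)).congr_fun ?_
  intro m
  rw [map_add, add_mul]

lemma HasQ.const_mul (hF : HasQ h F p) (c : ℂ) : HasQ h (fun τ => c * F τ) (PowerSeries.C c * p) := by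
  intro τ
  have := (hF τ).mul_left c
  refine this.congr_fun ?_
  intro m
  rw [PowerSeries.coeff_C_mul, mul_assoc]

lemma HasQ.sub (hF : HasQ h F p) (hG : HasQ h G r) : HasQ h (fun τ => F τ - G τ) (p - r) := by
  intro τ
  refine ((hF τ).sub (hG τ)).congr_fun ?_
  intro m
  rw [map_sub, sub_mul]

lemma HasQ.mul (hF : HasQ h F p) (hG : HasQ h G r) : HasQ h (fun τ => F τ * G τ) (p * r) := by
  intro τ
  have h1 := (hF τ).summable.norm
  have h2 := (hG τ).summable.norm
  have h3 := tsum_mul_tsum_eq_tsum_sum_antidiagonal_of_summable_norm h1 h2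
  have h4 := (summable_norm_sum_mul_antidiagonal_of_summable_norm h1 h2).of_norm
  rw [(hF τ).tsum_eq, (hG τ).tsum_eq] at h3
  show HasSum _ (F τ * G τ)
  rw [h3]
  refine h4.hasSum.congr_fun ?_
  intro m
  rw [PowerSeries.coeff_mul, Finset.sum_mul]
  refine Finset.sum_congr rfl fun x hx => ?_
  rw [← Finset.HasAntidiagonal.mem_antidiagonal.mp hx, pow_add]; ring

lemma hasQ_one : HasQ h (fun _ => 1) 1 := by
  intro τ
  convert hasSum_ite_eq (0 : ℕ) (1 : ℂ) using 2 with m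
  by_cases hm : m = 0 <;> simp [PowerSeries.coeff_one, hm]

lemma HasQ.pow (hF : HasQ h F p) (n : ℕ) : HasQ h (fun τ => F τ ^ n) (p ^ n) := by
  induction n with
  | zero => simpa using hasQ_one
  | succ n ih => simpa only [pow_succ] using ih.mul hF

lemma hasQ_monomial (c : ℂ) (k : ℕ) : HasQ h (fun τ => c * qq h τ ^ k) (PowerSeries.monomial k c) := by
  intro τ
  convert hasSum_ite_eq (k : ℕ) (c * qq h τ ^ k) using 2 with m
  rw [PowerSeries.coeff_monomial]
  split_ifs with h1 <;> simp [h1]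

lemma HasQ.bound (hh : 0 < h) (hF : HasQ h F p) {M : ℕ} (hM : ∀ m < M, p.coeff m = 0) :
    ∃ C : ℝ, ∀ τ : ℍ, 1 ≤ τ.im → ‖F τ‖ ≤ C * Real.exp (-2 * π * (τ.im / h) * M) := by
  set τ₀ := iy 1 one_pos
  have h0 := (hF τ₀).summable.norm
  refine ⟨(∑' m, ‖p.coeff m * qq h τ₀ ^ m‖) * Real.exp (2 * π / h * M), fun τ hτ => ?_⟩
  rw [← (hF τ).tsum_eq]
  have hle : ∀ m, ‖p.coeff m * qq h τ ^ m‖ ≤ ‖p.coeff m * qq h τ₀ ^ m‖ * (Real.exp (2 * π / h * M) * Real.exp (-2 * π * (τ.im / h) * M)) := by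
    intro m
    by_cases hm : m < M
    · simp [hM m hm]
    rw [norm_mul, norm_mul (p.coeff m), norm_pow, norm_pow, norm_qq hh, norm_qq hh, iy_im, mul_assoc ‖p.coeff m‖]
    refine mul_le_mul_of_nonneg_left ?_ (norm_nonneg (p.coeff m))
    rw [← Real.exp_nat_mul, ← Real.exp_nat_mul, ← Real.exp_add, ← Real.exp_add]
    apply Real.exp_le_exp.mpr
    have h1 : (M : ℝ) ≤ m := by exact_mod_cast not_lt.mp hm
    have h2 : 0 ≤ (2 * π / h) * ((m : ℝ) - M) * (τ.im - 1) := by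
      have := Real.pi_pos
      have h3 : 0 ≤ (m : ℝ) - M := by linarith
      have h4 : 0 ≤ τ.im - 1 := by linarith
      positivity
    have h5 : (h : ℝ) ≠ 0 := by positivity
    have h6 : (2 * π / h) * ((m : ℝ) - M) * (τ.im - 1) = (m * (-2 * π * (1 / h)) + (2 * π / h * M + -2 * π * (τ.im / h) * M)) - m * (-2 * π * (τ.im / h)) := by
      field_simp; ring
    linarith
  calc _ ≤ ∑' m, ‖p.coeff m * qq h τ ^ m‖ := norm_tsum_le_tsum_norm (hF τ).summable.norm
    _ ≤ ∑' m, ‖p.coeff m * qq h τ₀ ^ m‖ * (Real.exp (2 * π / h * M) * Real.exp (-2 * π * (τ.im / h) * M)) :=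
        Summable.tsum_le_tsum hle (hF τ).summable.norm (h0.mul_right _)
    _ = _ := by rw [tsum_mul_right, ← mul_assoc]

lemma HasQ.eq_zero (hh : 0 < h) (hF : HasQ h (fun _ => 0) p) : p = 0 := by
  ext k
  rw [map_zero]
  induction k using Nat.strong_induction_on with
  | _ k ih =>
    have h1 := hF.sub (hasQ_monomial (h := h) (p.coeff k) k)
    obtain ⟨C, hC⟩ := h1.bound hh (M := k + 1) (by
      intro m hm
      rw [map_sub, PowerSeries.coeff_monomial]
      rcases Nat.lt_succ_iff_lt_or_eq.mp hm with h2 | h2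
      · simp [ih m h2, h2.ne]
      · simp [h2])
    by_contra hne
    have hpos : 0 < ‖p.coeff k‖ := norm_pos_iff.mpr hne
    have key : ∀ y : ℝ, 1 ≤ y → ‖p.coeff k‖ ≤ C * Real.exp (-2 * π * (y / h)) := by
      intro y hy
      have h3 := hC (iy y (by linarith)) (by rw [iy_im]; exact hy)
      rw [zero_sub, norm_neg, norm_mul, norm_pow, norm_qq hh, iy_im, ← Real.exp_nat_mul] at h3
      have e : -2 * π * (y / h) * ((k + 1 : ℕ) : ℝ) = -2 * π * (y / h) + k * (-2 * π * (y / h)) := by push_cast; ring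
      rw [e, Real.exp_add, ← mul_assoc C] at h3
      exact le_of_mul_le_mul_right h3 (Real.exp_pos _)
    have hlim : Filter.Tendsto (fun y : ℝ => C * Real.exp (-2 * π * (y / h))) Filter.atTop (𝓝 (C * 0)) := by
      refine Filter.Tendsto.const_mul _ (Real.tendsto_exp_atBot.comp ?_)
      have : (fun y : ℝ => -2 * π * (y / h)) = fun y => (-(2 * π / h)) * y := by ext y; ring
      rw [this]
      refine Filter.Tendsto.const_mul_atTop_of_neg ?_ Filter.tendsto_id
      have := Real.pi_pos
      have : 0 < 2 * π / h := by positivity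
      linarith
    rw [mul_zero] at hlim
    have := ge_of_tendsto hlim (Filter.eventually_atTop.mpr ⟨1, key⟩)
    linarith

lemma HasQ.unique (hh : 0 < h) (hF : HasQ h F p) (hG : HasQ h F r) : p = r := by
  have := hF.sub hG
  simp only [sub_self] at this
  exact sub_eq_zero.mp (this.eq_zero hh)

lemma exists_qq (hh : 0 < h) (x : ℝ) (h0 : 0 < x) (h1 : x < 1) : ∃ τ : ℍ, qq h τ = x := by
  have hl := Real.log_neg h0 h1
  have hp := Real.pi_pos
  refine ⟨iy (-(Real.log x) * h / (2 * π)) (by have := neg_pos.mpr hl; positivity), ?_⟩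
  unfold qq iy eC
  have h5 : (h : ℂ) ≠ 0 := by exact_mod_cast hh.ne'
  have h6 : (π : ℂ) ≠ 0 := by exact_mod_cast hp.ne'
  have : 2 * (π : ℂ) * Complex.I * (((-(Real.log x) * h / (2 * π) : ℝ) * Complex.I) / h) = Real.log x := by
    push_cast
    field_simp
    rw [Complex.I_sq]; ring
  show cexp (2 * (π : ℂ) * Complex.I * (((-(Real.log x) * h / (2 * π) : ℝ) * Complex.I) / h)) = x
  rw [this, ← Complex.ofReal_exp, Real.exp_log h0]

lemma HasQ.mdiff (hh : 0 < h) (hF : HasQ h F p) : MDifferentiable 𝓘(ℂ) 𝓘(ℂ) F := by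
  rw [UpperHalfPlane.mdifferentiable_iff]
  have hg : DifferentiableOn ℂ (fun x : ℂ => ∑' m : ℕ, p.coeff m * x ^ m) (Metric.ball 0 1) := by
    intro x hx
    rw [mem_ball_zero_iff] at hx
    obtain ⟨s, hs1, hs2⟩ := exists_between hx
    have hs0 : 0 < s := lt_of_le_of_lt (norm_nonneg _) hs1
    obtain ⟨τ, hτ⟩ := exists_qq hh s hs0 hs2
    have hsum := (hF τ).summable.norm
    have := differentiableOn_tsum_of_summable_norm (F := fun (m : ℕ) (x : ℂ) => p.coeff m * x ^ m) hsum
      (fun m => (by fun_prop : Differentiable ℂ fun x : ℂ => p.coeff m * x ^ m).differentiableOn)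
      (Metric.isOpen_ball (x := (0 : ℂ)) (ε := s)) (by
        intro m w hw
        rw [mem_ball_zero_iff] at hw
        rw [norm_mul, norm_mul, norm_pow, norm_pow, hτ, Complex.norm_real, Real.norm_of_nonneg hs0.le]
        gcongr)
    exact (this.differentiableAt (Metric.isOpen_ball.mem_nhds (mem_ball_zero_iff.mpr hs1))).differentiableWithinAt
  have e : Set.EqOn (F ∘ UpperHalfPlane.ofComplex) ((fun x : ℂ => ∑' m : ℕ, p.coeff m * x ^ m) ∘ (fun τ => eC (τ / h))) {z | 0 < z.im} := by
    intro z hz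
    simp only [Function.comp_apply]
    rw [UpperHalfPlane.ofComplex_apply_of_im_pos hz, ← (hF _).tsum_eq]
    rfl
  refine DifferentiableOn.congr ?_ e
  refine hg.comp ?_ ?_
  · unfold eC; fun_prop
  · intro z hz
    rw [mem_ball_zero_iff]
    exact norm_qq_lt hh ⟨z, hz⟩

end hasQ

section modtool
open ModularGroup ModularForm

lemma slash_S_of {g : ℍ → ℂ} {k : ℤ} (hS : ∀ τ : ℍ, g (S • τ) = (τ : ℂ) ^ k * g τ) : g ∣[k] S = g := by
  ext τ
  rw [SL_slash_apply, ModularGroup.denom_S, hS, mul_right_comm, ← zpow_add₀ τ.ne_zero]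
  simp
lemma denom_T (τ : ℍ) : denom (T : SL(2, ℤ)) (τ : ℂ) = 1 := by
  rw [ModularGroup.denom_apply]; simp [ModularGroup.T]
lemma slash_T_of {g : ℍ → ℂ} {k : ℤ} (hT : ∀ τ : ℍ, g ((1 : ℝ) +ᵥ τ) = g τ) : g ∣[k] T = g := by
  ext τ
  rw [SL_slash_apply, UpperHalfPlane.modular_T_smul, hT]
  rw [denom_T, _root_.one_zpow, mul_one]

def mkMF (k : ℤ) (g : ℍ → ℂ) (hg : MDifferentiable 𝓘(ℂ) 𝓘(ℂ) g) (hS : ∀ τ : ℍ, g (S • τ) = (τ : ℂ) ^ k * g τ)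
    (hT : ∀ τ : ℍ, g ((1 : ℝ) +ᵥ τ) = g τ) (hb : IsBoundedAtImInfty g) : ModularForm 𝒮ℒ k where
  toFun := g
  slash_action_eq' A hA := by
    obtain ⟨A, rfl⟩ := hA
    exact SlashInvariantForm.slash_action_generators_SL2Z (slash_S_of hS) (slash_T_of hT) A
  holo' := hg
  bdd_at_cusps' hc := by
    rw [Subgroup.IsArithmetic.isCusp_iff_isCusp_SL2Z] at hc
    rw [OnePoint.isBoundedAt_iff_forall_SL2Z hc]
    intro γ _
    rw [SlashInvariantForm.slash_action_generators_SL2Z (slash_S_of hS) (slash_T_of hT)]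
    exact hb

lemma disc_S (τ : ℍ) : discriminant (S • τ) = (τ : ℂ) ^ (12 : ℤ) * discriminant τ := by
  have := congrFun discriminant_S_invariant τ
  rw [SL_slash_apply, ModularGroup.denom_S] at this
  rw [← this, mul_comm, mul_assoc, ← zpow_add₀ τ.ne_zero]; simp
lemma disc_T (τ : ℍ) : discriminant ((1 : ℝ) +ᵥ τ) = discriminant τ := by
  have := congrFun discriminant_T_invariant τ
  rw [SL_slash_apply, UpperHalfPlane.modular_T_smul] at this
  rw [← this]
  rw [denom_T, _root_.one_zpow, mul_one]
lemma disc_holo : MDifferentiable 𝓘(ℂ) 𝓘(ℂ) discriminant := CuspForm.discriminant.holo'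

lemma mdiff_div {f g : ℍ → ℂ} (hf : MDifferentiable 𝓘(ℂ) 𝓘(ℂ) f) (hg : MDifferentiable 𝓘(ℂ) 𝓘(ℂ) g) (h0 : ∀ τ, g τ ≠ 0) :
    MDifferentiable 𝓘(ℂ) 𝓘(ℂ) (fun τ => f τ / g τ) := by
  rw [UpperHalfPlane.mdifferentiable_iff] at *
  exact hf.div hg fun z _ => h0 _
lemma mdiff_pow {f : ℍ → ℂ} (hf : MDifferentiable 𝓘(ℂ) 𝓘(ℂ) f) (n : ℕ) :
    MDifferentiable 𝓘(ℂ) 𝓘(ℂ) (fun τ => f τ ^ n) := by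
  rw [UpperHalfPlane.mdifferentiable_iff] at *
  exact hf.pow n
lemma mdiff_mul {f g : ℍ → ℂ} (hf : MDifferentiable 𝓘(ℂ) 𝓘(ℂ) f) (hg : MDifferentiable 𝓘(ℂ) 𝓘(ℂ) g) :
    MDifferentiable 𝓘(ℂ) 𝓘(ℂ) (fun τ => f τ * g τ) := by
  rw [UpperHalfPlane.mdifferentiable_iff] at *
  exact hf.mul hg
lemma mdiff_sub {f g : ℍ → ℂ} (hf : MDifferentiable 𝓘(ℂ) 𝓘(ℂ) f) (hg : MDifferentiable 𝓘(ℂ) 𝓘(ℂ) g) :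
    MDifferentiable 𝓘(ℂ) 𝓘(ℂ) (fun τ => f τ - g τ) := by
  rw [UpperHalfPlane.mdifferentiable_iff] at *
  exact hf.sub hg

theorem modular_zero {F : ℍ → ℂ} {K : ℤ} {M : ℕ} (hF : MDifferentiable 𝓘(ℂ) 𝓘(ℂ) F)
    (hS : ∀ τ : ℍ, F (S • τ) = (τ : ℂ) ^ K * F τ) (hT : ∀ τ : ℍ, F ((1 : ℝ) +ᵥ τ) = F τ)
    (hb : ∃ C : ℝ, ∀ τ : ℍ, 1 ≤ τ.im → ‖F τ‖ ≤ C * Real.exp (-2 * π * τ.im * M))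
    (hK : K < 12 * M) (τ : ℍ) : F τ = 0 := by
  have hd : ∀ τ, discriminant τ ^ M ≠ 0 := fun τ => pow_ne_zero _ (discriminant_ne_zero τ)
  have hbd : IsBoundedAtImInfty (fun τ => F τ / discriminant τ ^ M) := by
    obtain ⟨C, hC⟩ := hb
    obtain ⟨c, hc⟩ := exp_isBigO_discriminant.bound
    rw [UpperHalfPlane.isBoundedAtImInfty_iff]
    have h1 := hc.and (UpperHalfPlane.atImInfty_mem _ |>.mpr ⟨1, fun z hz => hz⟩ : ∀ᶠ z in atImInfty, 1 ≤ UpperHalfPlane.im z)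
    obtain ⟨A, hA⟩ := (UpperHalfPlane.atImInfty_mem _).mp h1
    refine ⟨|C| * |c| ^ M, A, fun z hz => ?_⟩
    obtain ⟨h2, h3⟩ := hA z hz
    rw [norm_div, norm_pow, div_le_iff₀ (by have := norm_pos_iff.mpr (discriminant_ne_zero z); positivity)]
    have h4 := hC z h3
    rw [Real.norm_of_nonneg (Real.exp_pos _).le] at h2
    have h5 : Real.exp (-2 * π * z.im * M) = Real.exp (-2 * π * z.im) ^ M := by
      rw [← Real.exp_nat_mul]; congr 1; ring
    rw [h5] at h4
    have h6 : Real.exp (-2 * π * z.im) ^ M ≤ (|c| * ‖discriminant z‖) ^ M := by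
      refine pow_le_pow_left₀ (Real.exp_pos _).le (h2.trans ?_) _
      exact mul_le_mul_of_nonneg_right (le_abs_self c) (norm_nonneg _)
    calc ‖F z‖ ≤ C * _ := h4
      _ ≤ |C| * Real.exp (-2 * π * z.im) ^ M := mul_le_mul_of_nonneg_right (le_abs_self C) (by positivity)
      _ ≤ |C| * (|c| * ‖discriminant z‖) ^ M := mul_le_mul_of_nonneg_left h6 (abs_nonneg _)
      _ = _ := by rw [mul_pow]; ring
  let g := mkMF (K - 12 * M) (fun τ => F τ / discriminant τ ^ M) (mdiff_div hF (mdiff_pow disc_holo M) hd)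
    (by
      intro τ
      show F (S • τ) / discriminant (S • τ) ^ M = _ * (F τ / discriminant τ ^ M)
      rw [hS, disc_S, mul_pow, ← zpow_natCast, ← _root_.zpow_mul, zpow_sub₀ τ.ne_zero]
      field_simp) (by intro τ; simp only [hT, disc_T]) hbd
  have h1 : ⇑g = 0 := ModularFormClass.levelOne_neg_weight_eq_zero (by linarith) g
  have h2 : F τ / discriminant τ ^ M = 0 := congrFun h1 τ
  exact (div_eq_zero_iff.mp h2).resolve_right (hd τ)

end modtool

section shells
variable {B : MZ}

def nQ (B : MZ) (v : LV) : ℕ := (pairZ B v v / 2).toNat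

lemma IsLeech.two_nQ (hB : IsLeech B) (v : LV) : pairZ B v v = 2 * (nQ B v : ℤ) := by
  have h1 := hB.nonneg v
  obtain ⟨k, hk⟩ := hB.even v
  unfold nQ; omega

lemma nQ_fin (hB : IsLeech B) (m : ℕ) : {v : LV | nQ B v = m}.Finite := by
  have h1 := summable_gauss hB one_pos 0
  have h2 := h1.tendsto_cofinite_zero
  have h3 : ∀ᶠ v in Filter.cofinite, Real.exp (-1 * (pairZ B v v : ℝ) + 0 * l1 v) < Real.exp (-(2 * m : ℝ)) :=
    h2.eventually_lt_const (Real.exp_pos _)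
  refine (Filter.eventually_cofinite.mp h3).subset ?_
  intro v hv
  simp only [Set.mem_ofPred_eq] at hv ⊢
  rw [hB.two_nQ, hv]
  simp

open scoped Classical in
def TF (B : MZ) (m : ℕ) : Finset LV :=
  if h : {v : LV | nQ B v = m}.Finite then h.toFinset else ∅

lemma mem_TF' (hB : IsLeech B) {m : ℕ} {v : LV} : v ∈ TF B m ↔ nQ B v = m := by
  unfold TF
  rw [dif_pos (nQ_fin hB m)]; simp

lemma mem_TF (hB : IsLeech B) {m : ℕ} {v : LV} : v ∈ TF B m ↔ pairZ B v v = 2 * m := by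
  rw [mem_TF' hB]
  have := hB.two_nQ v
  omega

lemma hasQ_of_lv (hB : IsLeech B) {h : ℕ} {F : ℍ → ℂ} {c : LV → ℂ}
    (hs : ∀ τ, HasSum (fun v => c v * qq h τ ^ nQ B v) (F τ)) :
    HasQ h F (PowerSeries.mk fun m => ∑ v ∈ TF B m, c v) := by
  intro τ
  have h1 := (Equiv.sigmaFiberEquiv (nQ B)).hasSum_iff.mpr (hs τ)
  have h2 := h1.sigma (g := fun m => (PowerSeries.mk fun m => ∑ v ∈ TF B m, c v).coeff m * qq h τ ^ m) (by
    intro m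
    have h3 := (TF B m).hasSum (fun v => c v * qq h τ ^ nQ B v)
    have e : {v : LV // nQ B v = m} ≃ {v : LV // v ∈ TF B m} :=
      Equiv.subtypeEquivRight fun v => (mem_TF' hB).symm
    have h4 := (Equiv.subtypeEquivRight (fun v : LV => (mem_TF' hB (m := m) (v := v)).symm)).hasSum_iff.mpr h3
    have h5 : (∑ v ∈ TF B m, c v * qq h τ ^ nQ B v) = (PowerSeries.mk fun m => ∑ v ∈ TF B m, c v).coeff m * qq h τ ^ m := by
      rw [PowerSeries.coeff_mk, Finset.sum_mul]
      refine Finset.sum_congr rfl fun v hv => ?_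
      rw [(mem_TF' hB).mp hv]
    rw [← h5]
    exact h4)
  exact h2

lemma thT_eq (hB : IsLeech B) (τ : ℂ) (z : CV) (v : LV) :
    thT B τ z v = eC (pairC B (liftC v) z) * eC τ ^ nQ B v := by
  unfold thT
  rw [← eC_nat_mul, ← eC_add, hB.two_nQ]
  unfold eC
  congr 1
  push_cast; ring

def thF (B : MZ) (τ : ℍ) (z : CV) : ℂ := ∑' v : LV, thT B τ z v

lemma qq_one (τ : ℍ) : qq 1 τ = eC τ := by unfold qq; simp

lemma thF_hasSum (hB : IsLeech B) (τ : ℍ) (z : CV) :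
    HasSum (fun v => eC (pairC B (liftC v) z) * qq 1 τ ^ nQ B v) (thF B τ z) := by
  have := (summable_thT hB τ.im_pos z).hasSum
  refine this.congr_fun fun v => ?_
  rw [thT_eq hB, qq_one]

lemma coe_S (τ : ℍ) : ((ModularGroup.S • τ : ℍ) : ℂ) = -1 / τ := by
  rw [UpperHalfPlane.modular_S_smul]
  show (-(τ : ℂ))⁻¹ = _
  rw [inv_neg, neg_div, one_div]

lemma thF_S (hB : IsLeech B) (τ : ℍ) (z : CV) : thF B (ModularGroup.S • τ) ((τ : ℂ)⁻¹ • z) =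
    (τ : ℂ) ^ 12 * cexp (π * Complex.I * pairC B z z / τ) * thF B τ z := by
  unfold thF
  rw [coe_S]
  exact theta_inversion hB τ.im_pos z

lemma qq_one_T (τ : ℍ) : qq 1 ((1 : ℝ) +ᵥ τ) = qq 1 τ := by
  rw [qq_one, qq_one]
  have : (((1 : ℝ) +ᵥ τ : ℍ) : ℂ) = ((1 : ℤ) : ℂ) + τ := by simp
  rw [this, eC_add, eC_int, one_mul]

lemma thF_hasQ (hB : IsLeech B) (z : CV) :
    HasQ 1 (fun τ => thF B τ z) (PowerSeries.mk fun m => ∑ v ∈ TF B m, eC (pairC B (liftC v) z)) :=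
  hasQ_of_lv hB fun τ => thF_hasSum hB τ z

lemma theta0_hasQ (hB : IsLeech B) :
    HasQ 1 (fun τ => thF B τ 0) (PowerSeries.mk fun m => ((TF B m).card : ℂ)) := by
  have := thF_hasQ hB 0
  simpa [pairC_zero_right, eC_zero] using this

lemma TF_zero (hB : IsLeech B) : TF B 0 = {0} := by
  ext v
  rw [mem_TF hB, Finset.mem_singleton]
  constructor
  · intro h; exact hB.eq_zero (by simp [h])
  · rintro rfl; simp [pairZ]
lemma TF_one (hB : IsLeech B) : TF B 1 = ∅ := by
  ext v
  rw [mem_TF hB]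
  simpa using hB.2.2.2.2 v

end shells

section eis
open ModularForm EisensteinSeries ModularGroup

lemma mf_slash {k : ℤ} (f : ModularForm 𝒮ℒ k) (A : SL(2, ℤ)) : (⇑f) ∣[k] A = ⇑f :=
  SlashInvariantForm.slash_action_eqn f _ ⟨A, rfl⟩
lemma mf_S {k : ℤ} (f : ModularForm 𝒮ℒ k) (τ : ℍ) : f (S • τ) = (τ : ℂ) ^ k * f τ := by
  have := congrFun (mf_slash f S) τ
  rw [SL_slash_apply, ModularGroup.denom_S] at this
  rw [← this, mul_comm, mul_assoc, ← zpow_add₀ τ.ne_zero]; simp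
lemma mf_T {k : ℤ} (f : ModularForm 𝒮ℒ k) (τ : ℍ) : f ((1 : ℝ) +ᵥ τ) = f τ := by
  have := congrFun (mf_slash f T) τ
  rw [SL_slash_apply, UpperHalfPlane.modular_T_smul] at this
  rw [← this, denom_T, _root_.one_zpow, mul_one]
lemma mf_hasQ {k : ℤ} (f : ModularForm 𝒮ℒ k) : HasQ 1 f (qExpansion 1 f) := by
  intro τ
  have := UpperHalfPlane.hasSum_qExpansion (h:=1) one_pos (SlashInvariantFormClass.periodic_comp_ofComplex f one_mem_strictPeriods_SL) (ModularFormClass.holo f) (ModularFormClass.bdd_at_infty f) τ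
  refine this.congr_fun fun m => ?_
  rw [smul_eq_mul]
  congr 2
  unfold qq eC Function.Periodic.qParam
  simp

def e4 : PowerSeries ℂ := qExpansion 1 E₄
def e6 : PowerSeries ℂ := qExpansion 1 E₆
lemma e4_coeff (m : ℕ) : e4.coeff m = if m = 0 then 1 else 240 * (ArithmeticFunction.sigma 3 m : ℂ) := by
  unfold e4
  rw [EisensteinSeries.E_qExpansion_coeff _ (by decide)]
  split_ifs <;> norm_num [bernoulli_eq_bernoulli'_of_ne_one, bernoulli'_four]
lemma bernoulli'_six : bernoulli' 6 = 1/42 := by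
  rw [bernoulli'_def]
  norm_num [Finset.sum_range_succ, Nat.choose, bernoulli'_def 5, bernoulli'_four, bernoulli'_three]
lemma e6_coeff (m : ℕ) : e6.coeff m = if m = 0 then 1 else -504 * (ArithmeticFunction.sigma 5 m : ℂ) := by
  unfold e6
  rw [EisensteinSeries.E_qExpansion_coeff _ (by decide)]
  split_ifs <;> norm_num [bernoulli_eq_bernoulli'_of_ne_one, bernoulli'_six]
lemma e4_vals : e4.coeff 0 = 1 ∧ e4.coeff 1 = 240 ∧ e4.coeff 2 = 2160 ∧ e4.coeff 3 = 6720 ∧ e4.coeff 4 = 17520 ∧ e4.coeff 5 = 30240 ∧ e4.coeff 6 = 60480 ∧ e4.coeff 7 = 82560 ∧ e4.coeff 8 = 140400 := by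
  simp only [e4_coeff]
  have h : ∀ m, (ArithmeticFunction.sigma 3 m : ℂ) = ((ArithmeticFunction.sigma 3 m : ℕ) : ℂ) := fun m => rfl
  have h2 : ArithmeticFunction.sigma 3 2 = 9 := by decide
  have h3 : ArithmeticFunction.sigma 3 3 = 28 := by decide
  have h4 : ArithmeticFunction.sigma 3 4 = 73 := by decide
  have h5 : ArithmeticFunction.sigma 3 5 = 126 := by decide
  have h6 : ArithmeticFunction.sigma 3 6 = 252 := by decide
  have h7 : ArithmeticFunction.sigma 3 7 = 344 := by decide
  have h8 : ArithmeticFunction.sigma 3 8 = 585 := by decide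
  norm_num [h2,h3,h4,h5,h6,h7,h8]
lemma e6_vals : e6.coeff 0 = 1 ∧ e6.coeff 1 = -504 ∧ e6.coeff 2 = -16632 ∧ e6.coeff 3 = -122976 ∧ e6.coeff 4 = -532728 ∧ e6.coeff 5 = -1575504 ∧ e6.coeff 6 = -4058208 ∧ e6.coeff 7 = -8471232 ∧ e6.coeff 8 = -17047800 := by
  simp only [e6_coeff]
  have h2 : ArithmeticFunction.sigma 5 2 = 33 := by decide
  have h3 : ArithmeticFunction.sigma 5 3 = 244 := by decide
  have h4 : ArithmeticFunction.sigma 5 4 = 1057 := by decide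
  have h5 : ArithmeticFunction.sigma 5 5 = 3126 := by decide
  have h6 : ArithmeticFunction.sigma 5 6 = 8052 := by decide
  have h7 : ArithmeticFunction.sigma 5 7 = 16808 := by decide
  have h8 : ArithmeticFunction.sigma 5 8 = 33825 := by decide
  norm_num [h2,h3,h4,h5,h6,h7,h8]
end eis

lemma HasQ.T_inv {F : ℍ → ℂ} {p : PowerSeries ℂ} (hF : HasQ 1 F p) (τ : ℍ) : F ((1 : ℝ) +ᵥ τ) = F τ := by
  refine (hF _).unique ?_
  rw [qq_one_T]; exact hF τ

lemma modular_zero_q {F : ℍ → ℂ} {p : PowerSeries ℂ} {K : ℤ} {M : ℕ} (hF : HasQ 1 F p)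
    (hS : ∀ τ : ℍ, F (ModularGroup.S • τ) = (τ : ℂ) ^ K * F τ) (hM : ∀ m < M, p.coeff m = 0)
    (hK : K < 12 * M) : p = 0 := by
  have h0 : F = fun _ => 0 := by
    funext τ
    refine modular_zero (hF.mdiff one_pos) hS hF.T_inv ?_ hK τ
    obtain ⟨C, hC⟩ := hF.bound one_pos hM
    exact ⟨C, by simpa using hC⟩
  subst h0
  exact hF.eq_zero one_pos

section count
open ModularForm
variable {B : MZ}

lemma ps_mul_coeff (p r : PowerSeries ℂ) (n : ℕ) : (p * r).coeff n = ∑ k ∈ Finset.range (n+1), p.coeff k * r.coeff (n - k) := by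
  rw [PowerSeries.coeff_mul, Finset.Nat.sum_antidiagonal_eq_sum_range_succ (fun i j => p.coeff i * r.coeff j)]

lemma theta_ps (hB : IsLeech B) : (PowerSeries.mk fun m => ((TF B m).card : ℂ)) =
    PowerSeries.C (7/12) * (e4 * e4 * e4) + PowerSeries.C (5/12) * (e6 * e6) := by
  have h4 : HasQ 1 (fun τ => E₄ τ) e4 := mf_hasQ E₄
  have h6 : HasQ 1 (fun τ => E₆ τ) e6 := mf_hasQ E₆
  have hF := (theta0_hasQ hB).sub ((((h4.mul h4).mul h4).const_mul (7/12)).add ((h6.mul h6).const_mul (5/12)))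
  refine sub_eq_zero.mp (modular_zero_q (K := 12) (M := 2) hF ?_ ?_ (by norm_num))
  · intro τ
    have h1 := thF_S hB τ 0
    rw [smul_zero, pairC_zero_right, mul_zero, zero_div, Complex.exp_zero, mul_one] at h1
    show thF B _ 0 - _ = _ * (thF B τ 0 - _)
    rw [h1, mf_S, mf_S]
    have e1 : (τ : ℂ) ^ (4 : ℤ) = (τ : ℂ) ^ 4 := by norm_cast
    have e2 : (τ : ℂ) ^ (6 : ℤ) = (τ : ℂ) ^ 6 := by norm_cast
    have e3 : (τ : ℂ) ^ (12 : ℤ) = (τ : ℂ) ^ 12 := by norm_cast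
    rw [e1, e2, e3]; ring
  · intro m hm
    obtain ⟨a0, a1, -⟩ := e4_vals
    obtain ⟨b0, b1, -⟩ := e6_vals
    interval_cases m
    · rw [PowerSeries.coeff_zero_eq_constantCoeff_apply] at a0 b0
      simp [a0, b0, TF_zero hB]; norm_num
    · simp [ps_mul_coeff, a0, b0, a1, b1, TF_one hB, Finset.sum_range_succ]; norm_num

lemma card_TF (hB : IsLeech B) : (TF B 2).card = 196560 ∧ (TF B 3).card = 16773120 ∧ (TF B 4).card = 398034000
    ∧ (TF B 5).card = 4629381120 ∧ (TF B 7).card = 187489935360 ∧ (TF B 8).card = 814879774800 := by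
  have h := fun m => congrArg (PowerSeries.coeff m) (theta_ps hB)
  obtain ⟨a0, a1, a2, a3, a4, a5, a6, a7, a8⟩ := e4_vals
  obtain ⟨b0, b1, b2, b3, b4, b5, b6, b7, b8⟩ := e6_vals
  have key : ∀ m : ℕ, ∀ n : ℕ, (PowerSeries.C (7/12) * (e4 * e4 * e4) + PowerSeries.C (5/12) * (e6 * e6)).coeff m = (n : ℂ) → (TF B m).card = n := by
    intro m n hn
    have := h m
    rw [hn, PowerSeries.coeff_mk] at this
    exact_mod_cast this
  refine ⟨key _ _ ?_, key _ _ ?_, key _ _ ?_, key _ _ ?_, key _ _ ?_, key _ _ ?_⟩ <;>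
  · rw [map_add, PowerSeries.coeff_C_mul, PowerSeries.coeff_C_mul]
    simp only [ps_mul_coeff, Finset.sum_range_succ, Finset.sum_range_zero, Nat.reduceAdd, Nat.reduceSub, Nat.sub_zero, Nat.sub_self, a0, a1, a2, a3, a4, a5, a6, a7, a8, b0, b1, b2, b3, b4, b5, b6, b7, b8]
    norm_num
end count

section modn
variable {B : MZ}

def red (n : ℕ) (v : LV) : Fin 24 → ZMod n := fun i => (v i : ZMod n)

lemma red_eq_iff {n : ℕ} {v w : LV} : red n v = red n w ↔ ∃ u : LV, v - w = (n : ℤ) • u := by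
  constructor
  · intro h
    have : ∀ i, ∃ k : ℤ, v i - w i = n * k := fun i =>
      (ZMod.intCast_eq_intCast_iff_dvd_sub (w i) (v i) n).mp (congrFun h i).symm
    choose u hu using this
    exact ⟨u, by ext i; simpa using hu i⟩
  · rintro ⟨u, hu⟩
    ext i
    have : v i - w i = n * u i := by simpa using congrFun hu i
    exact ((ZMod.intCast_eq_intCast_iff_dvd_sub (w i) (v i) n).mpr ⟨u i, this⟩).symm
lemma red_neg {n : ℕ} (v : LV) : red n (-v) = - red n v := by ext i; simp [red]
lemma red_add {n : ℕ} (v w : LV) : red n (v + w) = red n v + red n w := by ext i; simp [red]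
lemma red_sub {n : ℕ} (v w : LV) : red n (v - w) = red n v - red n w := by ext i; simp [red]

lemma red_surj {n : ℕ} : Function.Surjective (red n) := by
  intro x
  choose f hf using fun i => ZMod.intCast_surjective (x i)
  exact ⟨f, by ext i; exact hf i⟩

lemma red2_neg (v : LV) : red 2 (-v) = red 2 v := by
  rw [red_eq_iff]; exact ⟨-v, by ext i; simp; ring⟩

lemma mod2_key (hB : IsLeech B) {v w : LV} (h : red 2 v = red 2 w) (h1 : v ≠ w) (h2 : v ≠ -w) :
    16 ≤ pairZ B v v - 2 * pairZ B v w + pairZ B w w ∧ 16 ≤ pairZ B v v + 2 * pairZ B v w + pairZ B w w := by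
  constructor
  · obtain ⟨u, hu⟩ := red_eq_iff.mp h
    rw [← hB.norm_sub, hu, pairZ_smul_left, pairZ_smul_right]
    have : u ≠ 0 := by rintro rfl; rw [smul_zero] at hu; exact h1 (sub_eq_zero.mp hu)
    have := hB.pos this
    push_cast; lia
  · rw [← red2_neg w] at h
    obtain ⟨u, hu⟩ := red_eq_iff.mp h
    rw [sub_neg_eq_add] at hu
    rw [← hB.norm_add, hu, pairZ_smul_left, pairZ_smul_right]
    have : u ≠ 0 := by rintro rfl; rw [smul_zero] at hu; exact h2 (eq_neg_of_add_eq_zero_left hu)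
    have := hB.pos this
    push_cast; lia

lemma neg_mem_TF (hB : IsLeech B) {m : ℕ} {v : LV} : -v ∈ TF B m ↔ v ∈ TF B m := by
  rw [mem_TF hB, mem_TF hB, pairZ_neg_left, pairZ_neg_right, neg_neg]

lemma fib_small (hB : IsLeech B) {m : ℕ} (hm : m < 4) (y : Fin 24 → ZMod 2) :
    ((TF B m).filter (fun x => red 2 x = y)).card ≤ 2 := by
  classical
  by_cases h : ((TF B m).filter (fun x => red 2 x = y)) = ∅
  · simp [h]
  obtain ⟨x, hx⟩ := Finset.nonempty_iff_ne_empty.mpr h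
  refine (Finset.card_le_card (t := {x, -x}) ?_).trans (Finset.card_le_two)
  intro z hz
  rw [Finset.mem_filter, mem_TF hB] at hx hz
  by_contra hc
  simp only [Finset.mem_insert, Finset.mem_singleton, not_or] at hc
  have := mod2_key hB (hz.2.trans hx.2.symm) hc.1 hc.2
  lia

lemma card_orth (hB : IsLeech B) (H : Finset LV) (h0 : ∀ v ∈ H, v ≠ 0) (h : ∀ v ∈ H, ∀ w ∈ H, v ≠ w → pairZ B v w = 0) :
    H.card ≤ 24 := by
  have hl : LinearIndependent ℤ (fun v : H => (v : LV)) := by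
    rw [Fintype.linearIndependent_iff]
    intro g hg j
    have h1 := congrArg (fun x => pairZ B x (j : LV)) hg
    simp only [pairZ_sum_left, pairZ_smul_left, pairZ_zero_left] at h1
    rw [Finset.sum_eq_single j (fun i _ hi => by rw [h i i.2 j j.2 (fun h => hi (Subtype.ext h)), mul_zero]) (by simp)] at h1
    have := hB.pos (h0 j j.2)
    rcases mul_eq_zero.mp h1 with h | h
    · exact h
    · lia
  have := hl.fintype_card_le_finrank
  simpa using this

lemma fib_T4_orth (hB : IsLeech B) {x y : LV} (hx : x ∈ TF B 4) (hy : y ∈ TF B 4) (h : red 2 x = red 2 y) (h1 : x ≠ y) (h2 : x ≠ -y) :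
    pairZ B x y = 0 := by
  have := mod2_key hB h h1 h2
  rw [mem_TF hB] at hx hy
  lia

def posL (v : LV) : Prop := ∃ i, 0 < v i ∧ ∀ j < i, v j = 0
lemma posL_or {v : LV} (hv : v ≠ 0) : posL v ∨ posL (-v) := by
  obtain ⟨i0, h0⟩ := Function.ne_iff.mp hv
  obtain ⟨i, hi, hm⟩ := WellFounded.has_min (wellFounded_lt (α := Fin 24)) {i | v i ≠ 0} ⟨i0, h0⟩
  have hm' : ∀ j < i, v j = 0 := fun j hj => by by_contra hc; exact hm j hc hj
  rcases lt_or_gt_of_ne (show v i ≠ 0 from hi) with h | h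
  · exact Or.inr ⟨i, by simpa using h, fun j hj => by simp [hm' j hj]⟩
  · exact Or.inl ⟨i, h, hm'⟩
lemma posL_not {v : LV} (h1 : posL v) (h2 : posL (-v)) : False := by
  obtain ⟨i, hi, hi'⟩ := h1
  obtain ⟨j, hj, hj'⟩ := h2
  simp only [Pi.neg_apply, neg_eq_zero] at hj hj'
  rcases lt_trichotomy i j with h | h | h
  · have := hj' i h; lia
  · subst h; lia
  · have := hi' j h; lia

open scoped Classical in
lemma half_card (S : Finset LV) (h0 : ∀ v ∈ S, v ≠ 0) (hn : ∀ v ∈ S, -v ∈ S) : S.card = 2 * (S.filter posL).card := by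
  have h1 : S = S.filter posL ∪ (S.filter posL).image (fun v => -v) := by
    ext v
    simp only [Finset.mem_union, Finset.mem_filter, Finset.mem_image]
    constructor
    · intro hv
      rcases posL_or (h0 v hv) with h | h
      · exact Or.inl ⟨hv, h⟩
      · exact Or.inr ⟨-v, ⟨hn v hv, h⟩, neg_neg v⟩
    · rintro (h | ⟨w, hw, rfl⟩)
      · exact h.1
      · exact hn w hw.1
  have h2 : Disjoint (S.filter posL) ((S.filter posL).image (fun v => -v)) := by
    rw [Finset.disjoint_left]
    intro v hv hv'
    simp only [Finset.mem_filter, Finset.mem_image] at hv hv'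
    obtain ⟨w, hw, rfl⟩ := hv'
    exact posL_not hw.2 hv.2
  conv_lhs => rw [h1]
  rw [Finset.card_union_of_disjoint h2, Finset.card_image_of_injective _ neg_injective]; ring

lemma TF_ne (hB : IsLeech B) {m : ℕ} (hm : m ≠ 0) {v : LV} (hv : v ∈ TF B m) : v ≠ 0 := by
  rintro rfl; rw [mem_TF hB, pairZ_zero_left] at hv; lia

open scoped Classical in
lemma fib_T4 (hB : IsLeech B) (y : Fin 24 → ZMod 2) :
    ((TF B 4).filter (fun x => red 2 x = y)).card = 2 * (((TF B 4).filter (fun x => red 2 x = y)).filter posL).card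
    ∧ (((TF B 4).filter (fun x => red 2 x = y)).filter posL).card ≤ 24 := by
  constructor
  · apply half_card
    · intro v hv; exact TF_ne hB (by norm_num) (Finset.mem_filter.mp hv).1
    · intro v hv
      rw [Finset.mem_filter] at hv ⊢
      exact ⟨(neg_mem_TF hB).mpr hv.1, by rw [red2_neg]; exact hv.2⟩
  · apply card_orth hB
    · intro v hv; exact TF_ne hB (by norm_num) (Finset.mem_filter.mp (Finset.mem_filter.mp hv).1).1
    · intro v hv w hw hvw
      simp only [Finset.mem_filter] at hv hw
      refine fib_T4_orth hB hv.1.1 hw.1.1 (hv.1.2.trans hw.1.2.symm) hvw ?_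
      rintro rfl
      exact posL_not hw.2 hv.2

lemma disj_im (hB : IsLeech B) {m n : ℕ} (hmn : m ≠ n) (h : m + n < 8) :
    Disjoint ((TF B m).image (red 2)) ((TF B n).image (red 2)) := by
  rw [Finset.disjoint_left]
  intro y h1 h2
  obtain ⟨v, hv, rfl⟩ := Finset.mem_image.mp h1
  obtain ⟨w, hw, hvw⟩ := Finset.mem_image.mp h2
  rw [mem_TF hB] at hv hw
  have hne : pairZ B v v ≠ pairZ B w w := by rw [hv, hw]; lia
  have := mod2_key hB hvw (by rintro rfl; exact hne rfl) (by rintro rfl; apply hne; rw [pairZ_neg_left, pairZ_neg_right, neg_neg])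
  lia

lemma mod2_count (hB : IsLeech B) :
    (TF B 0).image (red 2) ∪ (TF B 2).image (red 2) ∪ (TF B 3).image (red 2) ∪ (TF B 4).image (red 2) = Finset.univ
    ∧ ((TF B 4).image (red 2)).card = 8292375 := by
  obtain ⟨n2, n3, n4, -⟩ := card_TF hB
  have c2 := Finset.card_le_mul_card_image (f := red 2) (TF B 2) 2 (fun y _ => fib_small hB (by norm_num) y)
  have c3 := Finset.card_le_mul_card_image (f := red 2) (TF B 3) 2 (fun y _ => fib_small hB (by norm_num) y)
  have c4 := Finset.card_le_mul_card_image (f := red 2) (TF B 4) 48 (fun y _ => by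
    have := fib_T4 hB y
    lia)
  have c0 : ((TF B 0).image (red 2)).card = 1 := by simp [TF_zero hB]
  have hd1 := disj_im hB (m := 0) (n := 2) (by norm_num) (by norm_num)
  have hd2 := disj_im hB (m := 0) (n := 3) (by norm_num) (by norm_num)
  have hd3 := disj_im hB (m := 0) (n := 4) (by norm_num) (by norm_num)
  have hd4 := disj_im hB (m := 2) (n := 3) (by norm_num) (by norm_num)
  have hd5 := disj_im hB (m := 2) (n := 4) (by norm_num) (by norm_num)
  have hd6 := disj_im hB (m := 3) (n := 4) (by norm_num) (by norm_num)
  have hU : ((TF B 0).image (red 2) ∪ (TF B 2).image (red 2) ∪ (TF B 3).image (red 2) ∪ (TF B 4).image (red 2)).card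
    = ((TF B 0).image (red 2)).card + ((TF B 2).image (red 2)).card + ((TF B 3).image (red 2)).card + ((TF B 4).image (red 2)).card := by
    rw [Finset.card_union_of_disjoint, Finset.card_union_of_disjoint, Finset.card_union_of_disjoint hd1]
    · simp [Finset.disjoint_union_left, hd2, hd4]
    · simp only [Finset.disjoint_union_left]; exact ⟨⟨hd3, hd5⟩, hd6⟩
  have hcu : (Finset.univ : Finset (Fin 24 → ZMod 2)).card = 16777216 := by
    rw [Finset.card_univ, Fintype.card_fun, ZMod.card, Fintype.card_fin]; norm_num
  have hle := Finset.card_le_univ ((TF B 0).image (red 2) ∪ (TF B 2).image (red 2) ∪ (TF B 3).image (red 2) ∪ (TF B 4).image (red 2))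
  rw [← Finset.card_univ, hcu] at hle
  constructor
  · apply Finset.eq_univ_of_card
    rw [← Finset.card_univ, hcu]; lia
  · lia

lemma mod2_cover (hB : IsLeech B) (v : LV) : ∃ w, (w ∈ TF B 0 ∨ w ∈ TF B 2 ∨ w ∈ TF B 3 ∨ w ∈ TF B 4) ∧ red 2 v = red 2 w := by
  have := Finset.mem_univ (red 2 v)
  rw [← (mod2_count hB).1] at this
  simp only [Finset.mem_union, Finset.mem_image] at this
  rcases this with ((⟨w, hw, h⟩ | ⟨w, hw, h⟩) | ⟨w, hw, h⟩) | ⟨w, hw, h⟩ <;> exact ⟨w, by tauto, h.symm⟩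

lemma fib_T4_eq (hB : IsLeech B) {x : LV} (hx : x ∈ TF B 4) : ((TF B 4).filter (fun z => red 2 z = red 2 x)).card = 48 := by
  have h1 := Finset.card_eq_sum_card_image (red 2) (TF B 4)
  obtain ⟨n2, n3, n4, -⟩ := card_TF hB
  have hle : ∀ y ∈ (TF B 4).image (red 2), ((TF B 4).filter (fun z => red 2 z = y)).card ≤ 48 := fun y _ => by
    have := fib_T4 hB y
    lia
  by_contra hc
  have hlt := Finset.sum_lt_sum hle ⟨red 2 x, Finset.mem_image_of_mem _ hx, lt_of_le_of_ne (hle _ (Finset.mem_image_of_mem _ hx)) hc⟩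
  rw [← h1, Finset.sum_const, (mod2_count hB).2, n4] at hlt
  norm_num at hlt

structure IsFrame (B : MZ) (a : Fin 24 → LV) : Prop where
  ip : ∀ i j, pairZ B (a i) (a j) = if i = j then 8 else 0
  cong : ∀ i j, red 2 (a i) = red 2 (a j)

lemma IsFrame.neg {a : Fin 24 → LV} (h : IsFrame B a) : IsFrame B (fun i => - a i) :=
  ⟨fun i j => by rw [pairZ_neg_left, pairZ_neg_right, neg_neg, h.ip], fun i j => by rw [red2_neg, red2_neg, h.cong i j]⟩

lemma exists_frame (hB : IsLeech B) {x : LV} (hx : x ∈ TF B 4) : ∃ a, IsFrame B a ∧ ∃ i, a i = x := by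
  classical
  set H := ((TF B 4).filter (fun z => red 2 z = red 2 x)).filter posL with hH
  have hc : H.card = 24 := by
    have := fib_T4 hB (red 2 x)
    have := fib_T4_eq hB hx
    lia
  let e := H.equivFinOfCardEq hc
  have hf : IsFrame B (fun i => (e.symm i : LV)) := by
    have hm : ∀ i, (e.symm i : LV) ∈ TF B 4 ∧ red 2 (e.symm i : LV) = red 2 x ∧ posL (e.symm i : LV) := by
      intro i
      have := (e.symm i).2
      simp only [hH, Finset.mem_filter] at this
      exact ⟨this.1.1, this.1.2, this.2⟩
    refine ⟨fun i j => ?_, fun i j => (hm i).2.1.trans (hm j).2.1.symm⟩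
    split_ifs with hij
    · subst hij
      have := (mem_TF hB).mp (hm i).1
      simpa using this
    · refine fib_T4_orth hB (hm i).1 (hm j).1 ((hm i).2.1.trans (hm j).2.1.symm) ?_ ?_
      · intro h; exact hij (e.symm.injective (Subtype.ext h))
      · intro h
        refine posL_not (hm j).2.2 ?_
        rw [← h]; exact (hm i).2.2
  rcases posL_or (TF_ne hB (by norm_num) hx) with h | h
  · refine ⟨_, hf, e ⟨x, ?_⟩, by simp⟩
    simp [hH, hx, h]
  · refine ⟨_, hf.neg, e ⟨-x, ?_⟩, by simp⟩
    simp [hH, (neg_mem_TF hB).mpr hx, h, red2_neg]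

lemma IsFrame.mem (hB : IsLeech B) {a : Fin 24 → LV} (h : IsFrame B a) (i) : a i ∈ TF B 4 := by
  rw [mem_TF hB, h.ip, if_pos rfl]; norm_num

lemma pairZ_eq_sum (v w : LV) : pairZ B v w = ∑ i, ∑ j, v i * B i j * w j := by
  simp [pairZ, dotProduct, mulVec, Finset.mul_sum, mul_assoc]

lemma IsFrame.expand (hB : IsLeech B) {a : Fin 24 → LV} (h : IsFrame B a) (v : LV) :
    (8 : ℤ) • v = ∑ i, pairZ B v (a i) • a i := by
  let A : MZ := Matrix.of a
  have h1 : A * B * Aᵀ = (8 : ℤ) • (1 : MZ) := by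
    ext i j
    have := h.ip i j
    rw [pairZ_eq_sum] at this
    simp only [Matrix.smul_apply, Matrix.one_apply, Matrix.mul_apply, Matrix.transpose_apply, A, Matrix.of_apply]
    rw [Finset.sum_comm] at this
    simp only [Finset.sum_mul]
    rw [this]; split_ifs <;> simp
  have hd : A.det ≠ 0 := by
    intro h0
    have := congrArg Matrix.det h1
    rw [Matrix.det_mul, Matrix.det_mul, h0, Matrix.det_smul] at this
    simp at this
  have h2 : Aᵀ * (A * B) = (8 : ℤ) • (1 : MZ) := by
    have h3 : (Aᵀ * (A * B) - (8 : ℤ) • (1 : MZ)) * Aᵀ = 0 := by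
      rw [Matrix.sub_mul, Matrix.mul_assoc, h1, Matrix.mul_smul, Matrix.smul_mul, Matrix.mul_one, Matrix.one_mul, sub_self]
    have h4 := congrArg (fun M => M * Aᵀ.adjugate) h3
    simp only [Matrix.mul_assoc, Matrix.mul_adjugate, Matrix.zero_mul, Matrix.mul_smul, Matrix.mul_one, Matrix.det_transpose] at h4
    exact sub_eq_zero.mp ((smul_eq_zero.mp h4).resolve_left hd)
  have h5 := congrArg (fun M => M.mulVec v) h2
  simp only [Matrix.smul_mulVec, Matrix.one_mulVec] at h5
  rw [← h5]
  ext k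
  simp only [← Matrix.mulVec_mulVec, Finset.sum_apply, Pi.smul_apply, smul_eq_mul]
  rw [Matrix.mulVec, dotProduct]
  refine Finset.sum_congr rfl fun i _ => ?_
  rw [hB.comm v (a i)]
  simp only [pairZ, Matrix.transpose_apply, A, Matrix.of_apply, mul_comm]
  rfl

lemma IsFrame.parseval (hB : IsLeech B) {a : Fin 24 → LV} (h : IsFrame B a) (v w : LV) :
    8 * pairZ B v w = ∑ i, pairZ B v (a i) * pairZ B w (a i) := by
  rw [← pairZ_smul_left, h.expand hB v, pairZ_sum_left]
  exact Finset.sum_congr rfl fun i _ => by rw [pairZ_smul_left, hB.comm w]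
end modn

section design
variable {B : MZ}

lemma norm_qq_nQ (hB : IsLeech B) (τ : ℍ) (v : LV) : ‖qq 1 τ ^ nQ B v‖ = Real.exp (-(π * τ.im) * (pairZ B v v : ℝ)) := by
  rw [norm_pow, norm_qq one_pos, ← Real.exp_nat_mul]
  congr 1
  rw [hB.two_nQ]; push_cast; ring

def mom (B : MZ) (x : CV) (k : ℕ) (τ : ℍ) : ℂ :=
  ∑' v : LV, pairC B (liftC v) x ^ k * qq 1 τ ^ nQ B v

def dT (B : MZ) (x : CV) (τ : ℍ) (w : ℂ) (p : LV × ℕ) : ℂ :=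
  (2 * π * Complex.I * w * pairC B (liftC p.1) x) ^ p.2 / (p.2.factorial : ℂ) * qq 1 τ ^ nQ B p.1

lemma summable_dT (hB : IsLeech B) (x : CV) (τ : ℍ) (w : ℂ) : Summable (dT B x τ w) := by
  apply Summable.of_norm
  have h1 : ∀ v : LV, HasSum (fun k => ‖dT B x τ w (v, k)‖)
      (Real.exp (‖2 * π * Complex.I * w * pairC B (liftC v) x‖) * Real.exp (-(π * τ.im) * (pairZ B v v : ℝ))) := by
    intro v
    have := (NormedSpace.expSeries_div_hasSum_exp (‖2 * π * Complex.I * w * pairC B (liftC v) x‖)).mul_right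
      (Real.exp (-(π * τ.im) * (pairZ B v v : ℝ)))
    rw [← Real.exp_eq_exp_ℝ] at this
    refine this.congr_fun fun k => ?_
    unfold dT
    rw [norm_mul, norm_qq_nQ hB, norm_div, norm_pow, Complex.norm_natCast]
  refine (summable_prod_of_nonneg (fun _ => norm_nonneg _)).mpr ⟨fun v => (h1 v).summable, ?_⟩
  have h2 : (fun v => ∑' k, ‖dT B x τ w (v, k)‖) = fun v => (Real.exp (‖2 * π * Complex.I * w * pairC B (liftC v) x‖) * Real.exp (-(π * τ.im) * (pairZ B v v : ℝ))) :=
    funext fun v => (h1 v).tsum_eq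
  rw [h2]
  refine Summable.of_nonneg_of_le (fun v => by positivity) (fun v => ?_)
    (summable_gauss hB (mul_pos Real.pi_pos τ.im_pos) (2 * π * ‖w‖ * (KB B * ‖x‖)))
  rw [← Real.exp_add]
  apply Real.exp_le_exp.mpr
  have := norm_pairC_lift_le (B := B) v x
  have h3 : ‖2 * π * Complex.I * w * pairC B (liftC v) x‖ = 2 * π * ‖w‖ * ‖pairC B (liftC v) x‖ := by
    simp [abs_of_pos Real.pi_pos]
  rw [h3]
  have := mul_le_mul_of_nonneg_left this (show 0 ≤ 2 * π * ‖w‖ by positivity)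
  linarith

lemma thF_taylor (hB : IsLeech B) (x : CV) (τ : ℍ) (w : ℂ) :
    HasSum (fun k => (2 * π * Complex.I) ^ k / (k.factorial : ℂ) * mom B x k τ * w ^ k) (thF B τ (w • x)) := by
  have hs := summable_dT hB x τ w
  have h1 : HasSum (dT B x τ w) (thF B τ (w • x)) := by
    have h2 := hs.hasSum.prod_fiberwise (g := fun v => eC (pairC B (liftC v) (w • x)) * qq 1 τ ^ nQ B v) (fun v => by
      have := (NormedSpace.expSeries_div_hasSum_exp (2 * π * Complex.I * w * pairC B (liftC v) x)).mul_right (qq 1 τ ^ nQ B v)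
      rw [← Complex.exp_eq_exp_ℂ] at this
      have he : eC (pairC B (liftC v) (w • x)) = cexp (2 * π * Complex.I * w * pairC B (liftC v) x) := by
        rw [pairC_smul_right]; unfold eC; congr 1; ring
      rw [he]; exact this)
    rw [← h2.unique (thF_hasSum hB τ (w • x))]
    exact hs.hasSum
  have h3 := ((Equiv.prodComm ℕ LV).hasSum_iff.mpr h1).prod_fiberwise
    (g := fun k => ∑' v, dT B x τ w (v, k)) (fun k => (hs.prod_symm.prod_factor k).hasSum)
  refine h3.congr_fun fun k => ?_
  unfold mom dT
  rw [← tsum_mul_left, ← tsum_mul_right]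
  refine tsum_congr fun v => ?_
  simp only [mul_pow]; ring

lemma mom_hasSum (hB : IsLeech B) (x : CV) (k : ℕ) (τ : ℍ) :
    HasSum (fun v => pairC B (liftC v) x ^ k * qq 1 τ ^ nQ B v) (mom B x k τ) := by
  refine Summable.hasSum ?_
  have := (summable_dT hB x τ 1).prod_symm.prod_factor k
  have h2 := this.mul_left ((k.factorial : ℂ) / (2 * π * Complex.I) ^ k)
  refine h2.congr fun v => ?_
  have hk : (k.factorial : ℂ) ≠ 0 := by exact_mod_cast k.factorial_ne_zero
  have hp : (2 * π * Complex.I : ℂ) ^ k ≠ 0 := pow_ne_zero _ Complex.two_pi_I_ne_zero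
  simp only [dT, Prod.swap, mul_one, mul_pow (2 * π * Complex.I : ℂ)]
  field_simp

lemma mom_hasQ (hB : IsLeech B) (x : CV) (k : ℕ) :
    HasQ 1 (mom B x k) (PowerSeries.mk fun m => ∑ v ∈ TF B m, pairC B (liftC v) x ^ k) :=
  hasQ_of_lv hB fun τ => mom_hasSum hB x k τ

lemma exp_sq_ps (c : ℂ) : ∃ e : PowerSeries ℂ, e.coeff 0 = 1 ∧ ∀ w : ℂ, HasSum (fun k => e.coeff k * w ^ k) (cexp (c * w ^ 2)) := by
  refine ⟨PowerSeries.mk fun k => if Even k then c ^ (k / 2) / ((k / 2).factorial : ℂ) else 0, by simp, fun w => ?_⟩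
  have h := NormedSpace.expSeries_div_hasSum_exp (c * w ^ 2)
  rw [← Complex.exp_eq_exp_ℂ] at h
  have hi : Function.Injective (fun j : ℕ => 2 * j) := fun a b h => by simpa using h
  refine (hi.hasSum_iff ?_).mp (h.congr_fun ?_)
  · intro k hk
    rw [PowerSeries.coeff_mk, if_neg, zero_mul]
    rintro ⟨j, hj⟩
    exact hk ⟨j, by simp; lia⟩
  · intro j
    simp [mul_pow, ← pow_mul]; ring

lemma mom_S (hB : IsLeech B) {x y : CV} (hxy : pairC B x x = pairC B y y) (n : ℕ)
    (hm : ∀ m < n, ∀ τ, mom B x m τ = mom B y m τ) (τ : ℍ) :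
    mom B x n (ModularGroup.S • τ) - mom B y n (ModularGroup.S • τ) = (τ : ℂ) ^ (12 + n : ℤ) * (mom B x n τ - mom B y n τ) := by
  obtain ⟨e, he0, he⟩ := exp_sq_ps (π * Complex.I * pairC B x x / τ)
  have hτ := τ.ne_zero
  set g : ℍ → PowerSeries ℂ := fun τ => PowerSeries.mk fun k => (2 * π * Complex.I) ^ k / (k.factorial : ℂ) * (mom B x k τ - mom B y k τ) with hg
  have hG : ∀ τ' w, HasSum (fun k => (g τ').coeff k * w ^ k) (thF B τ' (w • x) - thF B τ' (w • y)) := by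
    intro τ' w
    refine ((thF_taylor hB x τ' w).sub (thF_taylor hB y τ' w)).congr_fun fun k => ?_
    rw [hg, PowerSeries.coeff_mk]; ring
  have hQ1 : HasQ 1 (fun t => thF B τ (qq 1 t • x) - thF B τ (qq 1 t • y)) (g τ) := fun t => hG τ _
  have hQ2 : HasQ 1 (fun t => cexp (π * Complex.I * pairC B x x / τ * qq 1 t ^ 2)) e := fun t => he _
  have hQ3 : HasQ 1 (fun t => thF B (ModularGroup.S • τ) ((τ : ℂ)⁻¹ • qq 1 t • x) - thF B (ModularGroup.S • τ) ((τ : ℂ)⁻¹ • qq 1 t • y))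
      (PowerSeries.mk fun k => (g (ModularGroup.S • τ)).coeff k * (τ : ℂ)⁻¹ ^ k) := by
    intro t
    have := hG (ModularGroup.S • τ) ((τ : ℂ)⁻¹ * qq 1 t)
    beta_reduce
    rw [smul_smul, smul_smul]
    refine this.congr_fun fun k => ?_
    rw [PowerSeries.coeff_mk]; ring
  have hQ4 := (hQ2.mul hQ1).const_mul ((τ : ℂ) ^ 12)
  have hEq : (PowerSeries.mk fun k => (g (ModularGroup.S • τ)).coeff k * (τ : ℂ)⁻¹ ^ k) = PowerSeries.C ((τ : ℂ) ^ 12) * (e * g τ) := by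
    refine hQ3.unique one_pos ?_
    have hfun : (fun t => thF B (ModularGroup.S • τ) ((τ : ℂ)⁻¹ • qq 1 t • x) - thF B (ModularGroup.S • τ) ((τ : ℂ)⁻¹ • qq 1 t • y)) =
        fun t => (τ : ℂ) ^ 12 * (cexp (π * Complex.I * pairC B x x / τ * qq 1 t ^ 2) * (thF B τ (qq 1 t • x) - thF B τ (qq 1 t • y))) := by
      funext t
      rw [thF_S hB, thF_S hB, pairC_smul_left, pairC_smul_left, pairC_smul_right, pairC_smul_right, ← hxy]
      have : π * Complex.I * (qq 1 t * (qq 1 t * pairC B x x)) / τ = π * Complex.I * pairC B x x / τ * qq 1 t ^ 2 := by ring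
      rw [this]; ring
    rw [hfun]; exact hQ4
  have hc := congrArg (PowerSeries.coeff n) hEq
  rw [PowerSeries.coeff_mk, PowerSeries.coeff_C_mul, ps_mul_coeff, Finset.sum_eq_single 0] at hc
  · rw [he0, one_mul, Nat.sub_zero] at hc
    simp only [hg, PowerSeries.coeff_mk] at hc
    have hk : (n.factorial : ℂ) ≠ 0 := by exact_mod_cast n.factorial_ne_zero
    have hp : (2 * π * Complex.I : ℂ) ^ n ≠ 0 := pow_ne_zero _ Complex.two_pi_I_ne_zero
    have h12 : (τ : ℂ) ^ (12 + n : ℤ) = (τ : ℂ) ^ 12 * (τ : ℂ) ^ n := by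
      rw [zpow_add₀ hτ]; norm_cast
    rw [h12]
    have hcc : (2 * π * Complex.I) ^ n / (n.factorial : ℂ) ≠ 0 := div_ne_zero hp hk
    apply mul_left_cancel₀ hcc
    have hn : (τ : ℂ) ^ n * (τ : ℂ)⁻¹ ^ n = 1 := by rw [← mul_pow, mul_inv_cancel₀ hτ, one_pow]
    linear_combination (τ : ℂ) ^ n * hc - (2 * π * Complex.I) ^ n / (n.factorial : ℂ) * (mom B x n (ModularGroup.S • τ) - mom B y n (ModularGroup.S • τ)) * hn
  · intro j hj hj0
    have : n - j < n := by
      rw [Finset.mem_range] at hj; lia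
    simp only [hg, PowerSeries.coeff_mk]
    rw [hm _ this]; simp
  · simp

theorem design_eq (hB : IsLeech B) {x y : CV} (hxy : pairC B x x = pairC B y y) (n : ℕ) (hn : n < 12) :
    ∀ m, ∑ v ∈ TF B m, pairC B (liftC v) x ^ n = ∑ v ∈ TF B m, pairC B (liftC v) y ^ n := by
  induction n using Nat.strong_induction_on with
  | _ n ih =>
  have hm : ∀ m < n, ∀ τ, mom B x m τ = mom B y m τ := by
    intro m hm τ
    refine (mom_hasQ hB x m τ).unique ?_
    have := mom_hasQ hB y m τ
    refine this.congr_fun fun k => ?_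
    rw [PowerSeries.coeff_mk, PowerSeries.coeff_mk, ih m hm (by lia)]
  have h0 := modular_zero_q (M := 2) (K := 12 + n) ((mom_hasQ hB x n).sub (mom_hasQ hB y n)) (mom_S hB hxy n hm) ?_ (by push_cast; lia)
  · intro m
    have := congrArg (PowerSeries.coeff m) h0
    simpa [sub_eq_zero] using this
  · intro m hm'
    interval_cases m
    · have : liftC 0 = 0 := by ext i; simp [liftC]
      simp [TF_zero hB, this, pairC]
    · simp [TF_one hB]

lemma coeff2_aux {T : Finset LV} {w α β : LV → ℂ} {c r r' : ℂ} {m : ℕ}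
    (h : ∀ s : ℂ, ∑ u ∈ T, w u * (α u + s * β u) ^ (2 * (m + 1)) = c * (r + s ^ 2 * r') ^ (m + 1)) :
    ((2 * (m + 1)).choose 2 : ℂ) * ∑ u ∈ T, w u * α u ^ (2 * m) * β u ^ 2 = c * (m + 1) * r ^ m * r' := by
  have hp : ∑ u ∈ T, Polynomial.C (w u) * (Polynomial.C (α u) + Polynomial.X * Polynomial.C (β u)) ^ (2 * (m + 1)) =
      Polynomial.C c * (Polynomial.C r + Polynomial.X ^ 2 * Polynomial.C r') ^ (m + 1) := by
    apply Polynomial.funext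
    intro s
    have := h s
    simp only [Polynomial.eval_finsetSum, Polynomial.eval_mul, Polynomial.eval_C, Polynomial.eval_pow, Polynomial.eval_add, Polynomial.eval_X]
    exact this
  have h1 : ∀ (a b : ℂ) (n : ℕ), ((Polynomial.C a + Polynomial.X * Polynomial.C b) ^ (n + 2)).coeff 2 = ((n + 2).choose 2 : ℂ) * a ^ n * b ^ 2 := by
    intro a b n
    rw [add_comm, add_pow, Polynomial.finsetSum_coeff, Finset.sum_eq_single 2]
    · have : (Polynomial.X * Polynomial.C b) ^ 2 * Polynomial.C a ^ (n + 2 - 2) * (((n + 2).choose 2 : ℕ) : Polynomial ℂ) = Polynomial.C (((n + 2).choose 2 : ℂ) * a ^ n * b ^ 2) * Polynomial.X ^ 2 := by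
        simp only [map_mul, map_pow, map_natCast, Nat.add_sub_cancel]; ring
      rw [this, Polynomial.coeff_C_mul_X_pow, if_pos rfl]
    · intro k _ hk
      have : (Polynomial.X * Polynomial.C b) ^ k * Polynomial.C a ^ (n + 2 - k) * (((n + 2).choose k : ℕ) : Polynomial ℂ) = Polynomial.C (((n + 2).choose k : ℂ) * a ^ (n + 2 - k) * b ^ k) * Polynomial.X ^ k := by
        simp only [map_mul, map_pow, map_natCast]; ring
      rw [this, Polynomial.coeff_C_mul_X_pow, if_neg hk.symm]
    · intro h; simp at h
  have h2 : ((Polynomial.C r + Polynomial.X ^ 2 * Polynomial.C r') ^ (m + 1)).coeff 2 = ((m : ℂ) + 1) * r ^ m * r' := by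
    rw [add_comm, add_pow, Polynomial.finsetSum_coeff, Finset.sum_eq_single 1]
    · have : (Polynomial.X ^ 2 * Polynomial.C r') ^ 1 * Polynomial.C r ^ (m + 1 - 1) * (((m + 1).choose 1 : ℕ) : Polynomial ℂ) = Polynomial.C (((m : ℂ) + 1) * r ^ m * r') * Polynomial.X ^ 2 := by
        simp only [map_mul, map_pow, map_natCast, map_add, map_one, Nat.add_sub_cancel, Nat.choose_one_right]; push_cast; ring
      rw [this, Polynomial.coeff_C_mul_X_pow, if_pos rfl]
    · intro k _ hk
      have : (Polynomial.X ^ 2 * Polynomial.C r') ^ k * Polynomial.C r ^ (m + 1 - k) * (((m + 1).choose k : ℕ) : Polynomial ℂ) = Polynomial.C (((m + 1).choose k : ℂ) * r ^ (m + 1 - k) * r' ^ k) * Polynomial.X ^ (2 * k) := by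
        simp only [map_mul, map_pow, map_natCast, ← pow_mul, mul_pow]; ring
      rw [this, Polynomial.coeff_C_mul_X_pow, if_neg (by lia)]
    · intro h; simp at h
  have h3 := congrArg (fun p => Polynomial.coeff p 2) hp
  simp only [Polynomial.finsetSum_coeff, Polynomial.coeff_C_mul, h2] at h3
  rw [Finset.mul_sum]
  rw [show c * (m + 1) * r ^ m * r' = c * (((m : ℂ) + 1) * r ^ m * r') by ring, ← h3]
  refine Finset.sum_congr rfl fun u _ => ?_
  rw [show 2 * (m + 1) = 2 * m + 2 by ring, h1]; ring

lemma exists_T4 (hB : IsLeech B) : ∃ x, x ∈ TF B 4 := by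
  have := (card_TF hB).2.2.1
  apply Finset.card_pos.mp
  lia

lemma design_M (hB : IsLeech B) {k : ℕ} (hk : k < 6) : ∃ M : ℂ, ∀ x : CV, ∑ v ∈ TF B 2, pairC B (liftC v) x ^ (2 * k) = M * pairC B x x ^ k := by
  obtain ⟨a, ha⟩ := exists_T4 hB
  rw [mem_TF hB] at ha
  refine ⟨(∑ v ∈ TF B 2, pairC B (liftC v) (liftC a) ^ (2 * k)) / 8 ^ k, fun x => ?_⟩
  obtain ⟨s, hs⟩ := IsAlgClosed.exists_pow_nat_eq (pairC B x x / 8) (n := 2) (by norm_num)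
  have h1 : pairC B x x = pairC B (s • liftC a) (s • liftC a) := by
    rw [pairC_smul_left, pairC_smul_right, pairC_lift, ha]
    push_cast
    linear_combination (-8 : ℂ) * hs
  rw [design_eq hB h1 _ (by lia)]
  simp only [pairC_smul_right, mul_pow]
  rw [← Finset.mul_sum, pow_mul, hs, div_pow]
  ring

lemma design_polar (hB : IsLeech B) {m : ℕ} {w : LV → ℂ} {c : ℂ} {x y : LV} {r r' : ℤ}
    (hx : pairZ B x x = r) (hy : pairZ B y y = r') (hxy : pairZ B x y = 0)
    (h : ∀ s : ℂ, ∑ u ∈ TF B 2, w u * pairC B (liftC u) (liftC x + s • liftC y) ^ (2 * (m + 1)) =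
      c * pairC B (liftC x + s • liftC y) (liftC x + s • liftC y) ^ (m + 1)) :
    ((2 * (m + 1)).choose 2 : ℂ) * ∑ u ∈ TF B 2, w u * (pairZ B u x : ℂ) ^ (2 * m) * (pairZ B u y : ℂ) ^ 2 = c * (m + 1) * (r : ℂ) ^ m * r' := by
  apply coeff2_aux
  intro s
  have := h s
  have e : pairC B (liftC x + s • liftC y) (liftC x + s • liftC y) = (r : ℂ) + s ^ 2 * r' := by
    rw [pairC_add_left, pairC_add_right, pairC_add_right, pairC_smul_left, pairC_smul_left, pairC_smul_right, pairC_smul_right,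
      pairC_lift, pairC_lift, pairC_lift, pairC_lift, hx, hy, hB.comm y x, hxy]
    push_cast; ring
  rw [e] at this
  rw [← this]
  refine Finset.sum_congr rfl fun u _ => ?_
  rw [pairC_add_right, pairC_smul_right, pairC_lift, pairC_lift]

lemma design_rec (hB : IsLeech B) {k : ℕ} {M M' : ℂ}
    (h : ∀ x : CV, ∑ v ∈ TF B 2, pairC B (liftC v) x ^ (2 * k) = M * pairC B x x ^ k)
    (h' : ∀ x : CV, ∑ v ∈ TF B 2, pairC B (liftC v) x ^ (2 * (k + 1)) = M' * pairC B x x ^ (k + 1)) :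
    (2 * k + 24) * M' = (2 * k + 1) * 4 * M := by
  obtain ⟨x, hx⟩ := exists_T4 hB
  obtain ⟨a, ha, -⟩ := exists_frame hB hx
  have h1 : ∀ j ∈ Finset.univ.erase (0 : Fin 24), ((2 * (k + 1)).choose 2 : ℂ) * ∑ u ∈ TF B 2, (pairZ B u (a 0) : ℂ) ^ (2 * k) * (pairZ B u (a j) : ℂ) ^ 2 = M' * (k + 1) * (8 : ℂ) ^ k * 8 := by
    intro j hj
    have hj0 : j ≠ 0 := (Finset.mem_erase.mp hj).1
    have := design_polar hB (m := k) (w := fun _ => 1) (c := M') (x := a 0) (y := a j) (r := 8) (r' := 8)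
      (by simp [ha.ip]) (by simp [ha.ip]) (by rw [ha.ip, if_neg hj0.symm]) (fun s => by simpa using h' _)
    simpa using this
  have h2 := Finset.sum_congr rfl h1
  rw [← Finset.mul_sum, Finset.sum_comm, Finset.sum_const, Finset.card_erase_of_mem (Finset.mem_univ _), Finset.card_univ, Fintype.card_fin] at h2
  have h3 : ∀ u ∈ TF B 2, ∑ j ∈ Finset.univ.erase (0 : Fin 24), (pairZ B u (a 0) : ℂ) ^ (2 * k) * (pairZ B u (a j) : ℂ) ^ 2 =
      32 * pairC B (liftC u) (liftC (a 0)) ^ (2 * k) - pairC B (liftC u) (liftC (a 0)) ^ (2 * (k + 1)) := by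
    intro u hu
    have hp := ha.parseval hB u u
    rw [(mem_TF hB).mp hu, ← Finset.add_sum_erase _ _ (Finset.mem_univ (0 : Fin 24))] at hp
    have hp' : (∑ j ∈ Finset.univ.erase (0 : Fin 24), (pairZ B u (a j) : ℂ) ^ 2) = 32 - (pairZ B u (a 0) : ℂ) ^ 2 := by
      have := congrArg (Int.cast : ℤ → ℂ) hp
      push_cast at this
      simp only [pow_two]
      linear_combination -this
    rw [← Finset.mul_sum, hp', pairC_lift]; ring
  rw [Finset.sum_congr rfl h3, Finset.sum_sub_distrib, ← Finset.mul_sum, h, h', pairC_lift, ha.ip, if_pos rfl] at h2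
  have hch : ((2 * (k + 1)).choose 2 : ℂ) = (k + 1) * (2 * k + 1) := by
    rw [Nat.cast_choose_two]; push_cast; ring
  rw [hch] at h2
  have hk : ((k : ℂ) + 1) ≠ 0 := by exact_mod_cast Nat.succ_ne_zero k
  have h8 : (8 : ℂ) ^ (k + 1) ≠ 0 := pow_ne_zero _ (by norm_num)
  apply mul_left_cancel₀ (mul_ne_zero hk h8)
  simp only [nsmul_eq_mul] at h2
  push_cast at h2
  rw [pow_succ] at *
  linear_combination -h2

theorem design_vals (hB : IsLeech B) (x : CV) :
    ∑ v ∈ TF B 2, pairC B (liftC v) x ^ 2 = 32760 * pairC B x x ∧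
    ∑ v ∈ TF B 2, pairC B (liftC v) x ^ 4 = 15120 * pairC B x x ^ 2 ∧
    ∑ v ∈ TF B 2, pairC B (liftC v) x ^ 6 = 10800 * pairC B x x ^ 3 ∧
    ∑ v ∈ TF B 2, pairC B (liftC v) x ^ 8 = 10080 * pairC B x x ^ 4 ∧
    ∑ v ∈ TF B 2, pairC B (liftC v) x ^ 10 = 11340 * pairC B x x ^ 5 := by
  obtain ⟨M0, h0⟩ := design_M hB (k := 0) (by norm_num)
  obtain ⟨M1, h1⟩ := design_M hB (k := 1) (by norm_num)
  obtain ⟨M2, h2⟩ := design_M hB (k := 2) (by norm_num)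
  obtain ⟨M3, h3⟩ := design_M hB (k := 3) (by norm_num)
  obtain ⟨M4, h4⟩ := design_M hB (k := 4) (by norm_num)
  obtain ⟨M5, h5⟩ := design_M hB (k := 5) (by norm_num)
  have r1 := design_rec hB h0 h1
  have r2 := design_rec hB h1 h2
  have r3 := design_rec hB h2 h3
  have r4 := design_rec hB h3 h4
  have r5 := design_rec hB h4 h5
  have e0 : M0 = 196560 := by
    have := h0 0
    simp [(card_TF hB).1] at this
    exact this.symm
  push_cast at r1 r2 r3 r4 r5
  have e1 : M1 = 32760 := by linear_combination r1 / 24 + e0 / 6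
  have e2 : M2 = 15120 := by linear_combination r2 / 26 + 12 * e1 / 26
  have e3 : M3 = 10800 := by linear_combination r3 / 28 + 20 * e2 / 28
  have e4 : M4 = 10080 := by linear_combination r4 / 30 + 28 * e3 / 30
  have e5 : M5 = 11340 := by linear_combination r5 / 32 + 36 * e4 / 32
  subst e1 e2 e3 e4 e5
  exact ⟨by simpa using h1 x, h2 x, h3 x, h4 x, h5 x⟩

theorem design_int (hB : IsLeech B) (x : LV) :
    ∑ v ∈ TF B 2, pairZ B v x ^ 2 = 32760 * pairZ B x x ∧
    ∑ v ∈ TF B 2, pairZ B v x ^ 4 = 15120 * pairZ B x x ^ 2 ∧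
    ∑ v ∈ TF B 2, pairZ B v x ^ 6 = 10800 * pairZ B x x ^ 3 ∧
    ∑ v ∈ TF B 2, pairZ B v x ^ 8 = 10080 * pairZ B x x ^ 4 ∧
    ∑ v ∈ TF B 2, pairZ B v x ^ 10 = 11340 * pairZ B x x ^ 5 := by
  have := design_vals hB (liftC x)
  simp only [pairC_lift] at this
  exact_mod_cast this
end design

section conway
variable {B : MZ}

lemma cg_pair {σ : MZ} (hσ : σ ∈ ConwayGroup B) (v w : LV) :
    pairZ B (σ.mulVec v) (σ.mulVec w) = pairZ B v w := by
  conv_rhs => rw [← hσ.2]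
  simp only [pairZ]
  rw [← Matrix.mulVec_mulVec, ← Matrix.mulVec_mulVec, Matrix.dotProduct_mulVec v, Matrix.vecMul_transpose]

lemma cg_of (hB : IsLeech B) {σ : MZ}
    (h : ∀ v w, pairZ B (σ.mulVec v) (σ.mulVec w) = pairZ B v w) : σ ∈ ConwayGroup B := by
  have h1 : σᵀ * B * σ = B := by
    ext i j
    have := h (Pi.single i 1) (Pi.single j 1)
    have e : ∀ M : MZ, Pi.single i 1 ⬝ᵥ M.mulVec (Pi.single j 1) = M i j := fun M => by
      simp
    rw [← e (σᵀ * B * σ), ← e B]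
    simp only [pairZ] at this
    rw [← this, ← Matrix.mulVec_mulVec, ← Matrix.mulVec_mulVec, Matrix.dotProduct_mulVec (Pi.single i 1), Matrix.vecMul_transpose]
  refine ⟨?_, h1⟩
  have := congrArg Matrix.det h1
  rw [Matrix.det_mul, Matrix.det_mul, Matrix.det_transpose, hB.2.1, mul_one] at this
  exact IsUnit.of_mul_eq_one _ this

lemma cg_of_fun (hB : IsLeech B) (f : LV → LV) (hadd : ∀ v w, f (v + w) = f v + f w)
    (h : ∀ v w, pairZ B (f v) (f w) = pairZ B v w) : ∃ σ ∈ ConwayGroup B, ∀ v, σ.mulVec v = f v := by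
  let g : LV →+ LV := AddMonoidHom.mk' f hadd
  have e : ∀ v, (LinearMap.toMatrix' g.toIntLinearMap).mulVec v = f v := fun v => by
    rw [← Matrix.toLin'_apply, Matrix.toLin'_toMatrix']; rfl
  exact ⟨_, cg_of hB (fun v w => by rw [e, e, h]), e⟩

lemma cg_one : (1 : MZ) ∈ ConwayGroup B := ⟨by simp, by simp⟩

lemma cg_mul (hB : IsLeech B) {σ ρ : MZ} (hσ : σ ∈ ConwayGroup B) (hρ : ρ ∈ ConwayGroup B) :
    σ * ρ ∈ ConwayGroup B := cg_of hB fun v w => by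
  rw [← Matrix.mulVec_mulVec, ← Matrix.mulVec_mulVec, cg_pair hσ, cg_pair hρ]

lemma cg_inv (hB : IsLeech B) {σ : MZ} (hσ : σ ∈ ConwayGroup B) :
    σ⁻¹ ∈ ConwayGroup B ∧ (∀ v, σ⁻¹.mulVec (σ.mulVec v) = v) ∧ (∀ v, σ.mulVec (σ⁻¹.mulVec v) = v) := by
  have e1 : ∀ v, σ⁻¹.mulVec (σ.mulVec v) = v := fun v => by
    rw [Matrix.mulVec_mulVec, Matrix.nonsing_inv_mul _ hσ.1, Matrix.one_mulVec]
  have e2 : ∀ v, σ.mulVec (σ⁻¹.mulVec v) = v := fun v => by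
    rw [Matrix.mulVec_mulVec, Matrix.mul_nonsing_inv _ hσ.1, Matrix.one_mulVec]
  exact ⟨cg_of hB fun v w => by rw [← cg_pair hσ, e2, e2], e1, e2⟩

lemma cg_neg (hB : IsLeech B) : ∃ σ ∈ ConwayGroup B, ∀ v, σ.mulVec v = -v :=
  cg_of_fun hB (fun v => -v) (fun v w => by abel) (fun v w => by rw [pairZ_neg_left, pairZ_neg_right, neg_neg])

lemma cg_TF (hB : IsLeech B) {σ : MZ} (hσ : σ ∈ ConwayGroup B) {v : LV} {m : ℕ} :
    σ.mulVec v ∈ TF B m ↔ v ∈ TF B m := by rw [mem_TF hB, mem_TF hB, cg_pair hσ]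

lemma cg_red {σ : MZ} {n : ℕ} {v w : LV} (h : red n v = red n w) :
    red n (σ.mulVec v) = red n (σ.mulVec w) := by
  rw [red_eq_iff] at h ⊢
  obtain ⟨u, hu⟩ := h
  exact ⟨σ.mulVec u, by rw [← Matrix.mulVec_sub, hu, Matrix.mulVec_smul]⟩

lemma cg_inj (hB : IsLeech B) {σ : MZ} (hσ : σ ∈ ConwayGroup B) :
    Function.Injective (fun v : LV => σ.mulVec v) := fun v w h => by
  have := (cg_inv hB hσ).2.1
  rw [← this v, ← this w]; exact congrArg _ h

lemma cg_sum (hB : IsLeech B) {σ : MZ} (hσ : σ ∈ ConwayGroup B) (m : ℕ) (f : LV → ℂ) :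
    ∑ v ∈ TF B m, f (σ.mulVec v) = ∑ v ∈ TF B m, f v := by
  refine Finset.sum_bij (fun v _ => σ.mulVec v) (fun v hv => (cg_TF hB hσ).2 hv)
    (fun v _ w _ h => cg_inj hB hσ h) (fun w hw => ⟨σ⁻¹.mulVec w, ?_, (cg_inv hB hσ).2.2 w⟩) (fun _ _ => rfl)
  exact (cg_TF hB (cg_inv hB hσ).1).2 hw

lemma orb_trans (hB : IsLeech B) {O : Set LV} {v w x : LV} (hO : O = orbitOf B x) (hv : v ∈ O) (hw : w ∈ O) :
    ∃ σ ∈ ConwayGroup B, w = σ.mulVec v := by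
  subst hO
  obtain ⟨σ, hσ, rfl⟩ := hv
  obtain ⟨ρ, hρ, rfl⟩ := hw
  refine ⟨ρ * σ⁻¹, cg_mul hB hρ (cg_inv hB hσ).1, ?_⟩
  rw [← Matrix.mulVec_mulVec, (cg_inv hB hσ).2.1]

lemma orb_mem (hB : IsLeech B) {O : Set LV} {v x : LV} (hO : O = orbitOf B x) (hv : v ∈ O)
    {σ : MZ} (hσ : σ ∈ ConwayGroup B) : σ.mulVec v ∈ O := by
  subst hO
  obtain ⟨ρ, hρ, rfl⟩ := hv
  exact ⟨σ * ρ, cg_mul hB hσ hρ, by rw [Matrix.mulVec_mulVec]⟩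

lemma orb_eq (hB : IsLeech B) {O O' : Set LV} {v x x' : LV} (hO : O = orbitOf B x) (hO' : O' = orbitOf B x')
    (hv : v ∈ O) (hv' : v ∈ O') : O = O' := by
  ext w
  constructor
  · intro hw
    obtain ⟨σ, hσ, rfl⟩ := orb_trans hB hO hv hw
    exact orb_mem hB hO' hv' hσ
  · intro hw
    obtain ⟨σ, hσ, rfl⟩ := orb_trans hB hO' hv' hw
    exact orb_mem hB hO hv hσ

lemma orb_sub (hB : IsLeech B) {O : Set LV} {m c : ℕ} (h : OrbitData B O m c) : O ⊆ (TF B m : Set LV) :=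
  fun v hv => by rw [Finset.mem_coe, mem_TF hB, h.2.1 v hv]

lemma orb_full (hB : IsLeech B) {O : Set LV} {m c : ℕ} (h : OrbitData B O m c) (hc : (TF B m).card = c) :
    O = (TF B m : Set LV) := by
  refine Set.eq_of_subset_of_ncard_le (orb_sub hB h) ?_ (TF B m).finite_toSet
  rw [Set.ncard_coe_finset, hc, ← h.2.2]; exact le_rfl

structure Setup (B : MZ) (O2 O5 Oa Ob Oc : Set LV) : Prop where
  hB : IsLeech B
  h2 : OrbitData B O2 2 (3 * 65520)
  h5 : OrbitData B O5 5 (70656 * 65520)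
  ha : OrbitData B Oa 8 (3 * 65520)
  hb : OrbitData B Ob 8 (12295800 * 65520)
  hc : OrbitData B Oc 8 (141312 * 65520)

variable {O2 O5 Oa Ob Oc : Set LV}

lemma Setup.e2 (H : Setup B O2 O5 Oa Ob Oc) : O2 = (TF B 2 : Set LV) :=
  orb_full H.hB H.h2 (by rw [(card_TF H.hB).1])
lemma Setup.e5 (H : Setup B O2 O5 Oa Ob Oc) : O5 = (TF B 5 : Set LV) :=
  orb_full H.hB H.h5 (by rw [(card_TF H.hB).2.2.2.1])

lemma orb_disj (hB : IsLeech B) {O O' : Set LV} {m c c' : ℕ} (h : OrbitData B O m c) (h' : OrbitData B O' m c') (hc : c ≠ c') :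
    Disjoint O O' := by
  rw [Set.disjoint_left]
  intro v hv hv'
  obtain ⟨x, hx⟩ := h.1
  obtain ⟨y, hy⟩ := h'.1
  have := orb_eq hB hx hy hv hv'
  apply hc; rw [← h.2.2, ← h'.2.2, this]

lemma Setup.dab (H : Setup B O2 O5 Oa Ob Oc) : Disjoint Oa Ob := orb_disj H.hB H.ha H.hb (by norm_num)
lemma Setup.dac (H : Setup B O2 O5 Oa Ob Oc) : Disjoint Oa Oc := orb_disj H.hB H.ha H.hc (by norm_num)
lemma Setup.dbc (H : Setup B O2 O5 Oa Ob Oc) : Disjoint Ob Oc := orb_disj H.hB H.hb H.hc (by norm_num)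

lemma Setup.e8 (H : Setup B O2 O5 Oa Ob Oc) : Oa ∪ Ob ∪ Oc = (TF B 8 : Set LV) := by
  have fa := (TF B 8).finite_toSet.subset (orb_sub H.hB H.ha)
  have fb := (TF B 8).finite_toSet.subset (orb_sub H.hB H.hb)
  have fc := (TF B 8).finite_toSet.subset (orb_sub H.hB H.hc)
  refine Set.eq_of_subset_of_ncard_le (Set.union_subset (Set.union_subset (orb_sub H.hB H.ha) (orb_sub H.hB H.hb)) (orb_sub H.hB H.hc)) ?_ (TF B 8).finite_toSet
  rw [Set.ncard_coe_finset, Set.ncard_union_eq (Set.disjoint_union_left.2 ⟨H.dac, H.dbc⟩) (fa.union fb) fc,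
    Set.ncard_union_eq H.dab fa fb, (card_TF H.hB).2.2.2.2.2]
  have := H.ha.2.2; have := H.hb.2.2; have := H.hc.2.2
  simp only [Nat.card_coe_set_eq] at *
  lia

lemma two_smul_TF (hB : IsLeech B) {v : LV} {m : ℕ} : (2 : ℤ) • v ∈ TF B (4 * m) ↔ v ∈ TF B m := by
  rw [mem_TF hB, mem_TF hB, pairZ_smul_left, pairZ_smul_right]; push_cast; lia

lemma Setup.ea (H : Setup B O2 O5 Oa Ob Oc) : Oa = (fun v : LV => (2 : ℤ) • v) '' (TF B 2 : Set LV) := by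
  have hB := H.hB
  obtain ⟨x, hx⟩ := H.h2.1
  have hx2 : x ∈ O2 := by rw [hx]; exact ⟨1, cg_one, by simp⟩
  have he : (fun v : LV => (2 : ℤ) • v) '' (TF B 2 : Set LV) = orbitOf B ((2 : ℤ) • x) := by
    rw [← H.e2, hx]
    ext w
    constructor
    · rintro ⟨_, ⟨σ, hσ, rfl⟩, rfl⟩
      exact ⟨σ, hσ, by simp only [Matrix.mulVec_smul]⟩
    · rintro ⟨σ, hσ, rfl⟩
      exact ⟨_, ⟨σ, hσ, rfl⟩, by simp only [Matrix.mulVec_smul]⟩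
  have hcard : Set.ncard ((fun v : LV => (2 : ℤ) • v) '' (TF B 2 : Set LV)) = 3 * 65520 := by
    rw [Set.ncard_image_of_injective, Set.ncard_coe_finset, (card_TF hB).1]
    exact smul_right_injective _ (by norm_num)
  have hmem : (2 : ℤ) • x ∈ Oa ∪ Ob ∪ Oc := by
    rw [H.e8, Finset.mem_coe, show 8 = 4 * 2 from rfl, two_smul_TF hB]; rw [H.e2] at hx2; exact hx2
  have hmem' : (2 : ℤ) • x ∈ orbitOf B ((2 : ℤ) • x) := ⟨1, cg_one, by simp⟩
  obtain ⟨a, ha⟩ := H.ha.1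
  obtain ⟨b, hb⟩ := H.hb.1
  obtain ⟨c, hc⟩ := H.hc.1
  rcases hmem with (h | h) | h
  · rw [he]; exact orb_eq hB ha rfl h hmem'
  · have e := orb_eq hB hb rfl h hmem'
    have := H.hb.2.2
    rw [Nat.card_coe_set_eq, e, ← he, hcard] at this; norm_num at this
  · have e := orb_eq hB hc rfl h hmem'
    have := H.hc.2.2
    rw [Nat.card_coe_set_eq, e, ← he, hcard] at this; norm_num at this

lemma mod3_key (hB : IsLeech B) {v w : LV} (h : red 3 v = red 3 w) (h1 : v ≠ w) :
    ∃ u : LV, v - w = (3 : ℤ) • u ∧ 4 ≤ pairZ B u u ∧ (∃ k, pairZ B u u = 2 * k) ∧ pairZ B v v - 2 * pairZ B v w + pairZ B w w = 9 * pairZ B u u := by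
  obtain ⟨u, hu⟩ := red_eq_iff.mp h
  refine ⟨u, hu, ?_, hB.even u, ?_⟩
  · apply hB.pos
    rintro rfl
    apply h1; rw [smul_zero, sub_eq_zero] at hu; exact hu
  · rw [← hB.norm_sub, hu, pairZ_smul_left, pairZ_smul_right]; push_cast; ring

lemma IsLeech.cs (hB : IsLeech B) (v w : LV) : pairZ B v w ^ 2 ≤ pairZ B v v * pairZ B w w := by
  rcases eq_or_ne w 0 with rfl | hw
  · simp [pairZ_zero_right]
  have h4 := hB.pos hw
  have := hB.nonneg (pairZ B w w • v - pairZ B v w • w)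
  rw [hB.norm_sub] at this
  simp only [pairZ_smul_left, pairZ_smul_right] at this
  nlinarith
end conway

section mod3
variable {B : MZ}

abbrev V3 := Fin 24 → ZMod 3

def b3 (B : MZ) (x y : V3) : ZMod 3 := x ⬝ᵥ (B.map (Int.cast : ℤ → ZMod 3)).mulVec y

lemma b3_add_left (x y z : V3) : b3 B (x + y) z = b3 B x z + b3 B y z := by simp [b3, add_dotProduct]
lemma b3_add_right (x y z : V3) : b3 B x (y + z) = b3 B x y + b3 B x z := by simp [b3, mulVec_add, dotProduct_add]
lemma b3_smul_left (c : ZMod 3) (x z : V3) : b3 B (c • x) z = c * b3 B x z := by simp [b3, smul_dotProduct]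
lemma b3_smul_right (c : ZMod 3) (x z : V3) : b3 B x (c • z) = c * b3 B x z := by simp [b3, mulVec_smul, dotProduct_smul]
lemma b3_neg_left (x z : V3) : b3 B (-x) z = - b3 B x z := by simp [b3]
lemma b3_neg_right (x z : V3) : b3 B x (-z) = - b3 B x z := by simp [b3, mulVec_neg]
lemma b3_zero_left (z : V3) : b3 B 0 z = 0 := by simp [b3]
lemma b3_sum_left (f : Fin 24 → V3) (z : V3) : b3 B (∑ i, f i) z = ∑ i, b3 B (f i) z := by
  simp [b3, sum_dotProduct]
lemma b3_sum_right (f : Fin 24 → V3) (z : V3) : b3 B z (∑ i, f i) = ∑ i, b3 B z (f i) := by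
  simp [b3, mulVec_sum, dotProduct_sum]

lemma b3_red (v w : LV) : b3 B (red 3 v) (red 3 w) = (pairZ B v w : ZMod 3) := by
  simp [b3, pairZ, red, dotProduct, mulVec]

lemma b3_comm (hB : IsLeech B) (x y : V3) : b3 B x y = b3 B y x := by
  obtain ⟨v, rfl⟩ := red_surj x
  obtain ⟨w, rfl⟩ := red_surj y
  rw [b3_red, b3_red, hB.comm]

def ch : AddChar (ZMod 3) ℂ := ZMod.stdAddChar

lemma ch_int (j : ℤ) : ch (j : ZMod 3) = eC (j / 3) := by
  rw [ch, ZMod.stdAddChar_coe, eC]; congr 1; push_cast; ring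

lemma ch_sum : 1 + ch 1 + ch 2 = 0 := by
  have h3 : ch 1 ^ 3 = 1 := by rw [← AddChar.map_nsmul_eq_pow]; exact AddChar.map_zero_eq_one ch
  have h2 : ch 2 = ch 1 ^ 2 := by rw [← AddChar.map_nsmul_eq_pow]; rfl
  have h1 : ch 1 ≠ 1 := by
    intro h
    have := (ZMod.injective_stdAddChar (N := 3)) (h.trans (AddChar.map_zero_eq_one ch).symm)
    exact absurd this (by decide)
  have : (ch 1 - 1) * (1 + ch 1 + ch 1 ^ 2) = 0 := by linear_combination h3
  rw [h2]; exact (mul_eq_zero.1 this).resolve_left (sub_ne_zero.2 h1)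

lemma ch_two : ch 2 = ch 1 ^ 2 := by rw [← AddChar.map_nsmul_eq_pow]; rfl

lemma z3_cases {s : ZMod 3} (hs : s ≠ 0) : s = 1 ∨ s = 2 := by revert s; decide

lemma gauss1 {s : ZMod 3} (hs : s ≠ 0) : (∑ c : ZMod 3, ch (s * (-(c * c)))) ^ 24 = 3 ^ 12 := by
  have e : ∑ c : ZMod 3, ch (s * (-(c * c))) = 1 + 2 * ch (-s) := by
    rw [show (Finset.univ : Finset (ZMod 3)) = {0, 1, 2} by decide]
    rw [Finset.sum_insert (by decide), Finset.sum_insert (by decide), Finset.sum_singleton]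
    rw [show s * (-(0 * 0)) = 0 by ring, show s * (-(1 * 1)) = -s by ring, show (2 : ZMod 3) * 2 = 1 by decide, show s * -1 = -s by ring,
      AddChar.map_zero_eq_one]; ring
  have h := ch_sum
  rw [ch_two] at h
  have key : (1 + 2 * ch (-s)) ^ 2 = -3 := by
    have := z3_cases hs
    rcases this with rfl | rfl
    · rw [show (-1 : ZMod 3) = 2 by decide, ch_two]
      have h3 : ch 1 ^ 3 = 1 := by linear_combination (ch 1 - 1) * h
      linear_combination 4 * h + 4 * ch 1 * h3
    · rw [show (-2 : ZMod 3) = 1 by decide]; linear_combination 4 * h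
  rw [e, show 24 = 2 * 12 from rfl, pow_mul, key]; norm_num

lemma gauss_sum (hB : IsLeech B) {s : ZMod 3} (hs : s ≠ 0) : ∑ x : V3, ch (s * b3 B x x) = 3 ^ 12 := by
  obtain ⟨x0, hx0⟩ := exists_T4 hB
  obtain ⟨a, ha, -⟩ := exists_frame hB hx0
  let f : V3 → V3 := fun y => ∑ i, y i • red 3 (a i)
  have hip : ∀ i j, b3 B (red 3 (a i)) (red 3 (a j)) = if i = j then -1 else 0 := fun i j => by
    rw [b3_red, ha.ip]; split_ifs <;> decide
  have hf1 : ∀ y j, b3 B (f y) (red 3 (a j)) = - y j := fun y j => by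
    simp only [f]
    rw [b3_sum_left]
    simp [b3_smul_left, hip]
  have hinj : Function.Injective f := fun y y' h => by
    ext j : 1
    have := hf1 y j
    rw [h, hf1] at this
    exact (neg_injective this).symm
  have hbij : Function.Bijective f := (Finite.injective_iff_bijective).1 hinj
  have hq : ∀ y, b3 B (f y) (f y) = ∑ i, -(y i * y i) := fun y => by
    conv_lhs => rw [show f y = ∑ i, y i • red 3 (a i) from rfl, b3_sum_right]
    refine Finset.sum_congr rfl fun i _ => ?_
    rw [b3_smul_right, ← show f y = ∑ i, y i • red 3 (a i) from rfl, hf1]; ring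
  rw [← hbij.sum_comp (fun x => ch (s * b3 B x x))]
  have : ∀ y : V3, ch (s * b3 B (f y) (f y)) = ∏ i, ch (s * (-(y i * y i))) := fun y => by
    rw [hq, Finset.mul_sum]
    exact map_prod ch.toMonoidHom (fun i => Multiplicative.ofAdd (s * -(y i * y i))) Finset.univ
  simp only [this]
  have h := Finset.prod_univ_sum (fun _ : Fin 24 => (Finset.univ : Finset (ZMod 3))) (fun _ c => ch (s * (-(c * c))))
  rw [Fintype.piFinset_univ] at h
  rw [← h, Finset.prod_const, Finset.card_univ, Fintype.card_fin, gauss1 hs]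

lemma ch_indicator (c : ZMod 3) : (if c = 0 then (1 : ℂ) else 0) = (1 + ch c + ch (2 * c)) / 3 := by
  have h := ch_sum
  fin_cases c
  · show (if (0 : ZMod 3) = 0 then (1 : ℂ) else 0) = (1 + ch 0 + ch (2 * 0)) / 3
    rw [mul_zero, AddChar.map_zero_eq_one]; norm_num
  · show (if (1 : ZMod 3) = 0 then (1 : ℂ) else 0) = (1 + ch 1 + ch (2 * 1)) / 3
    rw [mul_one, if_neg (by decide), h, zero_div]
  · show (if (2 : ZMod 3) = 0 then (1 : ℂ) else 0) = (1 + ch 2 + ch (2 * 2)) / 3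
    rw [show (2 : ZMod 3) * 2 = 1 by decide, if_neg (by decide), show 1 + ch 2 + ch 1 = 0 by linear_combination h, zero_div]

lemma quad_count (hB : IsLeech B) {s : ZMod 3} (hs : s ≠ 0) :
    (Finset.univ.filter (fun x : V3 => b3 B x x = s)).card = 94143001680 := by
  have h1 : ((Finset.univ.filter (fun x : V3 => b3 B x x = s)).card : ℂ) = ∑ x : V3, (if b3 B x x - s = 0 then (1 : ℂ) else 0) := by
    rw [Finset.card_filter]; push_cast; simp only [sub_eq_zero]
  simp only [ch_indicator] at h1
  rw [← Finset.sum_div, Finset.sum_add_distrib, Finset.sum_add_distrib] at h1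
  have e1 : ∀ x : V3, ch (b3 B x x - s) = ch (-s) * ch (1 * b3 B x x) := fun x => by
    rw [← AddChar.map_add_eq_mul]; ring_nf
  have e2 : ∀ x : V3, ch (2 * (b3 B x x - s)) = ch (-(2 * s)) * ch (2 * b3 B x x) := fun x => by
    rw [← AddChar.map_add_eq_mul]; ring_nf
  simp only [e1, e2, ← Finset.mul_sum] at h1
  rw [gauss_sum hB (by decide), gauss_sum hB (by decide)] at h1
  have hc : (∑ _x : V3, (1 : ℂ)) = 3 ^ 24 := by
    rw [Finset.sum_const, Finset.card_univ, Fintype.card_fun]; simp; norm_num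
  have hh : ch (-s) + ch (-(2 * s)) = -1 := by
    have h := ch_sum
    have := z3_cases hs
    rcases this with rfl | rfl
    · rw [show (-1 : ZMod 3) = 2 by decide, show (-(2 * 1) : ZMod 3) = 1 by decide]; linear_combination h
    · rw [show (-2 : ZMod 3) = 1 by decide, show (-(2 * 2) : ZMod 3) = 2 by decide]; linear_combination h
  rw [hc] at h1
  have : ((Finset.univ.filter (fun x : V3 => b3 B x x = s)).card : ℂ) = (94143001680 : ℕ) := by
    rw [h1]; push_cast; linear_combination (3 ^ 12 / 3 : ℂ) * hh
  exact_mod_cast this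

lemma ch_orth (hB : IsLeech B) (x : V3) : ∑ y : V3, ch (b3 B x y) = if x = 0 then 3 ^ 24 else 0 := by
  split_ifs with h
  · subst h
    simp only [b3_zero_left, AddChar.map_zero_eq_one]
    rw [Finset.sum_const, Finset.card_univ, Fintype.card_fun]; simp; norm_num
  · have hex : ∃ y, b3 B x y = 1 := by
      by_contra hc
      push Not at hc
      have h0 : ∀ y, b3 B x y = 0 := fun y => by
        by_contra h0
        apply hc ((b3 B x y)⁻¹ • y)
        rw [b3_smul_right]; exact inv_mul_cancel₀ h0
      apply h
      have hdet : IsUnit (B.map (Int.cast : ℤ → ZMod 3)).det := by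
        have : (B.map (Int.cast : ℤ → ZMod 3)).det = ((B.det : ℤ) : ZMod 3) := by
          exact ((Int.castRingHom (ZMod 3)).map_det B).symm
        rw [this, hB.2.1]; simp
      have : x ᵥ* (B.map (Int.cast : ℤ → ZMod 3)) = 0 := by
        ext j
        have := h0 (Pi.single j 1)
        rw [b3, Matrix.dotProduct_mulVec] at this
        simpa using this
      have h2 := congrArg (fun z => z ᵥ* (B.map (Int.cast : ℤ → ZMod 3))⁻¹) this
      simpa [Matrix.vecMul_vecMul, Matrix.mul_nonsing_inv _ hdet] using h2
    obtain ⟨y0, hy0⟩ := hex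
    have h1 := Equiv.sum_comp (Equiv.addRight y0) (fun y => ch (b3 B x y))
    simp only [Equiv.coe_addRight, b3_add_right, hy0, AddChar.map_add_eq_mul, ← Finset.sum_mul] at h1
    have hne : ch 1 ≠ 1 := by
      intro h'
      have := (ZMod.injective_stdAddChar (N := 3)) (h'.trans (AddChar.map_zero_eq_one ch).symm)
      exact absurd this (by decide)
    have : (∑ y : V3, ch (b3 B x y)) * (ch 1 - 1) = 0 := by linear_combination h1
    exact (mul_eq_zero.1 this).resolve_right (sub_ne_zero.2 hne)
end mod3

section cover3
variable {B : MZ} {O2 O5 Oa Ob Oc : Set LV}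

lemma m3_vals (hB : IsLeech B) {m n : ℕ} {v w : LV} (hv : v ∈ TF B m) (hw : w ∈ TF B n) (h : red 3 v = red 3 w) (h1 : v ≠ w) :
    ∃ u : LV, v - w = (3 : ℤ) • u ∧ ∃ k : ℤ, 2 ≤ k ∧ pairZ B u u = 2 * k ∧ pairZ B v w = m + n - 9 * k ∧ 0 ≤ 2 * (m + n) - 9 * k
      ∧ 2 * ((m : ℤ) + n) - 9 * k ≠ 1 := by
  obtain ⟨u, hu, h4, ⟨k, hk⟩, h9⟩ := mod3_key hB h h1
  have hp := hB.norm_add v w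
  have := hB.nonneg (v + w)
  rw [mem_TF hB] at hv hw
  refine ⟨u, hu, k, by lia, hk, by lia, by lia, fun h => hB.2.2.2.2 (v + w) (by lia)⟩

lemma m3_inj (hB : IsLeech B) {m n : ℕ} (hmn : m + n < 9) {v w : LV} (hv : v ∈ TF B m) (hw : w ∈ TF B n) (h : red 3 v = red 3 w) : v = w := by
  by_contra h1
  obtain ⟨u, hu, k, hk, -, -, h0, -⟩ := m3_vals hB hv hw h h1
  lia

lemma m3_55 (hB : IsLeech B) {v w : LV} (hv : v ∈ TF B 5) (hw : w ∈ TF B 5) (h : red 3 v = red 3 w) : v = w := by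
  by_contra h1
  obtain ⟨u, hu, k, hk, hk', hip, h0, -⟩ := m3_vals hB hv hw h h1
  have k2 : k = 2 := by push_cast at h0; lia
  subst k2
  have hs := hB.norm_add v w
  rw [mem_TF hB] at hv hw
  have hw' : pairZ B (v + w) (v + w) = 4 := by lia
  have h3 : red 2 u = red 2 (v + w) := by
    rw [red_eq_iff]; refine ⟨u + u - v, ?_⟩
    ext i
    have := congrFun hu i
    simp at this ⊢; linarith
  have hne : pairZ B u (v + w) = 0 := by
    have : 3 * pairZ B u (v + w) = 0 := by
      rw [← pairZ_smul_left, ← hu, pairZ_add_right, pairZ_sub_left, pairZ_sub_left, hB.comm w v]; lia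
    lia
  have := mod2_key hB h3 (by intro h; rw [← h] at hne; lia) (by
    intro h
    have e : v + w = -u := by rw [h, neg_neg]
    rw [e, pairZ_neg_right] at hne; lia)
  lia

lemma m3_47 (hB : IsLeech B) {v w : LV} (hv : v ∈ TF B 4) (hw : w ∈ TF B 7) (h : red 3 v = red 3 w) : False := by
  have h1 : v ≠ w := by rintro rfl; rw [mem_TF hB] at hv hw; lia
  obtain ⟨u, hu, k, hk, hk', hip, h0, -⟩ := m3_vals hB hv hw h h1
  have k2 : k = 2 := by push_cast at h0; lia
  subst k2
  rw [mem_TF hB] at hv hw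
  have h3 : 3 * pairZ B u v = 8 + 7 := by
    rw [← pairZ_smul_left, ← hu, pairZ_sub_left, hB.comm w v]; lia
  apply hB.2.2.2.2 (u - v)
  rw [hB.norm_sub]; lia

lemma m3_77 (hB : IsLeech B) {v w : LV} (hv : v ∈ TF B 7) (hw : w ∈ TF B 7) (h : red 3 v = red 3 w) (h1 : v ≠ w) : pairZ B v w = -4 := by
  obtain ⟨u, hu, k, hk, hk', hip, h0, h0'⟩ := m3_vals hB hv hw h h1
  push_cast at *
  lia

lemma m3_fib7 (hB : IsLeech B) (y : V3) : ((TF B 7).filter (fun x => red 3 x = y)).card ≤ 2 := by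
  by_contra hc
  push Not at hc
  obtain ⟨a, b, c, ha, hb, hc, hab, hac, hbc⟩ := Finset.two_lt_card_iff.1 hc
  rw [Finset.mem_filter] at ha hb hc
  have e1 := m3_77 hB ha.1 hb.1 (ha.2.trans hb.2.symm) hab
  have e2 := m3_77 hB ha.1 hc.1 (ha.2.trans hc.2.symm) hac
  have e3 := m3_77 hB hb.1 hc.1 (hb.2.trans hc.2.symm) hbc
  have h0 : red 3 (a + b + c) = red 3 0 := by
    rw [red_add, red_add, ha.2, hb.2, hc.2]
    ext i
    show y i + y i + y i = ((0 : ℤ) : ZMod 3)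
    generalize y i = t
    revert t; decide
  obtain ⟨u, hu⟩ := red_eq_iff.1 h0
  rw [sub_zero] at hu
  have := hB.norm_add (a + b) c
  rw [hB.norm_add a b, pairZ_add_left a b, hu, pairZ_smul_left, pairZ_smul_right] at this
  have m1 := (mem_TF hB).1 ha.1
  have m2 := (mem_TF hB).1 hb.1
  have m3 := (mem_TF hB).1 hc.1
  apply hB.2.2.2.2 u
  push_cast at *
  lia

lemma red_val (hB : IsLeech B) {m : ℕ} {v : LV} (hv : v ∈ TF B m) : b3 B (red 3 v) (red 3 v) = 2 * m := by
  rw [b3_red, (mem_TF hB).1 hv]; push_cast; rfl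

lemma cover1 (hB : IsLeech B) {v : LV} (hv : b3 B (red 3 v) (red 3 v) = 2) :
    ∃ w, (w ∈ TF B 4 ∨ w ∈ TF B 7) ∧ red 3 v = red 3 w := by
  obtain ⟨-, -, n4, -, n7, -⟩ := card_TF hB
  have c7 := Finset.card_le_mul_card_image (f := red 3) (TF B 7) 2 (fun y _ => m3_fib7 hB y)
  have c4 : ((TF B 4).image (red 3)).card = (TF B 4).card :=
    Finset.card_image_of_injOn fun x hx y hy h => m3_inj hB (by norm_num) hx hy h
  have hd : Disjoint ((TF B 4).image (red 3)) ((TF B 7).image (red 3)) := by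
    rw [Finset.disjoint_left]
    intro y h1 h2
    obtain ⟨v, hv, rfl⟩ := Finset.mem_image.mp h1
    obtain ⟨w, hw, h⟩ := Finset.mem_image.mp h2
    exact m3_47 hB hv hw h.symm
  have hsub : (TF B 4).image (red 3) ∪ (TF B 7).image (red 3) ⊆ Finset.univ.filter (fun x : V3 => b3 B x x = 2) := by
    intro y hy
    rw [Finset.mem_filter]
    refine ⟨Finset.mem_univ _, ?_⟩
    rcases Finset.mem_union.1 hy with h | h
    all_goals
      obtain ⟨w, hw, rfl⟩ := Finset.mem_image.mp h
      rw [red_val hB hw]; decide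
  have heq := Finset.eq_of_subset_of_card_le hsub (by
    rw [quad_count hB (by decide), Finset.card_union_of_disjoint hd]; lia)
  have hm : red 3 v ∈ Finset.univ.filter (fun x : V3 => b3 B x x = 2) := Finset.mem_filter.2 ⟨Finset.mem_univ _, hv⟩
  rw [← heq, Finset.mem_union, Finset.mem_image, Finset.mem_image] at hm
  rcases hm with ⟨w, hw, h⟩ | ⟨w, hw, h⟩ <;> exact ⟨w, by tauto, h.symm⟩

lemma exists_uv (hB : IsLeech B) {u : LV} (hu : u ∈ TF B 2) : ∃ v ∈ TF B 2, pairZ B v u = 1 := by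
  by_contra hc
  push Not at hc
  obtain ⟨s2, s4, s6, -⟩ := design_int hB u
  have hu' := (mem_TF hB).1 hu
  rw [hu'] at s2 s4 s6
  have : ∑ v ∈ TF B 2, (pairZ B v u ^ 6 - 20 * pairZ B v u ^ 4 + 64 * pairZ B v u ^ 2) = 0 := by
    refine Finset.sum_eq_zero fun v hv => ?_
    have h1 := hc v hv
    have h2 := hc (-v) ((neg_mem_TF hB).2 hv)
    rw [pairZ_neg_left] at h2
    have hv' := (mem_TF hB).1 hv
    have ha := hB.norm_add v u
    have hs := hB.norm_sub v u
    have a0 := hB.nonneg (v + u)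
    have b0 := hB.nonneg (v - u)
    have a2 := hB.2.2.2.2 (v + u)
    have b2 := hB.2.2.2.2 (v - u)
    generalize pairZ B v u = n at *
    have : n = 0 ∨ n = 2 ∨ n = -2 ∨ n = 4 ∨ n = -4 := by push_cast at *; lia
    rcases this with rfl | rfl | rfl | rfl | rfl <;> norm_num
  rw [Finset.sum_add_distrib, Finset.sum_sub_distrib, ← Finset.mul_sum, ← Finset.mul_sum, s2, s4, s6] at this
  norm_num at this

open scoped Classical in
def XX (B : MZ) : Finset LV := (TF B 8).filter (fun x => ∃ y ∈ TF B 5, red 3 x = red 3 y)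

lemma m3_58 (hB : IsLeech B) {x y : LV} (hx : x ∈ TF B 8) (hy : y ∈ TF B 5) (h : red 3 x = red 3 y) :
    ∃ u : LV, x - y = (3 : ℤ) • u ∧ y + (2 : ℤ) • u ∈ TF B 3 := by
  have h1 : x ≠ y := by rintro rfl; rw [mem_TF hB] at hx hy; lia
  obtain ⟨u, hu, k, hk, hk', hip, h0, -⟩ := m3_vals hB hx hy h h1
  have k2 : k = 2 := by push_cast at h0; lia
  subst k2
  refine ⟨u, hu, ?_⟩
  rw [mem_TF hB] at hx hy ⊢
  have h3 : 3 * pairZ B y u = -15 := by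
    rw [← pairZ_smul_right, ← hu, pairZ_sub_right, hB.comm y x]; push_cast at *; lia
  rw [hB.norm_add, pairZ_smul_right, pairZ_smul_right, pairZ_smul_left]; push_cast at *; lia

lemma card_XX (hB : IsLeech B) : (XX B).card ≤ 2 * (TF B 5).card := by
  classical
  have hex : ∀ x ∈ XX B, ∃ y ∈ TF B 5, red 3 x = red 3 y := fun x hx => (Finset.mem_filter.1 hx).2
  let g : LV → LV := fun x => if h : ∃ y ∈ TF B 5, red 3 x = red 3 y then h.choose else 0
  have hg : ∀ x ∈ XX B, g x ∈ TF B 5 ∧ red 3 x = red 3 (g x) := fun x hx => by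
    have h := hex x hx
    simp only [g, dif_pos h]
    exact h.choose_spec
  refine Finset.card_le_mul_card_image_of_maps_to (fun x hx => (hg x hx).1) 2 fun y hy => ?_
  have hu : ∀ x ∈ (XX B).filter (fun x => g x = y), ∃ u : LV, x - y = (3 : ℤ) • u ∧ y + (2 : ℤ) • u ∈ TF B 3 := fun x hx => by
    obtain ⟨hx1, rfl⟩ := Finset.mem_filter.1 hx
    exact m3_58 hB (Finset.mem_filter.1 hx1).1 (hg x hx1).1 (hg x hx1).2
  choose! U hU using hu
  refine le_trans ?_ (fib_small hB (show 3 < 4 by norm_num) (red 2 y))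
  refine Finset.card_le_card_of_injOn (fun x => y + (2 : ℤ) • U x) (fun x hx => ?_) (fun x hx x' hx' h => ?_)
  · rw [Finset.mem_coe, Finset.mem_filter]
    refine ⟨(hU x hx).2, ?_⟩
    rw [red_eq_iff]; exact ⟨U x, by simp⟩
  · have h' : (2 : ℤ) • U x = (2 : ℤ) • U x' := add_left_cancel h
    have h2 := smul_right_injective LV (two_ne_zero (α := ℤ)) h'
    have e1 := (hU x hx).1
    rw [h2, ← (hU x' hx').1] at e1
    exact sub_left_injective e1

lemma XX_inv (hB : IsLeech B) {σ : MZ} (hσ : σ ∈ ConwayGroup B) {x : LV} (hx : x ∈ XX B) :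
    σ.mulVec x ∈ XX B := by
  obtain ⟨h8, y, hy, h⟩ := Finset.mem_filter.1 hx
  exact Finset.mem_filter.2 ⟨(cg_TF hB hσ).2 h8, _, (cg_TF hB hσ).2 hy, cg_red h⟩

lemma Setup.XX_b (H : Setup B O2 O5 Oa Ob Oc) {x : LV} (hx : x ∈ XX B) : x ∉ Ob := by
  intro hb
  obtain ⟨b, hb'⟩ := H.hb.1
  have hsub : Ob ⊆ (XX B : Set LV) := fun w hw => by
    obtain ⟨σ, hσ, rfl⟩ := orb_trans H.hB hb' hb hw
    exact XX_inv H.hB hσ hx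
  have h1 := Set.ncard_le_ncard hsub (XX B).finite_toSet
  rw [Set.ncard_coe_finset, ← Nat.card_coe_set_eq, H.hb.2.2] at h1
  have := card_XX H.hB
  rw [(card_TF H.hB).2.2.2.1] at this
  lia

lemma Setup.exists_c (H : Setup B O2 O5 Oa Ob Oc) : ∃ x ∈ Oc, ∃ v ∈ TF B 2, ∃ y ∈ TF B 5, red 2 x = red 2 v ∧ red 3 x = red 3 y := by
  have hB := H.hB
  obtain ⟨u, hu⟩ : (TF B 2).Nonempty := Finset.card_pos.1 (by rw [(card_TF hB).1]; norm_num)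
  obtain ⟨v, hv, huv⟩ := exists_uv hB hu
  have hu' := (mem_TF hB).1 hu
  have hv' := (mem_TF hB).1 hv
  have h8 : v - (2 : ℤ) • u ∈ TF B 8 := by
    rw [mem_TF hB, hB.norm_sub, pairZ_smul_right, pairZ_smul_right, pairZ_smul_left]; push_cast at *; lia
  have h5 : v + u ∈ TF B 5 := by rw [mem_TF hB, hB.norm_add]; push_cast at *; lia
  have r3 : red 3 (v - (2 : ℤ) • u) = red 3 (v + u) := by
    rw [red_eq_iff]; refine ⟨-u, ?_⟩
    ext i; simp; ring
  have r2 : red 2 (v - (2 : ℤ) • u) = red 2 v := by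
    rw [red_eq_iff]; refine ⟨-u, ?_⟩
    ext i; simp
  have hX : v - (2 : ℤ) • u ∈ XX B := Finset.mem_filter.2 ⟨h8, _, h5, r3⟩
  have hm : v - (2 : ℤ) • u ∈ Oa ∪ Ob ∪ Oc := by rw [H.e8]; exact h8
  refine ⟨_, ?_, v, hv, _, h5, r2, r3⟩
  rcases hm with (h | h) | h
  · exfalso
    rw [H.ea] at h
    obtain ⟨w, hw, hw'⟩ := h
    have e : v = (2 : ℤ) • (w + u) := by rw [smul_add]; exact (sub_eq_iff_eq_add.1 hw'.symm)
    rw [e, pairZ_smul_left, pairZ_smul_right] at hv'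
    have : 4 ≤ pairZ B (w + u) (w + u) := hB.pos (by intro h0; rw [h0, pairZ_zero_left] at hv'; norm_num at hv')
    push_cast at *; lia
  · exact absurd h (H.XX_b hX)
  · exact h

lemma Setup.c_red (H : Setup B O2 O5 Oa Ob Oc) {x : LV} (hx : x ∈ Oc) :
    ∃ v ∈ TF B 2, ∃ y ∈ TF B 5, red 2 x = red 2 v ∧ red 3 x = red 3 y := by
  obtain ⟨x0, hx0, v, hv, y, hy, h2, h3⟩ := H.exists_c
  obtain ⟨c, hc⟩ := H.hc.1
  obtain ⟨σ, hσ, rfl⟩ := orb_trans H.hB hc hx0 hx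
  exact ⟨_, (cg_TF H.hB hσ).2 hv, _, (cg_TF H.hB hσ).2 hy, cg_red h2, cg_red h3⟩

lemma m3_fib8 (hB : IsLeech B) (S : Finset LV) (hS : ∀ v ∈ S, v ∈ TF B 8) (h : ∀ v ∈ S, ∀ w ∈ S, red 3 v = red 3 w) : S.card ≤ 9 := by
  have hip : ∀ v ∈ S, ∀ w ∈ S, pairZ B v w ≤ -2 + (if v = w then 18 else 0) := fun v hv w hw => by
    split_ifs with hvw
    · subst hvw; rw [(mem_TF hB).1 (hS v hv)]; norm_num
    · obtain ⟨u, hu, k, hk, hk', hip, h0, -⟩ := m3_vals hB (hS v hv) (hS w hw) (h v hv w hw) hvw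
      push_cast at *; lia
  have h0 := hB.nonneg (∑ v ∈ S, v)
  rw [pairZ_sum_left] at h0
  simp only [pairZ_sum_right] at h0
  have h1 : ∑ v ∈ S, ∑ w ∈ S, pairZ B v w ≤ ∑ v ∈ S, ∑ w ∈ S, (-2 + (if v = w then 18 else 0) : ℤ) :=
    Finset.sum_le_sum fun v hv => Finset.sum_le_sum fun w hw => hip v hv w hw
  simp only [Finset.sum_add_distrib, Finset.sum_const, Finset.sum_ite_eq, nsmul_eq_mul] at h1
  rw [Finset.sum_ite_mem, Finset.inter_self, Finset.sum_const] at h1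
  have h2 : (0 : ℤ) ≤ S.card * (18 - 2 * S.card) := by
    have := h0.trans h1; simp only [nsmul_eq_mul] at this; linarith
  by_contra hc
  push Not at hc
  have : (10 : ℤ) ≤ S.card := by exact_mod_cast hc
  nlinarith

lemma Setup.cover2 (H : Setup B O2 O5 Oa Ob Oc) {v : LV} (hv : b3 B (red 3 v) (red 3 v) = 1) :
    ∃ w, (w ∈ TF B 2 ∨ w ∈ TF B 5 ∨ w ∈ Ob) ∧ red 3 v = red 3 w := by
  classical
  have hB := H.hB
  obtain ⟨n2, -, -, n5, -, n8⟩ := card_TF hB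
  have hbs := orb_sub hB H.hb
  let Sb := (TF B 8).filter (fun x => x ∈ Ob)
  have hSb : (Sb : Set LV) = Ob := by
    ext x; simp only [Sb, Finset.coe_filter, Set.mem_ofPred_eq]; exact ⟨fun h => h.2, fun h => ⟨hbs h, h⟩⟩
  have hSc : Sb.card = 12295800 * 65520 := by
    rw [← Set.ncard_coe_finset, hSb, ← Nat.card_coe_set_eq, H.hb.2.2]
  have c8 := Finset.card_le_mul_card_image (f := red 3) Sb 9 (fun y _ => m3_fib8 hB _
    (fun v hv => (Finset.mem_filter.1 (Finset.mem_filter.1 hv).1).1)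
    (fun v hv w hw => (Finset.mem_filter.1 hv).2.trans (Finset.mem_filter.1 hw).2.symm))
  have c2 : ((TF B 2).image (red 3)).card = (TF B 2).card :=
    Finset.card_image_of_injOn fun x hx y hy h => m3_inj hB (by norm_num) hx hy h
  have c5 : ((TF B 5).image (red 3)).card = (TF B 5).card :=
    Finset.card_image_of_injOn fun x hx y hy h => m3_55 hB hx hy h
  have d25 : Disjoint ((TF B 2).image (red 3)) ((TF B 5).image (red 3)) := by
    rw [Finset.disjoint_left]
    intro y h1 h2
    obtain ⟨v, hv, rfl⟩ := Finset.mem_image.mp h1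
    obtain ⟨w, hw, h⟩ := Finset.mem_image.mp h2
    have := m3_inj hB (by norm_num) hv hw h.symm
    subst this
    rw [mem_TF hB] at hv hw; lia
  have d28 : Disjoint ((TF B 2).image (red 3) ∪ (TF B 5).image (red 3)) (Sb.image (red 3)) := by
    rw [Finset.disjoint_left]
    intro y h1 h2
    obtain ⟨x, hx, rfl⟩ := Finset.mem_image.mp h2
    obtain ⟨hx8, hxb⟩ := Finset.mem_filter.1 hx
    rcases Finset.mem_union.1 h1 with h1 | h1
    · obtain ⟨w, hw, h⟩ := Finset.mem_image.mp h1
      have hne : x ≠ w := by rintro rfl; rw [mem_TF hB] at hx8 hw; lia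
      obtain ⟨u, hu, k, hk, hk', hip, h0, -⟩ := m3_vals hB hx8 hw h.symm hne
      have k2 : k = 2 := by push_cast at h0; lia
      subst k2
      have hz : x + (2 : ℤ) • w = 0 := by
        apply hB.eq_zero
        rw [hB.norm_add, pairZ_smul_right, pairZ_smul_right, pairZ_smul_left]
        rw [mem_TF hB] at hx8 hw; push_cast at *; lia
      have : x ∈ Oa := by
        rw [H.ea]
        exact ⟨-w, (neg_mem_TF hB).2 hw, by show (2 : ℤ) • -w = x; rw [smul_neg]; exact (eq_neg_of_add_eq_zero_left hz).symm⟩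
      exact Set.disjoint_left.1 H.dab this hxb
    · obtain ⟨w, hw, h⟩ := Finset.mem_image.mp h1
      exact H.XX_b (Finset.mem_filter.2 ⟨hx8, w, hw, h.symm⟩) hxb
  have hsub : (TF B 2).image (red 3) ∪ (TF B 5).image (red 3) ∪ Sb.image (red 3) ⊆ Finset.univ.filter (fun x : V3 => b3 B x x = 1) := by
    intro y hy
    rw [Finset.mem_filter]
    refine ⟨Finset.mem_univ _, ?_⟩
    rcases Finset.mem_union.1 hy with h | h
    · rcases Finset.mem_union.1 h with h | h
      all_goals
        obtain ⟨w, hw, rfl⟩ := Finset.mem_image.mp h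
        rw [red_val hB hw]; decide
    · obtain ⟨w, hw, rfl⟩ := Finset.mem_image.mp h
      rw [red_val hB (Finset.mem_filter.1 hw).1]; decide
  have heq := Finset.eq_of_subset_of_card_le hsub (by
    rw [quad_count hB (by decide), Finset.card_union_of_disjoint d28, Finset.card_union_of_disjoint d25]; lia)
  have hm : red 3 v ∈ Finset.univ.filter (fun x : V3 => b3 B x x = 1) := Finset.mem_filter.2 ⟨Finset.mem_univ _, hv⟩
  rw [← heq, Finset.mem_union, Finset.mem_union, Finset.mem_image, Finset.mem_image, Finset.mem_image] at hm
  rcases hm with (⟨w, hw, h⟩ | ⟨w, hw, h⟩) | ⟨w, hw, h⟩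
  · exact ⟨w, by tauto, h.symm⟩
  · exact ⟨w, by tauto, h.symm⟩
  · exact ⟨w, Or.inr (Or.inr (Finset.mem_filter.1 hw).2), h.symm⟩

lemma T3_T5 (hB : IsLeech B) {t : LV} (ht : t ∈ TF B 3) : ∃ y ∈ TF B 5, red 2 t = red 2 y := by
  have ht' := (mem_TF hB).1 ht
  have : ∃ u ∈ TF B 2, pairZ B u t = 3 := by
    by_contra hc
    push Not at hc
    obtain ⟨s2, s4, s6, -⟩ := design_int hB t
    rw [ht'] at s2 s4 s6
    have : ∑ v ∈ TF B 2, (pairZ B v t ^ 6 - 5 * pairZ B v t ^ 4 + 4 * pairZ B v t ^ 2) = 0 := by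
      refine Finset.sum_eq_zero fun v hv => ?_
      have h1 := hc v hv
      have h2 := hc (-v) ((neg_mem_TF hB).2 hv)
      rw [pairZ_neg_left] at h2
      have hv' := (mem_TF hB).1 hv
      have ha := hB.norm_add v t
      have hs := hB.norm_sub v t
      have a0 := hB.nonneg (v + t)
      have b0 := hB.nonneg (v - t)
      have a2 := hB.2.2.2.2 (v + t)
      have b2 := hB.2.2.2.2 (v - t)
      have a3 : v + t ≠ 0 := fun h => by
        rw [eq_neg_of_add_eq_zero_left h, pairZ_neg_left, pairZ_neg_right] at hv'; push_cast at *; lia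
      have b3 : v - t ≠ 0 := fun h => by
        rw [sub_eq_zero.1 h] at hv'; push_cast at *; lia
      have a4 := hB.pos a3
      have b4 := hB.pos b3
      generalize pairZ B v t = n at *
      have : n = 0 ∨ n = 2 ∨ n = -2 ∨ n = 1 ∨ n = -1 := by push_cast at *; lia
      rcases this with rfl | rfl | rfl | rfl | rfl <;> norm_num
    rw [Finset.sum_add_distrib, Finset.sum_sub_distrib, ← Finset.mul_sum, ← Finset.mul_sum, s2, s4, s6] at this
    norm_num at this
  obtain ⟨u, hu, hut⟩ := this
  have hu' := (mem_TF hB).1 hu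
  refine ⟨(2 : ℤ) • u - t, ?_, ?_⟩
  · rw [mem_TF hB, hB.norm_sub, pairZ_smul_left, pairZ_smul_left, pairZ_smul_right]; push_cast at *; lia
  · rw [red_eq_iff]; exact ⟨t - u, by ext i; simp; ring⟩
end cover3

section frames
variable {B : MZ} {a : Fin 24 → LV}

lemma IsFrame.parity (h : IsFrame B a) (v : LV) (i j : Fin 24) : ∃ m, pairZ B v (a i) = pairZ B v (a j) + 2 * m := by
  obtain ⟨u, hu⟩ := red_eq_iff.1 (h.cong i j)
  refine ⟨pairZ B v u, ?_⟩
  have : a i = a j + (2 : ℤ) • u := by rw [← sub_eq_iff_eq_add']; exact hu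
  rw [this, pairZ_add_right, pairZ_smul_right]

lemma IsFrame.ext (hB : IsLeech B) (h : IsFrame B a) {v w : LV} (hvw : ∀ k, pairZ B v (a k) = pairZ B w (a k)) : v = w := by
  have h1 := h.expand hB v
  have h2 := h.expand hB w
  simp only [hvw] at h1
  exact smul_right_injective LV (show (8 : ℤ) ≠ 0 by norm_num) (h1.trans h2.symm)

lemma IsFrame.half (h : IsFrame B a) (m : Fin 24 → ℤ) {n : ℤ} (hm : ∑ k, m k = 2 * n) : ∃ t : LV, (2 : ℤ) • t = ∑ k, m k • a k := by
  have hg : ∀ k, ∃ u : LV, a k - a 0 = (2 : ℤ) • u := fun k => red_eq_iff.1 (h.cong k 0)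
  choose g hg using hg
  refine ⟨n • a 0 + ∑ k, m k • g k, ?_⟩
  have : ∀ k, m k • a k = m k • a 0 + (2 : ℤ) • (m k • g k) := fun k => by
    rw [smul_comm, ← hg, smul_sub]; abel
  simp only [this]
  rw [Finset.sum_add_distrib, ← Finset.sum_smul, hm, ← Finset.smul_sum, smul_add, smul_smul]

lemma IsFrame.fib (hB : IsLeech B) (h : IsFrame B a) {z : LV} (hz : z ∈ TF B 4) {i : Fin 24} (hr : red 2 z = red 2 (a i)) :
    ∃ j, z = a j ∨ z = - a j := by
  by_contra hc
  push Not at hc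
  have h0 : z = 0 := h.ext hB fun k => by
    rw [pairZ_zero_left, fib_T4_orth hB hz (h.mem hB k) (hr.trans (h.cong i k)) (hc k).1 (hc k).2]
  exact TF_ne hB (by norm_num) hz h0

lemma IsFrame.fib_sum (hB : IsLeech B) (h : IsFrame B a) (i : Fin 24) (f : LV → ℂ) :
    ∑ z ∈ (TF B 4).filter (fun z => red 2 z = red 2 (a i)), f z = ∑ k, (f (a k) + f (- a k)) := by
  classical
  have hinj : Function.Injective a := fun k l hkl => by
    by_contra hne
    have h1 := h.ip k l
    rw [hkl, h.ip, if_pos rfl, if_neg hne] at h1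
    norm_num at h1
  have hset : (TF B 4).filter (fun z => red 2 z = red 2 (a i)) = Finset.univ.image a ∪ Finset.univ.image (fun k => - a k) := by
    ext z
    simp only [Finset.mem_filter, Finset.mem_union, Finset.mem_image, Finset.mem_univ, true_and]
    constructor
    · rintro ⟨hz, hr⟩
      obtain ⟨j, hj | hj⟩ := h.fib hB hz hr
      · exact Or.inl ⟨j, hj.symm⟩
      · exact Or.inr ⟨j, hj.symm⟩
    · rintro (⟨j, rfl⟩ | ⟨j, rfl⟩)
      · exact ⟨h.mem hB j, h.cong j i⟩
      · exact ⟨(neg_mem_TF hB).2 (h.mem hB j), by rw [red2_neg]; exact h.cong j i⟩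
  have hd : Disjoint (Finset.univ.image a) (Finset.univ.image (fun k => - a k)) := by
    rw [Finset.disjoint_left]
    intro z h1 h2
    obtain ⟨k, -, rfl⟩ := Finset.mem_image.1 h1
    obtain ⟨l, -, hl⟩ := Finset.mem_image.1 h2
    have h1 := h.ip k k
    rw [if_pos rfl] at h1
    have h2 : pairZ B (a k) (a k) = - pairZ B (a k) (a l) := by
      conv_lhs => rw [← hl, pairZ_neg_left, pairZ_neg_right, neg_neg]
      rw [← hl, pairZ_neg_left, neg_neg]
    rw [h1, h.ip] at h2
    split_ifs at h2 <;> norm_num at h2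
  rw [hset, Finset.sum_union hd, Finset.sum_image (fun x _ y _ hxy => hinj hxy),
    Finset.sum_image (fun x _ y _ hxy => hinj (neg_injective hxy)), Finset.sum_add_distrib]

def D2 (y : LV) (f : LV → ℤ) : LV → ℤ := fun x => f (x + y) + f (x - y) - 2 * f x

lemma D2_sum {ι : Type*} (s : Finset ι) (y : LV) (f : ι → LV → ℤ) : D2 y (fun x => ∑ u ∈ s, f u x) = fun x => ∑ u ∈ s, D2 y (f u) x := by
  ext x; simp only [D2, Finset.sum_sub_distrib, Finset.sum_add_distrib, Finset.mul_sum]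

lemma D2_pow (c : LV) (y : LV) : D2 y (fun x => pairZ B c x ^ 8) =
    fun x => 56 * pairZ B c x ^ 6 * pairZ B c y ^ 2 + 140 * pairZ B c x ^ 4 * pairZ B c y ^ 4 + 56 * pairZ B c x ^ 2 * pairZ B c y ^ 6
      + 2 * pairZ B c y ^ 8 := by
  ext x; simp only [D2, pairZ_add_right, pairZ_sub_right]; ring

set_option maxHeartbeats 1000000 in
lemma IsFrame.S4 (hB : IsLeech B) (h : IsFrame B a) {i j k l : Fin 24} (hij : i ≠ j) (hik : i ≠ k) (hil : i ≠ l) (hjk : j ≠ k)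
    (hjl : j ≠ l) (hkl : k ≠ l) :
    ∑ u ∈ TF B 2, (pairZ B u (a i) ^ 2 * pairZ B u (a j) ^ 2 * pairZ B u (a k) ^ 2 * pairZ B u (a l) ^ 2) = 393216 := by
  have hF : (fun x : LV => ∑ u ∈ TF B 2, pairZ B u x ^ 8) = fun x => 10080 * pairZ B x x ^ 4 := by
    ext x; exact (design_int hB x).2.2.2.1
  have h1 := congrArg (fun f => D2 (a i) (D2 (a j) (D2 (a k) (D2 (a l) f))) 0) hF
  simp only [D2_sum, D2_pow] at h1
  have e1 : ∀ u : LV, D2 (a i) (D2 (a j) (D2 (a k) (fun x => 56 * pairZ B u x ^ 6 * pairZ B u (a l) ^ 2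
      + 140 * pairZ B u x ^ 4 * pairZ B u (a l) ^ 4 + 56 * pairZ B u x ^ 2 * pairZ B u (a l) ^ 6
      + 2 * pairZ B u (a l) ^ 8))) 0 = 40320 * (pairZ B u (a i) ^ 2 * pairZ B u (a j) ^ 2 * pairZ B u (a k) ^ 2 * pairZ B u (a l) ^ 2) := fun u => by
    simp only [D2, pairZ_add_right, pairZ_sub_right, pairZ_zero_right]; ring
  simp only [e1] at h1
  rw [← Finset.mul_sum] at h1
  have e2 : D2 (a l) (fun x => 10080 * pairZ B x x ^ 4) = fun x => 10080 * ((pairZ B x x + 2 * pairZ B x (a l) + 8) ^ 4 +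
      (pairZ B x x - 2 * pairZ B x (a l) + 8) ^ 4 - 2 * pairZ B x x ^ 4) := by
    ext x; simp only [D2, hB.norm_add, hB.norm_sub, h.ip, if_true]; ring
  rw [e2] at h1
  simp only [D2, hB.norm_add, hB.norm_sub, pairZ_add_left, pairZ_sub_left, h.ip, if_true, if_neg hij, if_neg hik, if_neg hil, if_neg hjk,
    if_neg hjl, if_neg hkl, pairZ_zero_left] at h1
  norm_num at h1
  lia

lemma IsFrame.sq_sum (hB : IsLeech B) (h : IsFrame B a) {m : ℕ} {v : LV} (hv : v ∈ TF B m) : ∑ k, pairZ B v (a k) ^ 2 = 16 * m := by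
  have := h.parseval hB v v
  rw [(mem_TF hB).1 hv] at this
  simp only [pow_two]; lia

lemma sq_odd_aux {c : Fin 24 → ℤ} (hodd : ∀ k, ∃ m, c k = 2 * m + 1) (hs : ∑ k, c k ^ 2 = 32) :
    ∃ j, c j ^ 2 = 9 ∧ ∀ k, k ≠ j → c k ^ 2 = 1 := by
  have h1 : ∀ k, ∃ n : ℕ, c k ^ 2 = 1 + 8 * n := fun k => by
    obtain ⟨m, hm⟩ := hodd k
    obtain ⟨n, hn⟩ := Int.even_mul_succ_self m
    refine ⟨n.toNat, ?_⟩
    have : 0 ≤ n := by nlinarith [sq_nonneg (2 * m + 1)]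
    rw [Int.toNat_of_nonneg this, hm]; nlinarith
  choose n hn using h1
  simp only [hn] at hs
  rw [Finset.sum_add_distrib, ← Finset.mul_sum] at hs
  simp only [Finset.sum_const, Finset.card_univ, Fintype.card_fin] at hs
  have hs' : ∑ k, n k = 1 := by
    have : ((∑ k, n k : ℕ) : ℤ) = 1 := by push_cast; simp at hs; lia
    exact_mod_cast this
  obtain ⟨j, hj⟩ : ∃ j, n j ≠ 0 := by
    by_contra hc; push Not at hc; simp [hc] at hs'
  have h2 := Finset.add_sum_erase Finset.univ n (Finset.mem_univ j)
  have h3 : n j = 1 ∧ ∑ k ∈ Finset.univ.erase j, n k = 0 := by lia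
  refine ⟨j, by rw [hn, h3.1]; norm_num, fun k hk => ?_⟩
  have := (Finset.sum_eq_zero_iff.1 h3.2) k (Finset.mem_erase.2 ⟨hk, Finset.mem_univ _⟩)
  rw [hn, this]; norm_num

def OctT (B : MZ) (a : Fin 24 → LV) (b : LV) : Prop := ∀ k, pairZ B b (a k) ^ 2 = 0 ∨ pairZ B b (a k) ^ 2 = 4

lemma IsFrame.classify (hB : IsLeech B) (h : IsFrame B a) {b : LV} (hb : b ∈ TF B 2) :
    (∃ j, pairZ B b (a j) ^ 2 = 9 ∧ ∀ k, k ≠ j → pairZ B b (a k) ^ 2 = 1) ∨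
    (∃ i j, ∀ k, (if k = i ∨ k = j then pairZ B b (a k) ^ 2 = 16 else pairZ B b (a k) = 0)) ∨ OctT B a b := by
  have hs := h.sq_sum hB hb
  have hb' := (mem_TF hB).1 hb
  rcases Int.even_or_odd' (pairZ B b (a 0)) with ⟨c, hc | hc⟩
  · right
    have hev : ∀ k, ∃ m, pairZ B b (a k) = 2 * m := fun k => by
      obtain ⟨m, hm⟩ := h.parity b k 0
      exact ⟨c + m, by lia⟩
    choose m hm using hev
    by_cases hall : ∀ k, m k ^ 2 ≤ 1
    · right
      intro k
      have h1 := hall k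
      have : m k = 0 ∨ m k = 1 ∨ m k = -1 := by
        have : -1 ≤ m k := by nlinarith
        have : m k ≤ 1 := by nlinarith
        lia
      rw [hm]
      rcases this with e | e | e <;> rw [e] <;> norm_num
    · left
      push Not at hall
      obtain ⟨i, hi⟩ := hall
      have hle : pairZ B b (a i) ^ 2 ≤ 32 := by
        rw [show (32 : ℤ) = 16 * ((2 : ℕ) : ℤ) by norm_num, ← hs]
        exact Finset.single_le_sum (f := fun k => pairZ B b (a k) ^ 2) (fun k _ => sq_nonneg _) (Finset.mem_univ i)
      rw [hm] at hle
      have hmi : m i = 2 ∨ m i = -2 := by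
        have : -2 ≤ m i := by nlinarith
        have : m i ≤ 2 := by nlinarith
        have : m i ≠ 1 := by intro h; rw [h] at hi; norm_num at hi
        have : m i ≠ -1 := by intro h; rw [h] at hi; norm_num at hi
        have : m i ≠ 0 := by intro h; rw [h] at hi; norm_num at hi
        lia
      obtain ⟨s, hs1, hs2⟩ : ∃ s : ℤ, s ^ 2 = 1 ∧ m i = 2 * s := by
        rcases hmi with e | e
        · exact ⟨1, by norm_num, by lia⟩
        · exact ⟨-1, by norm_num, by lia⟩
      have hz : (2 : ℤ) • b - s • a i ∈ TF B 4 := by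
        rw [mem_TF hB, hB.norm_sub]
        simp only [pairZ_smul_left, pairZ_smul_right, h.ip, hm, hs2, if_true, hb']
        push_cast; linear_combination (-8 : ℤ) * hs1
      have hr : red 2 ((2 : ℤ) • b - s • a i) = red 2 (a i) := by
        rw [red_eq_iff]
        rcases sq_eq_one_iff.1 hs1 with rfl | rfl
        · exact ⟨b - a i, by ext t; simp; ring⟩
        · exact ⟨b, by ext t; simp⟩
      obtain ⟨j, hj⟩ := h.fib hB hz hr
      obtain ⟨e, he1, he2⟩ : ∃ e : ℤ, e ^ 2 = 1 ∧ (2 : ℤ) • b = s • a i + e • a j := by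
        rcases hj with hj | hj
        · exact ⟨1, by norm_num, by rw [one_smul, ← hj]; abel⟩
        · exact ⟨-1, by norm_num, by rw [_root_.neg_smul, one_smul, ← hj]; abel⟩
      have hco : ∀ k, 2 * pairZ B b (a k) = s * (if i = k then 8 else 0) + e * (if j = k then 8 else 0) := fun k => by
        rw [← pairZ_smul_left, he2, pairZ_add_left, pairZ_smul_left, pairZ_smul_left, h.ip, h.ip]
      have hij : i ≠ j := by
        rintro rfl
        have := hco i
        rw [if_pos rfl, hm, hs2] at this
        have : e = -s/2 := by lia
        have e0 : 2 * e = - s := by lia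
        nlinarith
      refine ⟨i, j, fun k => ?_⟩
      have := hco k
      split_ifs with hk
      · rcases hk with rfl | rfl
        · rw [if_pos rfl, if_neg hij.symm] at this
          have e0 : pairZ B b (a k) = 4 * s := by lia
          rw [e0]; linear_combination 16 * hs1
        · rw [if_pos rfl, if_neg hij] at this
          have e0 : pairZ B b (a k) = 4 * e := by lia
          rw [e0]; linear_combination 16 * he1
      · push Not at hk
        rw [if_neg (Ne.symm hk.1), if_neg (Ne.symm hk.2)] at this; lia
  · left
    refine sq_odd_aux (fun k => ?_) (by rw [hs]; norm_num)
    obtain ⟨m, hm⟩ := h.parity b k 0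
    exact ⟨c + m, by lia⟩
end frames

section oct
variable {B : MZ} {a : Fin 24 → LV}

open scoped Classical in
def Oct (B : MZ) (a : Fin 24 → LV) : Finset LV := (TF B 2).filter (OctT B a)

lemma mem_Oct {b : LV} : b ∈ Oct B a ↔ b ∈ TF B 2 ∧ OctT B a b := by classical exact Finset.mem_filter

lemma oct_point (hB : IsLeech B) (h : IsFrame B a) {b : LV} (hb : b ∈ TF B 2) {i j k l : Fin 24} (hij : i ≠ j) (hik : i ≠ k)
    (hil : i ≠ l) (hjk : j ≠ k) (hjl : j ≠ l) (hkl : k ≠ l) (P : ℤ → ℤ) (hP : P = fun z => z * (z - 4) * (z - 16)) (Z : Fin 24 → ℤ)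
    (hZ : Z = fun k => pairZ B b (a k) ^ 2) [Decidable (OctT B a b)] :
    315 * (Z i * Z j * Z k * Z l) = 315 * (if OctT B a b then Z i * Z j * Z k * Z l else 0) + (8 * P (Z i) - Z i * P (Z i))
      + (P (Z i) - Z i * P (Z i)) + (P (Z j) - Z j * P (Z j)) + (P (Z k) - Z k * P (Z k)) + (P (Z l) - Z l * P (Z l)) := by
  have hZ' : ∀ k, pairZ B b (a k) ^ 2 = Z k := fun k => by rw [hZ]
  rcases h.classify hB hb with ⟨m, h9, h1⟩ | ⟨p, q, h2⟩ | h3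
  · have hn : ¬ OctT B a b := fun ho => by
      have := ho m; rw [h9] at this; norm_num at this
    rw [if_neg hn]
    rw [hZ'] at h9
    simp only [hZ'] at h1
    subst hP
    by_cases e1 : i = m
    · subst e1; rw [h9, h1 j hij.symm, h1 k hik.symm, h1 l hil.symm]; norm_num
    by_cases e2 : j = m
    · subst e2; rw [h9, h1 i e1, h1 k hjk.symm, h1 l hjl.symm]; norm_num
    by_cases e3 : k = m
    · subst e3; rw [h9, h1 i e1, h1 j e2, h1 l hkl.symm]; norm_num
    by_cases e4 : l = m
    · subst e4; rw [h9, h1 i e1, h1 j e2, h1 k e3]; norm_num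
    · rw [h1 i e1, h1 j e2, h1 k e3, h1 l e4]; norm_num
  · have hP0 : ∀ k, P (Z k) = 0 := fun k => by
      have := h2 k
      rw [hP]
      split_ifs at this with hk
      · rw [← hZ', this]; norm_num
      · rw [← hZ', this]; norm_num
    have hz : Z i * Z j * Z k * Z l = 0 := by
      by_contra hne
      simp only [mul_eq_zero, not_or] at hne
      have hk : ∀ k, Z k ≠ 0 → k = p ∨ k = q := fun k hk => by
        by_contra hc
        have := h2 k
        rw [if_neg hc] at this
        exact hk (by rw [← hZ', this]; norm_num)
      have := hk i hne.1.1.1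
      have := hk j hne.1.1.2
      have := hk k hne.1.2
      grind
    simp only [hP0, hz]; simp
  · have hP0 : ∀ k, P (Z k) = 0 := fun k => by
      rw [hP, ← hZ']
      rcases h3 k with e | e <;> rw [e] <;> norm_num
    rw [if_pos h3]; simp only [hP0]; ring

lemma oct_P (hB : IsLeech B) (h : IsFrame B a) (i : Fin 24) :
    ∑ b ∈ TF B 2, (pairZ B b (a i) ^ 2 * (pairZ B b (a i) ^ 2 - 4) * (pairZ B b (a i) ^ 2 - 16)) = 2949120 ∧
    ∑ b ∈ TF B 2, pairZ B b (a i) ^ 2 * (pairZ B b (a i) ^ 2 * (pairZ B b (a i) ^ 2 - 4) * (pairZ B b (a i) ^ 2 - 16)) = -7372800 := by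
  obtain ⟨h1, h2, h3, h4, -⟩ := design_int hB (a i)
  rw [h.ip, if_pos rfl] at h1 h2 h3 h4
  constructor
  · have e : ∀ b, pairZ B b (a i) ^ 2 * (pairZ B b (a i) ^ 2 - 4) * (pairZ B b (a i) ^ 2 - 16) =
      pairZ B b (a i) ^ 6 - 20 * pairZ B b (a i) ^ 4 + 64 * pairZ B b (a i) ^ 2 := fun b => by ring
    simp only [e, Finset.sum_add_distrib, Finset.sum_sub_distrib, ← Finset.mul_sum, h1, h2, h3]; norm_num
  · have e : ∀ b, pairZ B b (a i) ^ 2 * (pairZ B b (a i) ^ 2 * (pairZ B b (a i) ^ 2 - 4) * (pairZ B b (a i) ^ 2 - 16)) =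
      pairZ B b (a i) ^ 8 - 20 * pairZ B b (a i) ^ 6 + 64 * pairZ B b (a i) ^ 4 := fun b => by ring
    simp only [e, Finset.sum_add_distrib, Finset.sum_sub_distrib, ← Finset.mul_sum, h2, h3, h4]; norm_num

lemma oct4 (hB : IsLeech B) (h : IsFrame B a) {i j k l : Fin 24} (hij : i ≠ j) (hik : i ≠ k)
    (hil : i ≠ l) (hjk : j ≠ k) (hjl : j ≠ l) (hkl : k ≠ l) :
    ∑ b ∈ Oct B a, (pairZ B b (a i) ^ 2 * pairZ B b (a j) ^ 2 * pairZ B b (a k) ^ 2 * pairZ B b (a l) ^ 2) = 163840 := by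
  let : DecidablePred (OctT B a) := fun _ => Classical.propDecidable _
  have h1 := Finset.sum_congr rfl fun b (hb : b ∈ TF B 2) => oct_point hB h hb hij hik hil hjk hjl hkl _ rfl _ rfl
  simp only [Finset.sum_add_distrib, Finset.sum_sub_distrib, ← Finset.mul_sum, h.S4 hB hij hik hil hjk hjl hkl,
    (oct_P hB h _).1, (oct_P hB h _).2] at h1
  rw [← Finset.sum_filter] at h1
  have e : Finset.filter (OctT B a) (TF B 2) = Oct B a := by unfold Oct; congr
  rw [e] at h1
  lia

lemma oct_sum (hB : IsLeech B) (h : IsFrame B a) {b : LV} (hb : b ∈ Oct B a) : ∑ k, pairZ B b (a k) ^ 2 = 32 := by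
  rw [h.sq_sum hB (mem_Oct.1 hb).1]; norm_num

lemma oct_sq {b : LV} (hb : b ∈ Oct B a) (k : Fin 24) : pairZ B b (a k) ^ 2 * pairZ B b (a k) ^ 2 = 4 * pairZ B b (a k) ^ 2 := by
  rcases (mem_Oct.1 hb).2 k with e | e <;> rw [e] <;> norm_num

lemma oct3 (hB : IsLeech B) (h : IsFrame B a) {i j k : Fin 24} (hij : i ≠ j) (hik : i ≠ k) (hjk : j ≠ k) :
    ∑ b ∈ Oct B a, (pairZ B b (a i) ^ 2 * pairZ B b (a j) ^ 2 * pairZ B b (a k) ^ 2) = 172032 := by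
  set N := ∑ b ∈ Oct B a, (pairZ B b (a i) ^ 2 * pairZ B b (a j) ^ 2 * pairZ B b (a k) ^ 2) with hN
  have h1 : ∑ l, ∑ b ∈ Oct B a, (pairZ B b (a i) ^ 2 * pairZ B b (a j) ^ 2 * pairZ B b (a k) ^ 2 * pairZ B b (a l) ^ 2) = 32 * N := by
    rw [Finset.sum_comm, hN, Finset.mul_sum]
    refine Finset.sum_congr rfl fun b hb => ?_
    rw [← Finset.mul_sum, oct_sum hB h hb]; ring
  have h2 : ∀ l, ∑ b ∈ Oct B a, (pairZ B b (a i) ^ 2 * pairZ B b (a j) ^ 2 * pairZ B b (a k) ^ 2 * pairZ B b (a l) ^ 2) =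
      163840 + (if l = i then 4 * N - 163840 else 0) + (if l = j then 4 * N - 163840 else 0) + (if l = k then 4 * N - 163840 else 0) := fun l => by
    by_cases e1 : l = i
    · subst e1; rw [if_pos rfl, if_neg hij, if_neg hik, hN, Finset.mul_sum, add_zero, add_zero, add_sub_cancel]
      exact Finset.sum_congr rfl fun b hb => by linear_combination (pairZ B b (a j) ^ 2 * pairZ B b (a k) ^ 2) * oct_sq hb l
    by_cases e2 : l = j
    · subst e2; rw [if_pos rfl, if_neg e1, if_neg hjk, hN, Finset.mul_sum, add_zero, add_zero, add_sub_cancel]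
      exact Finset.sum_congr rfl fun b hb => by linear_combination (pairZ B b (a i) ^ 2 * pairZ B b (a k) ^ 2) * oct_sq hb l
    by_cases e3 : l = k
    · subst e3; rw [if_pos rfl, if_neg e1, if_neg e2, hN, Finset.mul_sum, add_zero, add_zero, add_sub_cancel]
      exact Finset.sum_congr rfl fun b hb => by linear_combination (pairZ B b (a i) ^ 2 * pairZ B b (a j) ^ 2) * oct_sq hb l
    · rw [if_neg e1, if_neg e2, if_neg e3, oct4 hB h hij hik (Ne.symm e1) hjk (Ne.symm e2) (Ne.symm e3)]; norm_num
  simp only [h2, Finset.sum_add_distrib, Finset.sum_ite_eq', Finset.mem_univ, if_true, Finset.sum_const, Finset.card_univ, Fintype.card_fin] at h1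
  simp at h1; lia

lemma oct2 (hB : IsLeech B) (h : IsFrame B a) {i j : Fin 24} (hij : i ≠ j) :
    ∑ b ∈ Oct B a, (pairZ B b (a i) ^ 2 * pairZ B b (a j) ^ 2) = 157696 := by
  set N := ∑ b ∈ Oct B a, (pairZ B b (a i) ^ 2 * pairZ B b (a j) ^ 2) with hN
  have h1 : ∑ l, ∑ b ∈ Oct B a, (pairZ B b (a i) ^ 2 * pairZ B b (a j) ^ 2 * pairZ B b (a l) ^ 2) = 32 * N := by
    rw [Finset.sum_comm, hN, Finset.mul_sum]
    refine Finset.sum_congr rfl fun b hb => ?_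
    rw [← Finset.mul_sum, oct_sum hB h hb]; ring
  have h2 : ∀ l, ∑ b ∈ Oct B a, (pairZ B b (a i) ^ 2 * pairZ B b (a j) ^ 2 * pairZ B b (a l) ^ 2) =
      172032 + (if l = i then 4 * N - 172032 else 0) + (if l = j then 4 * N - 172032 else 0) := fun l => by
    by_cases e1 : l = i
    · subst e1; rw [if_pos rfl, if_neg hij, hN, Finset.mul_sum, add_zero, add_sub_cancel]
      exact Finset.sum_congr rfl fun b hb => by linear_combination (pairZ B b (a j) ^ 2) * oct_sq hb l
    by_cases e2 : l = j
    · subst e2; rw [if_pos rfl, if_neg e1, hN, Finset.mul_sum, add_zero, add_sub_cancel]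
      exact Finset.sum_congr rfl fun b hb => by linear_combination (pairZ B b (a i) ^ 2) * oct_sq hb l
    · rw [if_neg e1, if_neg e2, oct3 hB h hij (Ne.symm e1) (Ne.symm e2)]; norm_num
  simp only [h2, Finset.sum_add_distrib, Finset.sum_ite_eq', Finset.mem_univ, if_true, Finset.sum_const, Finset.card_univ, Fintype.card_fin] at h1
  simp at h1; lia

lemma lemmaP_alg (hB : IsLeech B) (h : IsFrame B a) (K : Fin 24 → Fin 24 → ℂ) (hs : ∀ k l, K k l = K l k) (h0 : ∀ k, K k k = 0) (c : ℂ)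
    (hc : ∀ b ∈ Oct B a, ∑ k, ∑ l, (((pairZ B b (a k) ^ 2 * pairZ B b (a l) ^ 2 : ℤ) : ℂ)) * K k l = c) {i j : Fin 24} (hij : i ≠ j) :
    K i j = c / 896 := by
  have hM : ∀ i j k l, i ≠ j → (((∑ b ∈ Oct B a, (pairZ B b (a i) ^ 2 * pairZ B b (a j) ^ 2 * pairZ B b (a k) ^ 2 * pairZ B b (a l) ^ 2) : ℤ)) : ℂ) * K k l
      = (163840 + 524288 * ((if k = i then 1 else 0) + (if k = j then 1 else 0) + (if l = i then 1 else 0) + (if l = j then 1 else 0))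
        + 1310720 * ((if k = i then (if l = j then 1 else 0) else 0) + (if k = j then (if l = i then 1 else 0) else 0))) * K k l := by
    intro i j k l hij
    by_cases hkl : k = l
    · subst hkl; rw [h0]; ring
    congr 1
    by_cases e1 : k = i
    · subst e1
      by_cases e2 : l = j
      · subst e2
        have : ∑ b ∈ Oct B a, (pairZ B b (a k) ^ 2 * pairZ B b (a l) ^ 2 * pairZ B b (a k) ^ 2 * pairZ B b (a l) ^ 2) = 16 * 157696 := by
          rw [← oct2 hB h hij, Finset.mul_sum]
          exact Finset.sum_congr rfl fun b hb => by
            linear_combination (pairZ B b (a l) ^ 2 * pairZ B b (a l) ^ 2) * oct_sq hb k + (4 * pairZ B b (a k) ^ 2) * oct_sq hb l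
        rw [this]; simp [hij, hij.symm]; norm_num
      · have : ∑ b ∈ Oct B a, (pairZ B b (a k) ^ 2 * pairZ B b (a j) ^ 2 * pairZ B b (a k) ^ 2 * pairZ B b (a l) ^ 2) = 4 * 172032 := by
          rw [← oct3 hB h hij hkl (Ne.symm e2), Finset.mul_sum]
          exact Finset.sum_congr rfl fun b hb => by
            linear_combination (pairZ B b (a l) ^ 2 * pairZ B b (a j) ^ 2) * oct_sq hb k
        rw [this]; simp [hij, e2, Ne.symm hkl]; norm_num
    by_cases e2 : k = j
    · subst e2
      by_cases e3 : l = i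
      · subst e3
        have : ∑ b ∈ Oct B a, (pairZ B b (a l) ^ 2 * pairZ B b (a k) ^ 2 * pairZ B b (a k) ^ 2 * pairZ B b (a l) ^ 2) = 16 * 157696 := by
          rw [← oct2 hB h hij, Finset.mul_sum]
          exact Finset.sum_congr rfl fun b hb => by
            linear_combination (pairZ B b (a l) ^ 2 * pairZ B b (a l) ^ 2) * oct_sq hb k + (4 * pairZ B b (a k) ^ 2) * oct_sq hb l
        rw [this]; simp [hij, hij.symm]; norm_num
      · have : ∑ b ∈ Oct B a, (pairZ B b (a i) ^ 2 * pairZ B b (a k) ^ 2 * pairZ B b (a k) ^ 2 * pairZ B b (a l) ^ 2) = 4 * 172032 := by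
          rw [← oct3 hB h hij (Ne.symm e3) hkl, Finset.mul_sum]
          exact Finset.sum_congr rfl fun b hb => by
            linear_combination (pairZ B b (a l) ^ 2 * pairZ B b (a i) ^ 2) * oct_sq hb k
        rw [this]; simp [e1, e3, Ne.symm hkl]; norm_num
    by_cases e3 : l = i
    · subst e3
      have : ∑ b ∈ Oct B a, (pairZ B b (a l) ^ 2 * pairZ B b (a j) ^ 2 * pairZ B b (a k) ^ 2 * pairZ B b (a l) ^ 2) = 4 * 172032 := by
        rw [← oct3 hB h hij (Ne.symm hkl) (Ne.symm e2), Finset.mul_sum]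
        exact Finset.sum_congr rfl fun b hb => by
          linear_combination (pairZ B b (a k) ^ 2 * pairZ B b (a j) ^ 2) * oct_sq hb l
      rw [this]; simp [e1, e2, hij]; norm_num
    by_cases e4 : l = j
    · subst e4
      have : ∑ b ∈ Oct B a, (pairZ B b (a i) ^ 2 * pairZ B b (a l) ^ 2 * pairZ B b (a k) ^ 2 * pairZ B b (a l) ^ 2) = 4 * 172032 := by
        rw [← oct3 hB h hij (Ne.symm e1) (Ne.symm hkl), Finset.mul_sum]
        exact Finset.sum_congr rfl fun b hb => by
          linear_combination (pairZ B b (a k) ^ 2 * pairZ B b (a i) ^ 2) * oct_sq hb l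
      rw [this]; simp [e1, e2, e3]; norm_num
    · rw [oct4 hB h hij (Ne.symm e1) (Ne.symm e3) (Ne.symm e2) (Ne.symm e4) hkl]; simp [e1, e2, e3, e4]
  set T : Fin 24 → ℂ := fun i => ∑ l, K i l with hT
  set S : ℂ := ∑ i, T i with hS
  have hmain : ∀ i j, i ≠ j → 640 * S + 4096 * (T i + T j) + 10240 * K i j = 616 * c := by
    intro i j hij
    have h1 : ∑ b ∈ Oct B a, ((pairZ B b (a i) ^ 2 * pairZ B b (a j) ^ 2 : ℤ) : ℂ) * ∑ k, ∑ l, (((pairZ B b (a k) ^ 2 * pairZ B b (a l) ^ 2 : ℤ) : ℂ)) * K k l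
        = 157696 * c := by
      rw [Finset.sum_congr rfl fun b hb => by rw [hc b hb], ← Finset.sum_mul, ← Int.cast_sum, oct2 hB h hij]; norm_num
    simp only [Finset.mul_sum] at h1
    rw [Finset.sum_comm] at h1
    have h2 : ∀ k, ∑ b ∈ Oct B a, ∑ l, ((pairZ B b (a i) ^ 2 * pairZ B b (a j) ^ 2 : ℤ) : ℂ) * ((((pairZ B b (a k) ^ 2 * pairZ B b (a l) ^ 2 : ℤ) : ℂ)) * K k l)
      = ∑ l, (163840 + 524288 * ((if k = i then 1 else 0) + (if k = j then 1 else 0) + (if l = i then 1 else 0) + (if l = j then 1 else 0))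
        + 1310720 * ((if k = i then (if l = j then 1 else 0) else 0) + (if k = j then (if l = i then 1 else 0) else 0))) * K k l := fun k => by
      rw [Finset.sum_comm]
      refine Finset.sum_congr rfl fun l _ => ?_
      rw [← hM i j k l hij, Int.cast_sum, Finset.sum_mul]
      exact Finset.sum_congr rfl fun b _ => by push_cast; ring
    simp only [h2] at h1
    have h3 : ∑ k, ∑ l, (163840 + 524288 * ((if k = i then 1 else 0) + (if k = j then 1 else 0) + (if l = i then 1 else 0) + (if l = j then 1 else 0))
        + 1310720 * ((if k = i then (if l = j then 1 else 0) else 0) + (if k = j then (if l = i then 1 else 0) else 0))) * K k l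
        = 163840 * S + 524288 * (T i + T j + T i + T j) + 1310720 * (K i j + K j i) := by
      simp only [add_mul, mul_add, mul_ite, ite_mul, mul_zero, zero_mul, mul_one, Finset.sum_add_distrib]
      simp only [← Finset.mul_sum, Finset.sum_ite_eq', Finset.mem_univ, if_true]
      simp only [hS, hT, Finset.sum_ite_irrel, Finset.sum_const_zero, Finset.sum_ite_eq', Finset.mem_univ, if_true, ← Finset.mul_sum]
      rw [Finset.sum_congr rfl fun k _ => hs k i, Finset.sum_congr rfl fun k _ => hs k j]
    rw [h3, hs j i] at h1
    linear_combination h1 / 256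
  have hrow : ∀ i, 100352 * T i + 18816 * S = 23 * 616 * c := fun i => by
    have : ∑ j ∈ Finset.univ.erase i, (640 * S + 4096 * (T i + T j) + 10240 * K i j) = ∑ j ∈ (Finset.univ : Finset (Fin 24)).erase i, 616 * c :=
      Finset.sum_congr rfl fun j hj => hmain i j (Finset.ne_of_mem_erase hj).symm
    simp only [Finset.sum_const, Finset.card_erase_of_mem (Finset.mem_univ i), Finset.card_univ, Fintype.card_fin, Finset.sum_add_distrib,
      ← Finset.mul_sum] at this
    have e1 : ∑ j ∈ Finset.univ.erase i, T j = S - T i := by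
      rw [← Finset.add_sum_erase _ _ (Finset.mem_univ i)] at hS; linear_combination - hS
    have e2 : ∑ j ∈ Finset.univ.erase i, K i j = T i := by
      have := Finset.add_sum_erase Finset.univ (fun j => K i j) (Finset.mem_univ i)
      simp only [h0] at this; simp only [hT]; linear_combination this
    rw [e1, e2] at this
    simp at this
    linear_combination this
  have htot : 551936 * S = 24 * 23 * 616 * c := by
    have : ∑ i, (100352 * T i + 18816 * S) = ∑ _i : Fin 24, 23 * 616 * c := Finset.sum_congr rfl fun i _ => hrow i
    rw [Finset.sum_add_distrib, ← Finset.mul_sum, ← hS] at this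
    simp at this
    linear_combination this
  have hSv : S = 24 * 23 * 616 / 551936 * c := by linear_combination htot / 551936
  have hTv : ∀ i, T i = (23 * 616 - 18816 * (24 * 23 * 616 / 551936)) / 100352 * c := fun i => by
    linear_combination (hrow i) / 100352 - 18816 / 100352 * hSv
  have := hmain i j hij
  rw [hSv, hTv, hTv] at this
  linear_combination this / 10240

lemma oct_w {O2 O5 Oa Ob Oc : Set LV} (S : Setup B O2 O5 Oa Ob Oc) (h : IsFrame B a) {b : LV} (hb : b ∈ Oct B a) :
    ∃ w ∈ Ob, ∃ i, red 2 w = red 2 (a i) ∧ ∀ k, pairZ B w (a k) ^ 2 = 4 * pairZ B b (a k) ^ 2 := by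
  have hB := S.hB
  obtain ⟨hb2, ho⟩ := mem_Oct.1 hb
  obtain ⟨i, hi⟩ : ∃ i, pairZ B b (a i) ^ 2 = 4 := by
    by_contra hc
    push Not at hc
    have := oct_sum hB h hb
    rw [Finset.sum_eq_zero fun k _ => (ho k).resolve_right (hc k)] at this
    norm_num at this
  obtain ⟨s, hs1, hs2⟩ : ∃ s : ℤ, s ^ 2 = 1 ∧ pairZ B b (a i) = 2 * s := by
    have : (pairZ B b (a i) - 2) * (pairZ B b (a i) + 2) = 0 := by linear_combination hi
    rcases mul_eq_zero.1 this with e | e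
    · exact ⟨1, by norm_num, by lia⟩
    · exact ⟨-1, by norm_num, by lia⟩
  have hw8 : (2 : ℤ) • b - s • a i ∈ TF B 8 := by
    rw [mem_TF hB, hB.norm_sub]
    simp only [pairZ_smul_left, pairZ_smul_right, h.ip, hs2, if_true, (mem_TF hB).1 hb2]
    push_cast; linear_combination (0 : ℤ) * hs1
  have hr : red 2 ((2 : ℤ) • b - s • a i) = red 2 (a i) := by
    rw [red_eq_iff]
    rcases sq_eq_one_iff.1 hs1 with rfl | rfl
    · exact ⟨b - a i, by ext t; simp; ring⟩
    · exact ⟨b, by ext t; simp⟩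
  have hai := h.mem hB i
  have hain := (mem_TF hB).1 hai
  refine ⟨(2 : ℤ) • b - s • a i, ?_, i, hr, fun k => ?_⟩
  · have h8 : (2 : ℤ) • b - s • a i ∈ Oa ∪ Ob ∪ Oc := by rw [S.e8]; exact hw8
    rcases h8 with (h8 | h8) | h8
    · exfalso
      rw [S.ea] at h8
      obtain ⟨u, -, hu⟩ := h8
      have h0 : red 2 (a i) = red 2 (0 : LV) := by
        rw [← hr, ← hu, red_eq_iff]; exact ⟨u, by simp⟩
      have hne := TF_ne hB (by norm_num) hai
      have := (mod2_key hB h0 hne (by simpa using hne)).1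
      rw [hain, pairZ_zero_right, pairZ_zero_right] at this; norm_num at this
    · exact h8
    · exfalso
      obtain ⟨v, hv, -, -, hv2, -⟩ := S.c_red h8
      rw [hr] at hv2
      have hvn := (mem_TF hB).1 hv
      have := mod2_key hB hv2 (by rintro rfl; rw [hain] at hvn; norm_num at hvn)
        (by intro e; rw [e, pairZ_neg_left, pairZ_neg_right, hvn] at hain; norm_num at hain)
      rw [hain, hvn] at this
      push_cast at this; lia
  · rw [pairZ_sub_left, pairZ_smul_left, pairZ_smul_left, h.ip]
    split_ifs with e
    · subst e; rw [hs2]; ring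
    · ring

open scoped Classical in
lemma lemmaP {O2 O5 Oa Ob Oc : Set LV} (S : Setup B O2 O5 Oa Ob Oc) (κ : LV → LV → ℂ)
    (hκ : ∀ σ ∈ ConwayGroup B, ∀ x y, κ (σ.mulVec x) (σ.mulVec y) = κ x y) (hs : ∀ x y, κ x y = κ y x) (hn : ∀ x y, κ (-x) y = κ x y) :
    ∃ C, ∀ a, IsFrame B a → ∀ i j, i ≠ j → κ (a i) (a j) = C := by
  have hB := S.hB
  set H : LV → ℂ := fun w => ∑ x ∈ TF B 4, if red 2 x = red 2 w then ∑ y ∈ TF B 4, (if red 2 y = red 2 w then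
    (if pairZ B x w ^ 2 = 16 ∧ pairZ B y w ^ 2 = 16 ∧ pairZ B x y = 0 then κ x y else 0) else 0) else 0 with hH
  have hHG : ∀ σ ∈ ConwayGroup B, ∀ w, H (σ.mulVec w) = H w := by
    intro σ hσ w
    have hr : ∀ x, red 2 (σ.mulVec x) = red 2 (σ.mulVec w) ↔ red 2 x = red 2 w := fun x => by
      refine ⟨fun e => ?_, cg_red⟩
      have := cg_red (σ := σ⁻¹) e
      rwa [(cg_inv hB hσ).2.1, (cg_inv hB hσ).2.1] at this
    simp only [hH]
    rw [← cg_sum hB hσ 4]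
    refine Finset.sum_congr rfl fun x _ => ?_
    rw [← cg_sum hB hσ 4]
    simp only [hr, cg_pair hσ, hκ σ hσ]
  obtain ⟨⟨v0, hv0⟩, -, -⟩ := S.hb
  have hn' : ∀ x y, κ x (-y) = κ x y := fun x y => by rw [hs, hn, hs]
  refine ⟨4 * H v0 / 896, fun a h i j hij => ?_⟩
  have := lemmaP_alg hB h (fun k l => if k = l then 0 else κ (a k) (a l)) (fun k l => by simp only [eq_comm, hs (a k)])
    (fun k => if_pos rfl) (4 * H v0) (fun b hb => ?_) hij
  · simpa [hij] using this
  · obtain ⟨w, hw, i, hr, hwk⟩ := oct_w S h hb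
    obtain ⟨σ, hσ, rfl⟩ : ∃ σ ∈ ConwayGroup B, w = σ.mulVec v0 := by rw [hv0] at hw; exact hw
    rw [← hHG σ hσ]
    set w := σ.mulVec v0
    simp only [hH]
    rw [← Finset.sum_filter]
    simp only [← Finset.sum_filter _ (fun y => if _ ∧ pairZ B y w ^ 2 = 16 ∧ _ then _ else (0 : ℂ))]
    rw [hr, h.fib_sum hB]
    simp only [h.fib_sum hB, pairZ_neg_left, pairZ_neg_right, hn, hn', neg_sq, neg_eq_zero]
    rw [Finset.mul_sum]
    refine Finset.sum_congr rfl fun k _ => ?_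
    rw [← Finset.sum_add_distrib, Finset.mul_sum]
    refine Finset.sum_congr rfl fun l _ => ?_
    rw [hB.comm (a k) w, hB.comm (a l) w, hwk, hwk, h.ip]
    by_cases hkl : k = l
    · simp [hkl]
    · rw [if_neg hkl, if_neg hkl]
      rcases (mem_Oct.1 hb).2 k with e | e <;> rcases (mem_Oct.1 hb).2 l with e' | e' <;> rw [e, e'] <;> norm_num
      ring
end oct

section trans
variable {B : MZ} {a : Fin 24 → LV} {O2 O5 Oa Ob Oc : Set LV}

lemma inv_neg' (hB : IsLeech B) {h : LV → ℂ} (hG : ∀ σ ∈ ConwayGroup B, ∀ x, h (σ.mulVec x) = h x) (x : LV) : h (-x) = h x := by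
  obtain ⟨σ, hσ, e⟩ := cg_neg hB
  rw [← e, hG σ hσ]

lemma T4_const (S : Setup B O2 O5 Oa Ob Oc) {h : LV → ℂ} (hG : ∀ σ ∈ ConwayGroup B, ∀ x, h (σ.mulVec x) = h x) :
    ∃ C, ∀ x ∈ TF B 4, h x = C := by
  obtain ⟨C, hC⟩ := lemmaP S (fun x y => h x + h y) (fun σ hσ x y => by rw [hG σ hσ, hG σ hσ]) (fun x y => add_comm _ _)
    (fun x y => by rw [inv_neg' S.hB hG])
  refine ⟨C / 2, fun x hx => ?_⟩
  obtain ⟨a, ha, i, rfl⟩ := exists_frame S.hB hx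
  obtain ⟨j, k, hj, hk, hjk⟩ : ∃ j k : Fin 24, i ≠ j ∧ i ≠ k ∧ j ≠ k := by
    clear hx; revert i; decide
  have h1 := hC a ha i j hj
  have h2 := hC a ha i k hk
  have h3 := hC a ha j k hjk
  beta_reduce at h1 h2 h3
  linear_combination (h1 + h2 - h3) / 2

lemma sign_change (hB : IsLeech B) (h : IsFrame B a) {u u' : LV} (hodd : ∀ k, ∃ m, pairZ B u (a k) = 2 * m + 1)
    (hsq : ∀ k, pairZ B u (a k) ^ 2 = pairZ B u' (a k) ^ 2) : ∃ σ ∈ ConwayGroup B, u' = σ.mulVec u := by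
  have he : ∀ k, ∃ d : ℤ, (d = 0 ∨ d = 1) ∧ pairZ B u' (a k) = (1 - 2 * d) * pairZ B u (a k) := fun k => by
    have : (pairZ B u (a k) - pairZ B u' (a k)) * (pairZ B u (a k) + pairZ B u' (a k)) = 0 := by linear_combination hsq k
    rcases mul_eq_zero.1 this with e | e
    · exact ⟨0, Or.inl rfl, by linarith⟩
    · exact ⟨1, Or.inr rfl, by linarith⟩
  choose d hd hu' using he
  have hdd : ∀ k, d k * d k = d k := fun k => by rcases hd k with e | e <;> rw [e] <;> norm_num
  have hx : ∀ k, pairZ B (u - u') (a k) = 2 * d k * pairZ B u (a k) := fun k => by rw [pairZ_sub_left, hu']; ring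
  have hex : ∀ v : LV, ∃ w : LV, ∀ k, pairZ B w (a k) = (1 - 2 * d k) * pairZ B v (a k) := by
    intro v
    obtain ⟨e, he⟩ : ∃ e : ℤ, ∀ k, ∃ n, pairZ B v (a k) - e * pairZ B u (a k) = 2 * n := by
      rcases Int.even_or_odd' (pairZ B v (a 0)) with ⟨c, hc | hc⟩
      · refine ⟨0, fun k => ?_⟩
        obtain ⟨m, hm⟩ := h.parity v k 0
        exact ⟨c + m, by lia⟩
      · refine ⟨1, fun k => ?_⟩
        obtain ⟨m, hm⟩ := h.parity v k 0
        obtain ⟨m', hm'⟩ := hodd k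
        exact ⟨c + m - m', by lia⟩
    choose n hn using he
    choose o ho using hodd
    have h1 : ∑ k, d k * n k * pairZ B u (a k) = 2 * pairZ B (u - u') v - e * pairZ B (u - u') (u - u') := by
      have p1 := h.parseval hB (u - u') v
      have p2 := h.parseval hB (u - u') (u - u')
      simp only [hx] at p1 p2
      have : 8 * ∑ k, d k * n k * pairZ B u (a k) = 2 * (8 * pairZ B (u - u') v) - e * (8 * pairZ B (u - u') (u - u')) := by
        rw [p1, p2, Finset.mul_sum, Finset.mul_sum, Finset.mul_sum, ← Finset.sum_sub_distrib]
        refine Finset.sum_congr rfl fun k _ => ?_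
        linear_combination (-4 * d k * pairZ B u (a k)) * hn k + (4 * e * pairZ B u (a k) ^ 2) * hdd k
      lia
    obtain ⟨r, hr⟩ := hB.even (u - u')
    obtain ⟨t, ht⟩ := h.half (fun k => d k * n k) (n := pairZ B (u - u') v - e * r - ∑ k, d k * n k * o k) (by
      have : ∑ k, d k * n k = ∑ k, d k * n k * pairZ B u (a k) - 2 * ∑ k, d k * n k * o k := by
        rw [Finset.mul_sum, ← Finset.sum_sub_distrib]
        exact Finset.sum_congr rfl fun k _ => by rw [ho]; ring
      rw [this, h1, hr]; ring)
    have htk : ∀ k, pairZ B t (a k) = 4 * (d k * n k) := fun k => by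
      have : 2 * pairZ B t (a k) = 8 * (d k * n k) := by
        rw [← pairZ_smul_left, ht, pairZ_sum_left]
        simp only [pairZ_smul_left, h.ip, mul_ite, mul_zero, Finset.sum_ite_eq', Finset.mem_univ, if_true]; ring
      lia
    refine ⟨v - (e • (u - u') + t), fun k => ?_⟩
    rw [pairZ_sub_left, pairZ_add_left, pairZ_smul_left, hx, htk]
    linear_combination (2 * d k) * hn k
  choose f hf using hex
  obtain ⟨σ, hσ, hσf⟩ := cg_of_fun hB f
    (fun v w => h.ext hB fun k => by rw [hf, pairZ_add_left, pairZ_add_left, hf, hf]; ring)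
    (fun v w => by
      have h1 := h.parseval hB (f v) (f w)
      have h2 := h.parseval hB v w
      have : ∑ k, pairZ B (f v) (a k) * pairZ B (f w) (a k) = ∑ k, pairZ B v (a k) * pairZ B w (a k) :=
        Finset.sum_congr rfl fun k _ => by
          rw [hf, hf]; linear_combination (4 * pairZ B v (a k) * pairZ B w (a k)) * hdd k
      lia)
  exact ⟨σ, hσ, h.ext hB fun k => by rw [hσf, hf, hu']⟩

lemma T7_shape (hB : IsLeech B) (h : IsFrame B a) {u : LV} (hu : u ∈ TF B 7) {i j : Fin 24} (hij : i ≠ j)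
    (hi : pairZ B u (a i) ^ 2 = 81) (hj : pairZ B u (a j) ^ 2 = 9) :
    (∀ k, ∃ m, pairZ B u (a k) = 2 * m + 1) ∧ ∀ k, k ≠ i → k ≠ j → pairZ B u (a k) ^ 2 = 1 := by
  have hs := h.sq_sum hB hu
  have hodd : ∀ k, ∃ m, pairZ B u (a k) = 2 * m + 1 := by
    intro k
    obtain ⟨m, hm⟩ := h.parity u k i
    have : (pairZ B u (a i) - 9) * (pairZ B u (a i) + 9) = 0 := by linear_combination hi
    rcases mul_eq_zero.1 this with e | e
    · exact ⟨m + 4, by lia⟩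
    · exact ⟨m - 5, by lia⟩
  refine ⟨hodd, fun k hki hkj => ?_⟩
  have h1 : ∀ k, 1 ≤ pairZ B u (a k) ^ 2 := fun k => by
    obtain ⟨m, hm⟩ := hodd k
    have : pairZ B u (a k) ≠ 0 := by lia
    have := sq_pos_of_ne_zero this
    lia
  rw [← Finset.add_sum_erase _ _ (Finset.mem_univ i), ← Finset.add_sum_erase _ _ (Finset.mem_erase.2 ⟨hij.symm, Finset.mem_univ j⟩),
    ← Finset.add_sum_erase _ _ (Finset.mem_erase.2 ⟨hkj, Finset.mem_erase.2 ⟨hki, Finset.mem_univ k⟩⟩), hi, hj] at hs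
  have h2 : ∑ l ∈ ((Finset.univ.erase i).erase j).erase k, (1 : ℤ) ≤ ∑ l ∈ ((Finset.univ.erase i).erase j).erase k, pairZ B u (a l) ^ 2 :=
    Finset.sum_le_sum fun l _ => h1 l
  rw [Finset.sum_const, Finset.card_erase_of_mem (Finset.mem_erase.2 ⟨hkj, Finset.mem_erase.2 ⟨hki, Finset.mem_univ k⟩⟩),
    Finset.card_erase_of_mem (Finset.mem_erase.2 ⟨hij.symm, Finset.mem_univ j⟩), Finset.card_erase_of_mem (Finset.mem_univ i)] at h2
  have := h1 k
  simp at h2; lia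

lemma T7_swap (hB : IsLeech B) (h : IsFrame B a) {u : LV} (hu : u ∈ TF B 7) {i j : Fin 24} (hij : i ≠ j)
    (hi : pairZ B u (a i) ^ 2 = 81) (hj : pairZ B u (a j) ^ 2 = 9) :
    ∃ u' ∈ TF B 7, red 3 u = red 3 u' ∧ pairZ B u' (a j) ^ 2 = 81 ∧ pairZ B u' (a i) ^ 2 = 9 := by
  obtain ⟨s, hs, hs'⟩ : ∃ s : ℤ, s ^ 2 = 1 ∧ pairZ B u (a i) = 9 * s := by
    have : (pairZ B u (a i) - 9) * (pairZ B u (a i) + 9) = 0 := by linear_combination hi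
    rcases mul_eq_zero.1 this with e | e
    · exact ⟨1, by norm_num, by lia⟩
    · exact ⟨-1, by norm_num, by lia⟩
  obtain ⟨r, hr, hr'⟩ : ∃ s : ℤ, s ^ 2 = 1 ∧ pairZ B u (a j) = 3 * s := by
    have : (pairZ B u (a j) - 3) * (pairZ B u (a j) + 3) = 0 := by linear_combination hj
    rcases mul_eq_zero.1 this with e | e
    · exact ⟨1, by norm_num, by lia⟩
    · exact ⟨-1, by norm_num, by lia⟩
  obtain ⟨n, hn⟩ : ∃ n, s + r = 2 * n := by
    rcases sq_eq_one_iff.1 hs with rfl | rfl <;> rcases sq_eq_one_iff.1 hr with rfl | rfl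
    exacts [⟨1, by norm_num⟩, ⟨0, by norm_num⟩, ⟨0, by norm_num⟩, ⟨-1, by norm_num⟩]
  obtain ⟨w, hw⟩ := h.half (fun k => (if k = i then s else 0) + (if k = j then r else 0)) (n := n) (by
    simp [Finset.sum_add_distrib, hn])
  have hw' : (2 : ℤ) • w = s • a i + r • a j := by
    rw [hw]; simp [add_smul, Finset.sum_add_distrib, ite_smul]
  have hwv : ∀ v, 2 * pairZ B w v = s * pairZ B (a i) v + r * pairZ B (a j) v := fun v => by
    rw [← pairZ_smul_left, hw', pairZ_add_left, pairZ_smul_left, pairZ_smul_left]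
  have c1 := hwv (a i)
  have c2 := hwv (a j)
  have c3 := hwv u
  have c4 := hwv w
  rw [h.ip, h.ip, if_pos rfl, if_neg hij.symm] at c1
  rw [h.ip, h.ip, if_pos rfl, if_neg hij] at c2
  rw [hB.comm (a i), hB.comm (a j), hs', hr'] at c3
  rw [hB.comm (a i), hB.comm (a j)] at c4
  have c5 : pairZ B w w = 4 := by
    have e1 : pairZ B w (a i) = 4 * s := by lia
    have e2 : pairZ B w (a j) = 4 * r := by lia
    rw [e1, e2] at c4
    linarith [show s * (4 * s) + r * (4 * r) = 8 by linear_combination 4 * hs + 4 * hr]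
  have c6 : pairZ B w u = 6 := by
    linarith [show s * (9 * s) + r * (3 * r) = 12 by linear_combination 9 * hs + 3 * hr]
  refine ⟨u - (3 : ℤ) • w, ?_, ?_, ?_, ?_⟩
  · rw [mem_TF hB, hB.norm_sub]
    simp only [pairZ_smul_left, pairZ_smul_right, c5, hB.comm u w, c6, (mem_TF hB).1 hu]; norm_num
  · rw [red_eq_iff]; exact ⟨w, by ext t; simp⟩
  · rw [pairZ_sub_left, pairZ_smul_left, hr', show pairZ B w (a j) = 4 * r by lia]; linear_combination 81 * hr
  · rw [pairZ_sub_left, pairZ_smul_left, hs', show pairZ B w (a i) = 4 * s by lia]; linear_combination 9 * hs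

lemma T7_six (hB : IsLeech B) {u : LV} (hu : u ∈ TF B 7) : ((TF B 2).filter (fun w => pairZ B w u = 6)).card ≤ 1 := by
  rw [Finset.card_le_one]
  intro w hw w' hw'
  rw [Finset.mem_filter, mem_TF hB] at hw hw'
  rw [mem_TF hB] at hu
  have hr : red 2 (u - (2 : ℤ) • w) = red 2 (u - (2 : ℤ) • w') := by
    rw [red_eq_iff]; exact ⟨w' - w, by ext t; simp; ring⟩
  by_contra hne
  have n1 : pairZ B (u - (2 : ℤ) • w) (u - (2 : ℤ) • w) = 6 := by
    rw [hB.norm_sub]; simp only [pairZ_smul_left, pairZ_smul_right, hB.comm u w, hw.1, hw.2, hu]; norm_num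
  have n2 : pairZ B (u - (2 : ℤ) • w') (u - (2 : ℤ) • w') = 6 := by
    rw [hB.norm_sub]; simp only [pairZ_smul_left, pairZ_smul_right, hB.comm u w', hw'.1, hw'.2, hu]; norm_num
  have := mod2_key hB hr (fun e => hne (by
      ext t; have := congrFun e t; simp at this; exact this)) (fun e => by
    have e' : u = w + w' := by ext t; have := congrFun e t; simp at this ⊢; lia
    have h1 : pairZ B (w + w') u = 12 := by rw [pairZ_add_left, hw.2, hw'.2]; norm_num
    rw [← e', hu] at h1; norm_num at h1)
  rw [n1, n2] at this; lia

lemma T7_five (hB : IsLeech B) {u : LV} (hu : u ∈ TF B 7) : ∃ b ∈ TF B 2, pairZ B b u = 5 := by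
  by_contra hc
  push Not at hc
  obtain ⟨h1, h2, h3, h4, h5⟩ := design_int hB u
  have hun := (mem_TF hB).1 hu
  rw [hun] at h1 h2 h3 h4 h5
  have hp : ∀ b ∈ TF B 2, pairZ B b u ^ 10 - 30 * pairZ B b u ^ 8 + 273 * pairZ B b u ^ 6 - 820 * pairZ B b u ^ 4 + 576 * pairZ B b u ^ 2
      = 21772800 * ((if pairZ B b u = 6 then 1 else 0) + (if pairZ B (-b) u = 6 then 1 else 0)) := by
    intro b hb
    have hbn := (mem_TF hB).1 hb
    have n1 := hc b hb
    have n2 := hc (-b) ((neg_mem_TF hB).2 hb)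
    rw [pairZ_neg_left] at n2 ⊢
    have hcs := hB.cs b u
    rw [hun, hbn] at hcs
    norm_num at hcs
    have l1 : -7 ≤ pairZ B b u := by nlinarith
    have l2 : pairZ B b u ≤ 7 := by nlinarith
    have n7 : pairZ B b u ≠ 7 := fun e => by
      refine hB.2.2.2.2 (u - (2 : ℤ) • b) ?_
      rw [hB.norm_sub]; simp only [pairZ_smul_left, pairZ_smul_right, hB.comm u b, e, hbn, hun]; norm_num
    have n7' : pairZ B b u ≠ -7 := fun e => by
      refine hB.2.2.2.2 (u + (2 : ℤ) • b) ?_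
      rw [hB.norm_add]; simp only [pairZ_smul_left, pairZ_smul_right, hB.comm u b, e, hbn, hun]; norm_num
    generalize pairZ B b u = n at *
    interval_cases n <;> simp_all
  have hs := Finset.sum_congr rfl hp
  simp only [Finset.sum_add_distrib, Finset.sum_sub_distrib, ← Finset.mul_sum, h1, h2, h3, h4, h5] at hs
  have c1 : ∑ b ∈ TF B 2, (if pairZ B b u = 6 then (1 : ℤ) else 0) ≤ 1 := by
    rw [← Finset.sum_filter, Finset.sum_const, nsmul_one]; exact_mod_cast T7_six hB hu
  have c2 : ∑ b ∈ TF B 2, (if pairZ B (-b) u = 6 then (1 : ℤ) else 0) ≤ 1 := by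
    have : ∑ b ∈ TF B 2, (if pairZ B (-b) u = 6 then (1 : ℤ) else 0) = ∑ b ∈ TF B 2, (if pairZ B b u = 6 then (1 : ℤ) else 0) :=
      Finset.sum_nbij' (fun b => -b) (fun b => -b) (fun b hb => (neg_mem_TF hB).2 hb) (fun b hb => (neg_mem_TF hB).2 hb)
        (fun b _ => neg_neg b) (fun b _ => neg_neg b) (fun b _ => rfl)
    rw [this]; exact c1
  norm_num at hs
  lia

lemma T7_exists (hB : IsLeech B) {u : LV} (hu : u ∈ TF B 7) :
    ∃ a, IsFrame B a ∧ ∃ i j, i ≠ j ∧ pairZ B u (a i) ^ 2 = 81 ∧ pairZ B u (a j) ^ 2 = 9 := by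
  obtain ⟨b, hb, h5⟩ := T7_five hB hu
  have hun := (mem_TF hB).1 hu
  have hbn := (mem_TF hB).1 hb
  have ha : u - b ∈ TF B 4 := by
    rw [mem_TF hB, hB.norm_sub, hB.comm u b, h5, hun, hbn]; norm_num
  obtain ⟨a, h, i, hi⟩ := exists_frame hB ha
  have hbi : pairZ B b (a i) = 1 := by rw [hi, pairZ_sub_right, h5, hbn]; norm_num
  have hui : pairZ B u (a i) = 9 := by rw [hi, pairZ_sub_right, hB.comm u b, h5, hun]; norm_num
  refine ⟨a, h, i, ?_⟩
  rcases h.classify hB hb with ⟨j, h9, -⟩ | ⟨p, q, h2⟩ | h3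
  · have hij : i ≠ j := by rintro rfl; rw [hbi] at h9; norm_num at h9
    refine ⟨j, hij, by rw [hui]; norm_num, ?_⟩
    have : u = a i + b := by rw [hi]; abel
    rw [this, pairZ_add_left, h.ip, if_neg hij, zero_add, h9]
  · have := h2 i
    rw [hbi] at this; split_ifs at this <;> norm_num at this
  · have := h3 i
    rw [hbi] at this; norm_num at this

lemma T7_const (S : Setup B O2 O5 Oa Ob Oc) {h : LV → ℂ} (hG : ∀ σ ∈ ConwayGroup B, ∀ x, h (σ.mulVec x) = h x)
    (h3 : ∀ x y, red 3 x = red 3 y → h x = h y) : ∃ C, ∀ x ∈ TF B 7, h x = C := by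
  classical
  have hB := S.hB
  let cnd : LV → LV → LV → Prop := fun x y u => (pairZ B u x ^ 2 = 81 ∧ pairZ B u y ^ 2 = 9) ∨ (pairZ B u x ^ 2 = 9 ∧ pairZ B u y ^ 2 = 81)
  have key : ∀ g : LV → ℂ, (∀ σ ∈ ConwayGroup B, ∀ x, g (σ.mulVec x) = g x) → ∃ C, ∀ a, IsFrame B a → ∀ i j, i ≠ j →
      ∑ u ∈ (TF B 7).filter (cnd (a i) (a j)), g u = C := by
    intro g hg
    refine lemmaP S (fun x y => ∑ u ∈ (TF B 7).filter (cnd x y), g u) (fun σ hσ x y => ?_) (fun x y => ?_) (fun x y => ?_)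
    · beta_reduce
      rw [Finset.sum_filter, Finset.sum_filter, ← cg_sum hB hσ 7]
      simp only [cnd, cg_pair hσ, hg σ hσ]
    · refine Finset.sum_congr (Finset.filter_congr fun u _ => ?_) fun _ _ => rfl
      simp only [cnd]; tauto
    · simp only [cnd, pairZ_neg_right, neg_sq]
  obtain ⟨C, hC⟩ := key h hG
  obtain ⟨D, hD⟩ := key (fun _ => 1) (fun _ _ _ => rfl)
  refine ⟨C / D, fun u hu => ?_⟩
  obtain ⟨a, ha, i, j, hij, hi, hj⟩ := T7_exists hB hu
  have hsame : ∀ u' ∈ TF B 7, pairZ B u' (a i) ^ 2 = 81 → pairZ B u' (a j) ^ 2 = 9 → h u' = h u := fun u' hu' hi' hj' => by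
    obtain ⟨σ, hσ, e⟩ := sign_change hB ha (u := u) (u' := u') (T7_shape hB ha hu hij hi hj).1 (fun k => by
      by_cases e1 : k = i
      · rw [e1, hi, hi']
      by_cases e2 : k = j
      · rw [e2, hj, hj']
      rw [(T7_shape hB ha hu hij hi hj).2 k e1 e2, (T7_shape hB ha hu' hij hi' hj').2 k e1 e2])
    rw [e, hG σ hσ]
  have h1 : ∑ u' ∈ (TF B 7).filter (cnd (a i) (a j)), h u' = h u * ∑ u' ∈ (TF B 7).filter (cnd (a i) (a j)), 1 := by
    rw [Finset.mul_sum]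
    refine Finset.sum_congr rfl fun u' hu' => ?_
    obtain ⟨hu', hc⟩ := Finset.mem_filter.1 hu'
    rw [mul_one]
    rcases hc with ⟨hi', hj'⟩ | ⟨hi', hj'⟩
    · exact hsame u' hu' hi' hj'
    · obtain ⟨u'', hu'', hr, q1, q2⟩ := T7_swap hB ha hu' hij.symm hj' hi'
      rw [h3 _ _ hr]; exact hsame u'' hu'' q1 q2
  have hD' := hD a ha i j hij
  rw [hC a ha i j hij, hD'] at h1
  have hD0 : D ≠ 0 := by
    rw [← hD', Finset.sum_const, nsmul_one, Nat.cast_ne_zero]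
    exact Finset.card_ne_zero.2 ⟨u, Finset.mem_filter.2 ⟨hu, Or.inl ⟨hi, hj⟩⟩⟩
  rw [h1]; field_simp
end trans

section weil
variable {B : MZ}

def FF (B : MZ) (c : V3 → ℂ) (γ : V3) : ℂ := (1 / 3 ^ 12) * ∑ x, c x * ch (b3 B x γ)

def PP (B : MZ) (x : V3) : ℂ := (1 + ch (b3 B x x - 1) + ch (2 * (b3 B x x - 1))) / 3

lemma PP_eq (x : V3) : PP B x = if b3 B x x = 1 then 1 else 0 := by
  rw [PP, ← ch_indicator]; simp only [sub_eq_zero]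

lemma e33 : (3 : ZMod 3) = 0 := by decide

lemma gauss_shift (hB : IsLeech B) (w : V3) : ∑ x, ch (b3 B x x + b3 B x w) = ch (-b3 B w w) * 3 ^ 12 ∧
    ∑ x, ch (2 * b3 B x x + b3 B x w) = ch (b3 B w w) * 3 ^ 12 := by
  constructor
  · rw [← gauss_sum hB (s := 1) (by decide), ← Equiv.sum_comp (Equiv.addRight ((2 : ZMod 3) • w)) (fun x => ch (1 * b3 B x x)), Finset.mul_sum]
    refine Finset.sum_congr rfl fun x _ => ?_
    rw [← AddChar.map_add_eq_mul]
    refine congrArg ch ?_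
    simp only [Equiv.coe_addRight, b3_add_left, b3_add_right, b3_smul_left, b3_smul_right, b3_comm hB w x]
    linear_combination (- b3 B x w - b3 B w w) * e33
  · rw [← gauss_sum hB (s := 2) (by decide), ← Equiv.sum_comp (Equiv.addRight w) (fun x => ch (2 * b3 B x x)), Finset.mul_sum]
    refine Finset.sum_congr rfl fun x _ => ?_
    rw [← AddChar.map_add_eq_mul]
    refine congrArg ch ?_
    simp only [Equiv.coe_addRight, b3_add_left, b3_add_right, b3_comm hB w x]
    linear_combination (- b3 B x w - b3 B w w) * e33

lemma kern (hB : IsLeech B) (w : V3) : ∑ x, PP B x * ch (b3 B x w) =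
    (if w = 0 then 3 ^ 23 else 0) + 3 ^ 11 * (ch (-1 - b3 B w w) + ch (1 + b3 B w w)) := by
  have e : ∀ x, PP B x * ch (b3 B x w) = (ch (b3 B w x) + ch (-1) * ch (b3 B x x + b3 B x w) + ch 1 * ch (2 * b3 B x x + b3 B x w)) / 3 := fun x => by
    have e1 : ch (b3 B x x - 1) * ch (b3 B x w) = ch (-1) * ch (b3 B x x + b3 B x w) := by
      rw [← AddChar.map_add_eq_mul, ← AddChar.map_add_eq_mul]; exact congrArg ch (by ring)
    have e2 : ch (2 * (b3 B x x - 1)) * ch (b3 B x w) = ch 1 * ch (2 * b3 B x x + b3 B x w) := by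
      rw [← AddChar.map_add_eq_mul, ← AddChar.map_add_eq_mul]; exact congrArg ch (by linear_combination (-1) * e33)
    rw [PP, ← e1, ← e2, b3_comm hB w x]; ring
  simp only [e]
  rw [← Finset.sum_div, Finset.sum_add_distrib, Finset.sum_add_distrib, ← Finset.mul_sum, ← Finset.mul_sum, ch_orth hB, (gauss_shift hB w).1,
    (gauss_shift hB w).2, sub_eq_add_neg, AddChar.map_add_eq_mul, AddChar.map_add_eq_mul]
  split_ifs <;> ring

lemma FF_main (hB : IsLeech B) (m : V3 → ℂ) (hev : ∀ x, m (-x) = m x) (hsup : ∀ x, m x ≠ 0 → b3 B x x = 1) (δ : V3) :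
    FF B (fun x => PP B x * (m x + 3 * FF B m x)) δ = PP B δ * (m δ + 3 * FF B m δ) := by
  have hFe : ∑ x, m x * ch (- b3 B x δ) = ∑ x, m x * ch (b3 B x δ) := by
    rw [← Equiv.sum_comp (Equiv.neg V3)]
    refine Finset.sum_congr rfl fun x _ => ?_
    rw [Equiv.neg_apply, hev, b3_neg_left, neg_neg]
  have hPm : ∀ x, PP B x * m x = m x := fun x => by
    by_cases h : m x = 0
    · rw [h, mul_zero]
    · rw [PP_eq, if_pos (hsup x h), one_mul]
  have h1 : ∑ x, (PP B x * FF B m x) * ch (b3 B x δ) = (1 / 3 ^ 12) * ∑ γ, m γ * ∑ x, PP B x * ch (b3 B x (γ + δ)) := by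
    simp only [FF, Finset.mul_sum, Finset.sum_mul]
    rw [Finset.sum_comm]
    refine Finset.sum_congr rfl fun γ _ => Finset.sum_congr rfl fun x _ => ?_
    rw [b3_add_right, AddChar.map_add_eq_mul, b3_comm hB γ x]; ring
  have h2 : ∑ γ, m γ * ∑ x, PP B x * ch (b3 B x (γ + δ)) = 3 ^ 23 * m δ + 3 ^ 11 * ((ch (b3 B δ δ - 1) + ch (2 * (b3 B δ δ - 1))) * ∑ x, m x * ch (b3 B x δ)) := by
    have e : ∀ γ, m γ * ∑ x, PP B x * ch (b3 B x (γ + δ)) = (if γ = -δ then 3 ^ 23 * m γ else 0) + 3 ^ 11 * (ch (2 * (b3 B δ δ - 1)) * (m γ * ch (b3 B γ δ))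
        + ch (b3 B δ δ - 1) * (m γ * ch (-b3 B γ δ))) := fun γ => by
      rw [kern hB]
      by_cases h : m γ = 0
      · rw [h]; simp
      have hq := hsup γ h
      have q : b3 B (γ + δ) (γ + δ) = 1 + 2 * b3 B γ δ + b3 B δ δ := by
        simp only [b3_add_left, b3_add_right, b3_comm hB δ γ, hq]; ring
      have e1 : ch (2 * (b3 B δ δ - 1)) * (m γ * ch (b3 B γ δ)) = m γ * ch (-1 - b3 B (γ + δ) (γ + δ)) := by
        rw [mul_left_comm, ← AddChar.map_add_eq_mul, q]; exact congrArg (fun t => m γ * ch t) (by linear_combination (b3 B γ δ + b3 B δ δ) * e33)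
      have e2 : ch (b3 B δ δ - 1) * (m γ * ch (-b3 B γ δ)) = m γ * ch (1 + b3 B (γ + δ) (γ + δ)) := by
        rw [mul_left_comm, ← AddChar.map_add_eq_mul, q]; exact congrArg (fun t => m γ * ch t) (by linear_combination (-b3 B γ δ - 1) * e33)
      rw [e1, e2]
      simp only [add_eq_zero_iff_eq_neg]
      split_ifs <;> ring
    simp only [e]
    rw [Finset.sum_add_distrib, Finset.sum_ite_eq', if_pos (Finset.mem_univ _), hev, ← Finset.mul_sum, Finset.sum_add_distrib, ← Finset.mul_sum,
      ← Finset.mul_sum, hFe]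
    ring
  have h3 : ∑ x, (PP B x * (m x + 3 * FF B m x)) * ch (b3 B x δ) = ∑ x, m x * ch (b3 B x δ) + 3 * ∑ x, (PP B x * FF B m x) * ch (b3 B x δ) := by
    rw [Finset.mul_sum, ← Finset.sum_add_distrib]
    refine Finset.sum_congr rfl fun x _ => ?_
    rw [mul_add, hPm]; ring
  have h4 : PP B δ * (m δ + 3 * FF B m δ) = m δ + 3 * (PP B δ * FF B m δ) := by rw [mul_add, hPm]; ring
  rw [h4]
  conv_lhs => rw [FF]
  rw [h3, h1, h2, PP, FF]
  ring

def mm (B : MZ) (x : V3) : ℂ := ∑ v ∈ TF B 2, if red 3 v = x then 1 else 0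

def hh (B : MZ) (x : V3) : ℂ := PP B x * (mm B x + 3 * FF B (mm B) x)

lemma T2_neg_sum (hB : IsLeech B) (f : LV → ℂ) : ∑ v ∈ TF B 2, f (-v) = ∑ v ∈ TF B 2, f v :=
  Finset.sum_nbij' (fun b => -b) (fun b => -b) (fun b hb => (neg_mem_TF hB).2 hb) (fun b hb => (neg_mem_TF hB).2 hb)
        (fun b _ => neg_neg b) (fun b _ => neg_neg b) (fun b _ => rfl)

lemma hh_FF (hB : IsLeech B) (x : V3) : FF B (hh B) x = hh B x := by
  refine FF_main hB (mm B) (fun x => ?_) (fun x hx => ?_) x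
  · rw [mm, mm, ← T2_neg_sum hB]
    simp only [red_neg, neg_inj]
  · obtain ⟨v, hv, h⟩ := Finset.exists_ne_zero_of_sum_ne_zero hx
    have : red 3 v = x := by by_contra hc; rw [if_neg hc] at h; exact h rfl
    rw [← this, red_val hB hv]; rfl

lemma FF_mm (x : V3) : FF B (mm B) x = (1 / 3 ^ 12) * ∑ v ∈ TF B 2, ch (b3 B (red 3 v) x) := by
  rw [FF]; congr 1
  simp only [mm, Finset.sum_mul]
  rw [Finset.sum_comm]
  refine Finset.sum_congr rfl fun v _ => ?_
  simp

lemma hh_cg (hB : IsLeech B) (σ : MZ) (hσ : σ ∈ ConwayGroup B) (x : LV) : hh B (red 3 (σ.mulVec x)) = hh B (red 3 x) := by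
  have hr : ∀ v, red 3 (σ.mulVec v) = red 3 (σ.mulVec x) ↔ red 3 v = red 3 x := fun v => by
    refine ⟨fun e => ?_, cg_red⟩
    have := cg_red (σ := σ⁻¹) e
    rwa [(cg_inv hB hσ).2.1, (cg_inv hB hσ).2.1] at this
  rw [hh, hh, FF_mm, FF_mm, mm, mm, ← cg_sum hB hσ 2, ← cg_sum hB hσ 2 (fun v => ch (b3 B (red 3 v) _)), PP_eq, PP_eq]
  simp only [hr, b3_red, cg_pair hσ]

lemma hh_supp (x : LV) (h : hh B (red 3 x) ≠ 0) : b3 B (red 3 x) (red 3 x) = 1 := by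
  by_contra hc
  rw [hh, PP_eq, if_neg hc, zero_mul] at h; exact h rfl

lemma hh_T2 (hB : IsLeech B) {u : LV} (hu : u ∈ TF B 2) : hh B (red 3 u) ≠ 0 := by
  classical
  have hP : b3 B (red 3 u) (red 3 u) = 1 := by rw [red_val hB hu]; rfl
  rw [hh, PP_eq, if_pos hP, one_mul, FF_mm]
  obtain ⟨k, hk⟩ : ∃ k : ℕ, mm B (red 3 u) = k + 1 := by
    refine ⟨((TF B 2).filter (fun v => red 3 v = red 3 u)).card - 1, ?_⟩
    rw [mm, ← Finset.sum_filter, Finset.sum_const, nsmul_one]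
    have : 0 < ((TF B 2).filter (fun v => red 3 v = red 3 u)).card := Finset.card_pos.2 ⟨u, Finset.mem_filter.2 ⟨hu, rfl⟩⟩
    rw [← Nat.cast_add_one]; congr 1; lia
  obtain ⟨n, hn⟩ : ∃ n : ℕ, 2 * ∑ v ∈ TF B 2, ch (b3 B (red 3 v) (red 3 u)) = 3 * n - 196560 := by
    refine ⟨((TF B 2).filter (fun v => b3 B (red 3 v) (red 3 u) = 0)).card, ?_⟩
    rw [two_mul]
    nth_rw 1 [← T2_neg_sum hB]
    rw [← Finset.sum_add_distrib]
    have : ∀ v ∈ TF B 2, ch (b3 B (red 3 (-v)) (red 3 u)) + ch (b3 B (red 3 v) (red 3 u)) = 3 * (if b3 B (red 3 v) (red 3 u) = 0 then 1 else 0) - 1 := by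
      intro v _
      rw [ch_indicator, red_neg, b3_neg_left, show -b3 B (red 3 v) (red 3 u) = 2 * b3 B (red 3 v) (red 3 u) by
          linear_combination (-b3 B (red 3 v) (red 3 u)) * e33]
      ring
    rw [Finset.sum_congr rfl this, Finset.sum_sub_distrib, ← Finset.mul_sum, ← Finset.sum_filter, Finset.sum_const, Finset.sum_const,
      (card_TF hB).1]
    simp
  intro h0
  have : ((354294 * (k + 1) + 3 * n : ℕ) : ℂ) = ((196560 : ℕ) : ℂ) := by
    push_cast
    rw [hk] at h0
    linear_combination 354294 * h0 - hn
  have := Nat.cast_injective this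
  lia
end weil

section phi
variable {B : MZ}

def PH (B : MZ) (c : V3 → ℂ) (τ : ℍ) (z : CV) : ℂ := ∑' v : LV, c (red 3 v) * thT B ((τ : ℂ) / 3) z v

lemma im3 (τ : ℍ) : 0 < ((τ : ℂ) / 3).im := by
  have := τ.im_pos
  rw [show (3 : ℂ) = ((3 : ℝ) : ℂ) by norm_num, Complex.div_ofReal_im]; simpa using this

lemma c_bd (c : V3 → ℂ) : ∃ M : ℝ, 0 ≤ M ∧ ∀ x, ‖c x‖ ≤ M :=
  ⟨∑ x, ‖c x‖, Finset.sum_nonneg fun _ _ => norm_nonneg _, fun x => Finset.single_le_sum (f := fun x => ‖c x‖) (fun _ _ => norm_nonneg _) (Finset.mem_univ x)⟩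

lemma summable_c (hB : IsLeech B) (c : V3 → ℂ) {τ : ℂ} (hτ : 0 < τ.im) (z : CV) : Summable fun v : LV => c (red 3 v) * thT B τ z v := by
  obtain ⟨M, -, hM⟩ := c_bd c
  refine Summable.of_norm_bounded ((summable_thT hB hτ z).norm.mul_left M) fun v => ?_
  rw [norm_mul]; exact mul_le_mul_of_nonneg_right (hM _) (norm_nonneg _)

lemma PH_hasSum (hB : IsLeech B) (c : V3 → ℂ) (τ : ℍ) (z : CV) : HasSum (fun v : LV => c (red 3 v) * thT B ((τ : ℂ) / 3) z v) (PH B c τ z) :=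
  (summable_c hB c (im3 τ) z).hasSum

lemma PH_hasQ (hB : IsLeech B) (c : V3 → ℂ) (z : CV) : HasQ 3 (fun τ => PH B c τ z)
    (PowerSeries.mk fun m => ∑ v ∈ TF B m, c (red 3 v) * eC (pairC B (liftC v) z)) :=
  hasQ_of_lv hB fun τ => (PH_hasSum hB c τ z).congr_fun fun v => by
    rw [thT_eq hB, qq, mul_assoc]; rfl

lemma PH_S (hB : IsLeech B) (c : V3 → ℂ) (τ : ℍ) (z : CV) : PH B (FF B c) (ModularGroup.S • τ) ((τ : ℂ)⁻¹ • z) =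
    (τ : ℂ) ^ 12 * cexp (3 * π * Complex.I * pairC B z z / τ) * PH B c τ z := by
  have hτ := τ.ne_zero
  choose r hr using red_surj (n := 3)
  have hS : 0 < (((ModularGroup.S • τ : ℍ) : ℂ) / 3).im := im3 _
  have h3τ : 0 < (3 * (τ : ℂ)).im := by have := τ.im_pos; simpa using this
  have hL : PH B (FF B c) (ModularGroup.S • τ) ((τ : ℂ)⁻¹ • z) =
      (1 / 3 ^ 12) * ∑ x, c x * ∑' v, thT B (-1 / (3 * τ)) ((3 * (τ : ℂ))⁻¹ • ((3 : ℂ) • z + (τ : ℂ) • liftC (r x))) v := by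
    simp only [← tsum_mul_left]
    rw [← Summable.tsum_finsetSum, ← tsum_mul_left]
    · refine tsum_congr fun v => ?_
      rw [FF, mul_assoc, Finset.sum_mul]
      congr 1
      refine Finset.sum_congr rfl fun x _ => ?_
      rw [mul_assoc]; congr 1
      conv_lhs => rw [← hr x]
      rw [b3_red, ch_int, coe_S, thT, thT, eC, ← Complex.exp_add, smul_add, smul_smul, smul_smul, pairC_add_right, pairC_smul_right,
        pairC_smul_right, pairC_smul_right, pairC_lift, hB.comm (r x) v]
      congr 1; field_simp; ring
    · intro x _
      refine (summable_thT hB ?_ _).mul_left _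
      rw [show (-1 : ℂ) / (3 * τ) = ((ModularGroup.S • τ : ℍ) : ℂ) / 3 by rw [coe_S]; field_simp]
      exact hS
  have hR : PH B c τ z = ∑ x, c x * ∑' v, thT B (τ / 3) z (r x + (3 : ℤ) • v) := by
    have e : ∀ x, ∑' v, thT B (τ / 3) z (r x + (3 : ℤ) • v) = ∑' v, (if red 3 v = x then 1 else 0) * thT B (τ / 3) z v := fun x => by
      have hi : Function.Injective fun v : LV => r x + (3 : ℤ) • v := fun v w h => by
        ext i; have := congrFun h i; simp at this; exact this
      rw [← hi.tsum_eq (f := fun v => (if red 3 v = x then 1 else 0) * thT B (τ / 3) z v)]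
      · refine tsum_congr fun v => ?_
        have : red 3 (r x + (3 : ℤ) • v) = x := by
          rw [← hr x, red_eq_iff]
          refine ⟨v, ?_⟩
          rw [hr x]; push_cast; abel
        rw [if_pos this, one_mul]
      · intro v hv
        have : red 3 v = x := by by_contra h; simp [h] at hv
        rw [← hr x, red_eq_iff] at this
        obtain ⟨u, hu⟩ := this
        exact ⟨u, by show r x + (3 : ℤ) • u = v; push_cast at hu; rw [← hu]; abel⟩
    simp only [e, ← tsum_mul_left]
    rw [← Summable.tsum_finsetSum]
    · refine tsum_congr fun v => ?_
      simp
    · intro x _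
      exact (summable_c hB (fun y => if y = x then 1 else 0) (im3 τ) z).mul_left _
  rw [hL, hR, Finset.mul_sum, Finset.mul_sum]
  refine Finset.sum_congr rfl fun x _ => ?_
  rw [theta_inversion hB h3τ, mul_pow]
  have e2 : cexp (π * Complex.I * pairC B ((3 : ℂ) • z + (τ : ℂ) • liftC (r x)) ((3 : ℂ) • z + (τ : ℂ) • liftC (r x)) / (3 * τ)) *
      ∑' v, thT B (3 * τ) ((3 : ℂ) • z + (τ : ℂ) • liftC (r x)) v =
      cexp (3 * π * Complex.I * pairC B z z / τ) * ∑' v, thT B (τ / 3) z (r x + (3 : ℤ) • v) := by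
    rw [← tsum_mul_left, ← tsum_mul_left]
    refine tsum_congr fun v => ?_
    rw [thT, thT, ← Complex.exp_add, ← Complex.exp_add]
    congr 1
    simp only [pairC_add_right, pairC_add_left, pairC_smul_right, pairC_smul_left, pairC_lift, liftC_add, liftC_smul, pairZ_add_left,
      pairZ_add_right, pairZ_smul_left, pairZ_smul_right, hB.comm v (r x), hB.commC z (liftC (r x))]
    push_cast
    field_simp
    ring
  rw [mul_assoc _ (cexp _), e2]
  ring

lemma PH_T (hB : IsLeech B) (c : V3 → ℂ) (hc : ∀ x : LV, c (red 3 x) ≠ 0 → b3 B (red 3 x) (red 3 x) = 1) (τ : ℍ) (z : CV) :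
    PH B c ((1 : ℝ) +ᵥ τ) z = eC (2 / 3) * PH B c τ z := by
  rw [PH, PH, ← tsum_mul_left]
  refine tsum_congr fun v => ?_
  by_cases h : c (red 3 v) = 0
  · rw [h]; ring
  have h1 := hc v h
  rw [b3_red, show (1 : ZMod 3) = ((1 : ℤ) : ZMod 3) by simp, ZMod.intCast_eq_intCast_iff_dvd_sub] at h1
  obtain ⟨k, hk⟩ := h1
  obtain ⟨n, hn⟩ := hB.even v
  have : ∃ j : ℤ, pairZ B v v = 4 + 6 * j := ⟨(n - 2) / 3, by push_cast at hk; omega⟩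
  obtain ⟨j, hj⟩ := this
  rw [mul_left_comm, thT, thT, eC, ← Complex.exp_add, hj]
  congr 1
  rw [Complex.exp_eq_exp_iff_exists_int]
  refine ⟨j, ?_⟩
  have : (((1 : ℝ) +ᵥ τ : ℍ) : ℂ) = 1 + τ := by simp
  rw [this]; push_cast; ring

lemma PH_quasi (hB : IsLeech B) (c : V3 → ℂ) (x y : LV) (τ : ℍ) (z : CV) : PH B c τ (z + (τ : ℂ) • liftC x + liftC y) =
    cexp (-((3 : ℕ) : ℂ) * π * Complex.I * (pairZ B x x : ℂ) * τ - 2 * ((3 : ℕ) : ℂ) * π * Complex.I * pairC B (liftC x) z) * PH B c τ z := by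
  rw [PH, PH, ← (Equiv.addRight ((3 : ℤ) • x)).tsum_eq (fun v : LV => c (red 3 v) * thT B ((τ : ℂ) / 3) z v), ← tsum_mul_left]
  refine tsum_congr fun v => ?_
  have hr : red 3 (v + (3 : ℤ) • x) = red 3 v := red_eq_iff.2 ⟨x, by push_cast; abel⟩
  rw [Equiv.coe_addRight, hr, mul_left_comm, thT, thT, ← Complex.exp_add]
  congr 1
  rw [Complex.exp_eq_exp_iff_exists_int]
  refine ⟨pairZ B v y, ?_⟩
  simp only [pairC_add_right, pairC_add_left, pairC_smul_right, pairC_smul_left, pairC_lift, liftC_add, liftC_smul, pairZ_add_left,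
      pairZ_add_right, pairZ_smul_left, pairZ_smul_right, hB.comm x v]
  push_cast
  ring

def cgE (hB : IsLeech B) {σ : MZ} (hσ : σ ∈ ConwayGroup B) : LV ≃ LV :=
  ⟨fun v => σ.mulVec v, fun v => σ⁻¹.mulVec v, (cg_inv hB hσ).2.1, (cg_inv hB hσ).2.2⟩

lemma cg_pairC {σ : MZ} (hσ : σ ∈ ConwayGroup B) (v : LV) (z : CV) :
    pairC B (liftC (σ.mulVec v)) (actC σ z) = pairC B (liftC v) z := by
  have e1 : liftC (σ.mulVec v) = (σ.map (Int.cast : ℤ → ℂ)).mulVec (liftC v) := by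
    ext i; simp [liftC, mulVec, dotProduct]
  have e2 : (σ.map (Int.cast : ℤ → ℂ))ᵀ * B.map (Int.cast : ℤ → ℂ) * σ.map (Int.cast : ℤ → ℂ) = B.map (Int.cast : ℤ → ℂ) := by
    have := congrArg (fun M => M.map (Int.castRingHom ℂ)) hσ.2
    simp only [Matrix.map_mul] at this
    exact this
  rw [e1, pairC, actC, pairC]
  conv_rhs => rw [← e2]
  rw [← Matrix.mulVec_mulVec, ← Matrix.mulVec_mulVec, ← Matrix.vecMul_transpose, ← Matrix.dotProduct_mulVec]

lemma PH_cg (hB : IsLeech B) (c : V3 → ℂ) {σ : MZ} (hσ : σ ∈ ConwayGroup B)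
    (hc : ∀ x, c (red 3 (σ.mulVec x)) = c (red 3 x)) (τ : ℍ) (z : CV) : PH B c τ (actC σ z) = PH B c τ z := by
  rw [PH, PH, ← (cgE hB hσ).tsum_eq]
  refine tsum_congr fun v => ?_
  show c (red 3 (σ.mulVec v)) * thT B _ _ (σ.mulVec v) = _
  rw [hc, thT, thT, cg_pair hσ, cg_pairC hσ]

lemma PH_holo (hB : IsLeech B) (c : V3 → ℂ) (τ : ℍ) : Differentiable ℂ (PH B c τ) := by
  intro z
  obtain ⟨M, hM0, hM⟩ := c_bd c
  let L : LV → CV →L[ℂ] ℂ := fun v => LinearMap.toContinuousLinearMap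
    { toFun := fun z => pairC B (liftC v) z, map_add' := fun a b => pairC_add_right _ _ _, map_smul' := fun a b => pairC_smul_right _ _ _ }
  have hL : ∀ v, ‖L v‖ ≤ KB B * l1 v := fun v => by
    refine ContinuousLinearMap.opNorm_le_bound _ (mul_nonneg KB_nonneg (l1_nonneg v)) fun y => ?_
    refine (norm_pairC_lift_le (B := B) v y).trans (le_of_eq (by ring))
  set R := ‖z‖ + 1
  have hR : 0 < R := by positivity
  have hz : z ∈ Metric.ball (0 : CV) R := by simp [R]
  have hd : ∀ v, ∀ y ∈ Metric.ball (0 : CV) R, HasFDerivAt (fun y => c (red 3 v) * thT B ((τ : ℂ) / 3) y v)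
      ((c (red 3 v) * thT B ((τ : ℂ) / 3) y v * (2 * π * Complex.I)) • L v) y := fun v y _ => by
    have h1 : HasFDerivAt (fun y => pairC B (liftC v) y) (L v) y := (L v).hasFDerivAt
    have h2 := (((h1.const_mul (2 * π * Complex.I)).const_add (π * Complex.I * (pairZ B v v : ℂ) * ((τ : ℂ) / 3))).cexp).const_mul (c (red 3 v))
    refine h2.congr_fderiv ?_
    rw [smul_smul, smul_smul]; rfl
  refine (hasFDerivAt_tsum_of_isPreconnected
    (u := fun v => M * (2 * π) * KB B * Real.exp (-(π * ((τ : ℂ) / 3).im) * (pairZ B v v : ℝ) + (2 * π * KB B * R + 1) * l1 v))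
    ((summable_gauss hB (mul_pos Real.pi_pos (im3 τ)) _).mul_left _) Metric.isOpen_ball (convex_ball _ _).isPreconnected hd ?_ hz
    (summable_c hB c (im3 τ) z) hz).differentiableAt
  intro v y hy
  rw [norm_smul, norm_mul, norm_mul]
  have h1 := norm_thT_le (B := B) ((τ : ℂ) / 3) y v
  have h2 : ‖(2 * π * Complex.I : ℂ)‖ = 2 * π := by simp [abs_of_pos Real.pi_pos]
  have hK := KB_nonneg (B := B)
  have h3 : ‖y‖ ≤ R := by simpa using (mem_ball_zero_iff.1 hy).le
  have h4 : ‖thT B ((τ : ℂ) / 3) y v‖ ≤ Real.exp (-(π * ((τ : ℂ) / 3).im) * (pairZ B v v : ℝ) + (2 * π * KB B * R) * l1 v) := by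
    refine h1.trans (Real.exp_le_exp.2 ?_)
    have := mul_le_mul_of_nonneg_right (mul_le_mul_of_nonneg_left h3 (by positivity : 0 ≤ 2 * π * KB B)) (l1_nonneg v)
    linarith
  have h5 : l1 v ≤ Real.exp (l1 v) := by linarith [Real.add_one_le_exp (l1 v)]
  have h6 := mul_le_mul_of_nonneg_left h5 hK
  rw [h2, show ∀ a b : ℝ, a + (2 * π * KB B * R + 1) * b = (a + (2 * π * KB B * R) * b) + b by intros; ring, Real.exp_add]
  calc _ ≤ M * Real.exp (-(π * ((τ : ℂ) / 3).im) * (pairZ B v v : ℝ) + (2 * π * KB B * R) * l1 v) * (2 * π) * (KB B * Real.exp (l1 v)) := by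
        gcongr
        · exact hM _
        · exact (hL v).trans h6
    _ = _ := by ring
end phi

section etasec
open ModularGroup

lemma etaF_eq (τ : ℍ) : etaF τ = ModularForm.eta τ := by
  rw [etaF, ModularForm.eta]
  congr 1
  · rw [eC, Function.Periodic.qParam]; congr 1; push_cast; ring
  · refine tprod_congr fun n => ?_
    rw [ModularForm.eta_q_eq_cexp, eC, mul_assoc (2 * (π : ℂ) * Complex.I)]

lemma etaF_ne (τ : ℍ) : etaF τ ≠ 0 := by
  rw [etaF_eq]; exact ModularForm.eta_ne_zero τ.2

lemma etaF_T (τ : ℍ) : etaF ((1 : ℝ) +ᵥ τ) = eC (1 / 24) * etaF τ := by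
  have h : (((1 : ℝ) +ᵥ τ : ℍ) : ℂ) = 1 + τ := by simp
  rw [etaF, etaF, h, ← mul_assoc, ← eC_add]
  congr 1
  · congr 1; ring
  · refine tprod_congr fun n => ?_
    rw [mul_add, eC_add, mul_one, show ((n : ℂ) + 1) = ((n + 1 : ℤ) : ℂ) by push_cast; rfl, eC_int, one_mul]

lemma etaF_S (τ : ℍ) : (etaF (S • τ) / etaF τ) ^ 16 = (τ : ℂ) ^ 8 := by
  have h := ModularForm.eta_comp_eq_csqrt_I_inv τ.2
  simp only [Function.comp, Pi.smul_apply, Pi.mul_apply, smul_eq_mul] at h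
  have h' : etaF (S • τ) = (sqrt Complex.I)⁻¹ * (sqrt τ * etaF τ) := by rw [etaF_eq, etaF_eq, _root_.coe_S, ← h]
  have hs : ∀ z : ℂ, z ≠ 0 → sqrt z ^ 16 = z ^ 8 := fun z hz => by
    have h2 : sqrt z ^ 2 = z := by
      rw [sqrt_eq_exp hz, ← exp_nat_mul]
      push_cast
      rw [mul_div_cancel₀ _ two_ne_zero, exp_log hz]
    calc sqrt z ^ 16 = (sqrt z ^ 2) ^ 8 := by ring
      _ = _ := by rw [h2]
  rw [h', div_pow, mul_pow, mul_pow, inv_pow, hs _ Complex.I_ne_zero, hs _ τ.ne_zero]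
  have : Complex.I ^ 8 = 1 := by rw [show 8 = 4 * 2 by norm_num, pow_mul, Complex.I_pow_four, one_pow]
  rw [this]
  have := etaF_ne τ
  field_simp

lemma etaF_S24 (τ : ℍ) : (etaF (S • τ) / etaF τ) ^ 24 = (τ : ℂ) ^ 12 := by
  have h := disc_S τ
  simp only [ModularForm.discriminant, ← etaF_eq] at h
  rw [div_pow, h, mul_div_assoc, div_self (pow_ne_zero _ (etaF_ne τ)), mul_one]; norm_cast

lemma jf_S (τ : ℍ) : jfactor S τ = τ ∧ slc S = 1 := by simp [jfactor, slc, sld, S]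
lemma jf_T (τ : ℍ) : jfactor T τ = 1 ∧ slc T = 0 := by simp [jfactor, slc, sld, T]
lemma jf_den (A : SL(2, ℤ)) (τ : ℍ) : jfactor A τ = denom A (τ : ℂ) := by
  rw [ModularGroup.denom_apply]; rfl
lemma jf_ne (A : SL(2, ℤ)) (τ : ℍ) : jfactor A τ ≠ 0 := by
  rw [jf_den]; exact denom_ne_zero _ _
lemma jf_mul (A C : SL(2, ℤ)) (τ : ℍ) : jfactor (A * C) τ = jfactor A (C • τ) * jfactor C τ := by
  have h := jf_ne C τ
  have e : jfactor C τ * ((C • τ : ℍ) : ℂ) = (C.1 0 0 : ℤ) * (τ : ℂ) + (C.1 0 1 : ℤ) := by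
    rw [UpperHalfPlane.coe_specialLinearGroup_apply]
    exact mul_div_cancel₀ _ h
  have e2 : jfactor A (C • τ) * jfactor C τ = slc A * (jfactor C τ * ((C • τ : ℍ) : ℂ)) + sld A * jfactor C τ := by
    rw [jfactor]; ring
  rw [e2, e]
  simp only [jfactor, slc, sld, Matrix.SpecialLinearGroup.coe_mul, Matrix.mul_apply, Fin.sum_univ_two]
  push_cast
  ring
lemma slc_mul (A C : SL(2, ℤ)) (τ : ℍ) : slc (A * C) / jfactor (A * C) τ = slc A / (jfactor A (C • τ) * jfactor C τ ^ 2) + slc C / jfactor C τ := by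
  have h1 := jf_ne C τ
  have h2 := jf_ne A (C • τ)
  have h0 := jf_ne (A * C) τ
  have e0 : slc A + slc C * jfactor (A * C) τ = slc (A * C) * jfactor C τ := by
    have hd : ((C.1 0 0 : ℤ) : ℂ) * (C.1 1 1 : ℤ) - (C.1 0 1 : ℤ) * (C.1 1 0 : ℤ) = 1 := by
      have := C.2; rw [Matrix.det_fin_two] at this; exact_mod_cast this
    simp only [jfactor, slc, sld, Matrix.SpecialLinearGroup.coe_mul, Matrix.mul_apply, Fin.sum_univ_two]
    push_cast
    linear_combination (-(A.1 1 0 : ℤ) : ℂ) * hd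
  have e1 := jf_mul A C τ
  rw [e1] at e0 h0 ⊢
  field_simp
  linear_combination -e0
end etasec

section modform
variable {B : MZ}
open ModularGroup

def XC (B : MZ) (A : SL(2, ℤ)) (τ : ℍ) (z : CV) : ℂ :=
  (etaF (A • τ) / etaF τ) ^ (16 : ℤ) * (jfactor A τ) ^ (12 - (16 : ℤ) / 2) * cexp (((3 : ℕ) : ℂ) * π * Complex.I * slc A * pairC B z z / jfactor A τ)

lemma XC_ne (A : SL(2, ℤ)) (τ : ℍ) (z : CV) : XC B A τ z ≠ 0 :=
  mul_ne_zero (mul_ne_zero (zpow_ne_zero _ (div_ne_zero (etaF_ne _) (etaF_ne _))) (zpow_ne_zero _ (jf_ne A τ))) (Complex.exp_ne_zero _)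

lemma XC_mul (A C : SL(2, ℤ)) (τ : ℍ) (z : CV) : XC B (A * C) τ z = XC B A (C • τ) ((jfactor C τ)⁻¹ • z) * XC B C τ z := by
  have e : cexp (((3 : ℕ) : ℂ) * π * Complex.I * slc (A * C) * pairC B z z / jfactor (A * C) τ) =
      cexp (((3 : ℕ) : ℂ) * π * Complex.I * slc A * pairC B ((jfactor C τ)⁻¹ • z) ((jfactor C τ)⁻¹ • z) / jfactor A (C • τ)) *
      cexp (((3 : ℕ) : ℂ) * π * Complex.I * slc C * pairC B z z / jfactor C τ) := by
    rw [← Complex.exp_add, pairC_smul_left, pairC_smul_right]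
    congr 1
    have := slc_mul A C τ
    calc _ = ((3 : ℕ) : ℂ) * π * Complex.I * pairC B z z * (slc (A * C) / jfactor (A * C) τ) := by ring
      _ = _ := by rw [this]; have := jf_ne C τ; have := jf_ne A (C • τ); field_simp
  rw [XC, XC, XC, e, jf_mul, mul_smul, mul_zpow]
  have : etaF (A • C • τ) / etaF τ = etaF (A • C • τ) / etaF (C • τ) * (etaF (C • τ) / etaF τ) := by
    have := etaF_ne (C • τ); field_simp
  rw [this, mul_zpow]
  ring

lemma XC_one (τ : ℍ) (z : CV) : XC B 1 τ z = 1 := by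
  have := etaF_ne τ
  simp [XC, jfactor, slc, sld, this]

lemma PH_modular (hB : IsLeech B) {c : V3 → ℂ} (hF : ∀ x, FF B c x = c x) (hc : ∀ x : LV, c (red 3 x) ≠ 0 → b3 B (red 3 x) (red 3 x) = 1)
    (A : SL(2, ℤ)) : ∀ (τ : ℍ) (z : CV), PH B c (A • τ) ((jfactor A τ)⁻¹ • z) = XC B A τ z * PH B c τ z := by
  have hA : A ∈ Subgroup.closure {S, T} := by simp [SpecialLinearGroup.SL2Z_generators]
  induction hA using Subgroup.closure_induction with
  | mem x hx =>
    intro τ z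
    rcases hx with rfl | rfl
    · have h := PH_S hB c τ z
      rw [show FF B c = c from funext hF] at h
      rw [(jf_S τ).1, h, XC, (jf_S τ).1, (jf_S τ).2]
      have h16 : (etaF (S • τ) / etaF τ) ^ (16 : ℤ) = (τ : ℂ) ^ 8 := by rw [← etaF_S]; norm_cast
      rw [h16, show (12 - (16 : ℤ) / 2) = ((4 : ℕ) : ℤ) by norm_num, zpow_natCast, ← pow_add]
      push_cast
      rw [mul_one]
    · rw [(jf_T τ).1, XC, (jf_T τ).1, (jf_T τ).2, UpperHalfPlane.modular_T_smul, PH_T hB c (by simpa using hc), etaF_T, mul_div_assoc, div_self (etaF_ne τ), mul_one,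
        ← eC_int_mul]
      simp
      left; congr 1; norm_num
  | one => intro τ z; rw [XC_one, one_smul, jfactor]; simp [slc, sld]
  | mul A C _ _ hA hC =>
    intro τ z
    rw [XC_mul, jf_mul, mul_inv, ← smul_smul, mul_smul, hA, hC, mul_assoc]
  | inv A _ hA =>
    intro τ z
    have h1 := hA (A⁻¹ • τ) ((jfactor A⁻¹ τ)⁻¹ • z)
    have h2 := XC_mul (B := B) A A⁻¹ τ z
    have h3 := jf_mul A A⁻¹ τ
    rw [mul_inv_cancel] at h2 h3
    rw [smul_inv_smul, smul_smul, ← mul_inv, ← h3] at h1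
    rw [XC_one] at h2
    have e1 : jfactor 1 τ = 1 := by simp [jfactor, slc, sld]
    rw [e1, inv_one, one_smul] at h1
    have h4 := XC_ne (B := B) A (A⁻¹ • τ) ((jfactor A⁻¹ τ)⁻¹ • z)
    apply mul_left_cancel₀ h4
    rw [← h1, ← mul_assoc, ← h2, one_mul]

lemma nQ_mod (hB : IsLeech B) {x : LV} (h : b3 B (red 3 x) (red 3 x) = 1) : nQ B x % 3 = 2 := by
  rw [b3_red, show (1 : ZMod 3) = ((1 : ℤ) : ZMod 3) by simp, ZMod.intCast_eq_intCast_iff_dvd_sub] at h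
  have := hB.two_nQ x
  push_cast at h; omega

def fco (B : MZ) (c : V3 → ℂ) (j : ℤ) (ℓ : LV) : ℂ := if (nQ B ℓ : ℤ) = 2 + 3 * j then c (red 3 ℓ) else 0

theorem PH_form (hB : IsLeech B) {c : V3 → ℂ} (hF : ∀ x, FF B c x = c x) (hc : ∀ x : LV, c (red 3 x) ≠ 0 → b3 B (red 3 x) (red 3 x) = 1)
    (hG : ∀ σ ∈ ConwayGroup B, ∀ x, c (red 3 (σ.mulVec x)) = c (red 3 x)) : IsSingularJacobiCharWith B 3 16 (PH B c) (fco B c) where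
  holo_tau z := (PH_hasQ hB c z).mdiff (by norm_num)
  holo_z τ := PH_holo hB c τ
  conway_invar σ hσ τ z := PH_cg hB c hσ (hG σ hσ) τ z
  quasi_periodic x y τ z := PH_quasi hB c x y τ z
  modular A τ z := PH_modular hB hF hc A τ z
  support j ℓ h := by
    rw [fco] at h
    have e : (nQ B ℓ : ℤ) = 2 + 3 * j := by by_contra hh; exact h (if_neg hh)
    have := hB.two_nQ ℓ
    push_cast
    constructor <;> omega
  expansion τ z := by
    have hi : Function.Injective fun ℓ : LV => ((((nQ B ℓ : ℤ) - 2) / 3, ℓ) : ℤ × LV) := fun a b h => (Prod.mk.inj h).2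
    rw [← hi.hasSum_iff]
    · refine (PH_hasSum hB c τ z).congr_fun fun ℓ => ?_
      simp only [Function.comp]
      by_cases h : c (red 3 ℓ) = 0
      · rw [h, fco]; simp [h]
      have hm := nQ_mod hB (hc ℓ h)
      have e : (nQ B ℓ : ℤ) = 2 + 3 * (((nQ B ℓ : ℤ) - 2) / 3) := by omega
      rw [fco, if_pos e, ftermQ, thT_eq hB, mul_comm (eC (pairC B _ _)), ← eC_nat_mul]
      congr 3
      generalize ((nQ B ℓ : ℤ) - 2) / 3 = k at e
      have e' : (nQ B ℓ : ℂ) = 2 + 3 * k := by exact_mod_cast e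
      rw [e']; push_cast; ring
    · rintro ⟨j, ℓ⟩ h
      rw [fco, if_neg, zero_mul]
      intro e
      simp only at e
      exact h ⟨ℓ, Prod.ext (by simp only; omega) rfl⟩
end modform

section coefs
variable {B : MZ} {O2 O5 Oa Ob Oc : Set LV}
open ModularForm ModularGroup

lemma orb_const (hB : IsLeech B) {O : Set LV} {m c : ℕ} (h : OrbitData B O m c) {g : LV → ℂ}
    (hG : ∀ σ ∈ ConwayGroup B, ∀ x, g (σ.mulVec x) = g x) : ∃ C, ∀ x ∈ O, g x = C := by
  obtain ⟨x, hx⟩ := h.1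
  refine ⟨g x, fun y hy => ?_⟩
  rw [hx] at hy
  obtain ⟨σ, hσ, rfl⟩ := hy
  exact hG σ hσ x

lemma Setup.struct (H : Setup B O2 O5 Oa Ob Oc) {g : LV → ℂ} (hG : ∀ σ ∈ ConwayGroup B, ∀ x, g (σ.mulVec x) = g x)
    (h3 : ∀ x y, red 3 x = red 3 y → g x = g y) : ∃ A C D, (∀ x ∈ TF B 2, g x = A) ∧ (∀ x ∈ TF B 5, g x = C) ∧ (∀ x ∈ Oa, g x = A) ∧
    (∀ x ∈ Ob, g x = D) ∧ (∀ x ∈ Oc, g x = C) := by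
  obtain ⟨A, hA⟩ := orb_const H.hB H.h2 hG
  obtain ⟨C, hC⟩ := orb_const H.hB H.h5 hG
  obtain ⟨D, hD⟩ := orb_const H.hB H.hb hG
  rw [H.e2] at hA
  rw [H.e5] at hC
  refine ⟨A, C, D, hA, hC, fun x hx => ?_, hD, fun x hx => ?_⟩
  · rw [H.ea] at hx
    obtain ⟨v, hv, rfl⟩ := hx
    rw [← hA v hv, ← inv_neg' H.hB hG v]
    refine h3 _ _ (red_eq_iff.2 ⟨v, ?_⟩)
    ext i; simp; ring
  · obtain ⟨-, -, y, hy, -, h⟩ := H.c_red hx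
    rw [h3 _ _ h]; exact hC y hy

lemma Setup.sum8 (H : Setup B O2 O5 Oa Ob Oc) {g : LV → ℂ} {A D C : ℂ} (ha : ∀ x ∈ Oa, g x = A) (hb : ∀ x ∈ Ob, g x = D) (hc : ∀ x ∈ Oc, g x = C) :
    ∑ x ∈ TF B 8, g x = 196560 * A + 805620816000 * D + 9258762240 * C := by
  classical
  have key : ∀ (O : Set LV) (n : ℕ), OrbitData B O 8 n → ((n : ℕ) : ℂ) = ∑ x ∈ TF B 8, if x ∈ O then 1 else 0 := fun O n h => by
    rw [← Finset.sum_filter, Finset.sum_const, nsmul_one, ← h.2.2, Nat.card_coe_set_eq, ← Set.ncard_coe_finset]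
    congr 2
    ext x; simp only [Finset.coe_filter, Set.mem_ofPred_eq]
    exact ⟨fun h' => ⟨orb_sub H.hB h h', h'⟩, fun h' => h'.2⟩
  have e : ∀ x ∈ TF B 8, g x = (if x ∈ Oa then 1 else 0) * A + (if x ∈ Ob then 1 else 0) * D + (if x ∈ Oc then 1 else 0) * C := fun x hx => by
    have h8 : x ∈ Oa ∪ Ob ∪ Oc := by rw [H.e8]; exact hx
    rcases h8 with (h | h) | h
    · rw [if_pos h, if_neg (Set.disjoint_left.1 H.dab h), if_neg (Set.disjoint_left.1 H.dac h), ha x h]; ring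
    · rw [if_pos h, if_neg (Set.disjoint_right.1 H.dab h), if_neg (Set.disjoint_left.1 H.dbc h), hb x h]; ring
    · rw [if_pos h, if_neg (Set.disjoint_right.1 H.dac h), if_neg (Set.disjoint_right.1 H.dbc h), hc x h]; ring
  rw [Finset.sum_congr rfl e, Finset.sum_add_distrib, Finset.sum_add_distrib, ← Finset.sum_mul, ← Finset.sum_mul, ← Finset.sum_mul,
    ← key _ _ H.ha, ← key _ _ H.hb, ← key _ _ H.hc]
  push_cast; ring

def dd : PowerSeries ℂ := PowerSeries.C (1 / 1728) * (e4 * e4 * e4 - e6 * e6)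

lemma disc_hasQ : HasQ 1 discriminant dd := by
  have h4 : HasQ 1 (fun τ => E₄ τ) e4 := mf_hasQ E₄
  have h6 : HasQ 1 (fun τ => E₆ τ) e6 := mf_hasQ E₆
  have := (((h4.mul h4).mul h4).sub (h6.mul h6)).const_mul (1 / 1728)
  intro τ
  rw [discriminant_eq_E₄_cube_sub_E₆_sq, show (E₄ τ ^ 3 - E₆ τ ^ 2) / 1728 = 1 / 1728 * (E₄ τ * E₄ τ * E₄ τ - E₆ τ * E₆ τ) by ring]
  exact this τ

lemma dd_vals : dd.coeff 0 = 0 ∧ dd.coeff 1 = 1 ∧ dd.coeff 2 = -24 ∧ dd.coeff 3 = 252 := by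
  obtain ⟨a0, a1, a2, a3, -⟩ := e4_vals
  obtain ⟨b0, b1, b2, b3, -⟩ := e6_vals
  refine ⟨?_, ?_, ?_, ?_⟩ <;>
  · rw [dd, PowerSeries.coeff_C_mul, map_sub]
    simp only [ps_mul_coeff, Finset.sum_range_succ, Finset.sum_range_zero, Nat.reduceAdd, Nat.reduceSub, Nat.sub_zero, Nat.sub_self, a0, a1, a2, a3, b0, b1, b2, b3]
    norm_num

lemma exists_rho : ∃ ρ : ℍ, S • ρ = (1 : ℝ) +ᵥ ρ ∧ (ρ : ℂ) ^ 3 = 1 ∧ (ρ : ℂ) ≠ 1 := by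
  have hs : (Real.sqrt 3 : ℂ) ^ 2 = 3 := by rw [← Complex.ofReal_pow, Real.sq_sqrt (by norm_num)]; norm_num
  have hI : Complex.I ^ 2 = -1 := Complex.I_sq
  have him : 0 < (-1 / 2 + (Real.sqrt 3 : ℂ) / 2 * Complex.I : ℂ).im := by
    rw [show (-1 / 2 + (Real.sqrt 3 : ℂ) / 2 * Complex.I : ℂ) = ((-1 / 2 : ℝ) : ℂ) + ((Real.sqrt 3 / 2 : ℝ) : ℂ) * Complex.I by push_cast; ring,
      Complex.add_im, Complex.ofReal_im, Complex.im_ofReal_mul]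
    simp
  let ρ : ℍ := ⟨_, him⟩
  have e : (ρ : ℂ) = -1 / 2 + (Real.sqrt 3 : ℂ) / 2 * Complex.I := rfl
  have q : (ρ : ℂ) ^ 2 + ρ + 1 = 0 := by rw [e]; linear_combination (1 / 4) * (Real.sqrt 3 : ℂ) ^ 2 * hI - 1 / 4 * hs
  refine ⟨ρ, ?_, ?_, fun h => ?_⟩
  · ext1
    rw [_root_.coe_S]
    have h : (((1 : ℝ) +ᵥ ρ : ℍ) : ℂ) = 1 + ρ := by simp
    have := ρ.ne_zero
    rw [h]; field_simp; linear_combination -q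
  · linear_combination ((ρ : ℂ) - 1) * q
  · rw [h] at q; norm_num at q

lemma ratio {F : ℍ → ℂ} {p : PowerSeries ℂ} (hF : HasQ 3 F p) (hp : ∀ m, m % 3 ≠ 2 → p.coeff m = 0) (hS : ∀ τ : ℍ, F (S • τ) = (τ : ℂ) ^ 12 * F τ)
    (hT : ∀ τ : ℍ, F ((1 : ℝ) +ᵥ τ) = eC (2 / 3) * F τ) (h0 : p.coeff 2 ≠ 0) :
    p.coeff 5 = 224 * p.coeff 2 ∧ p.coeff 8 = -1576 * p.coeff 2 := by
  obtain ⟨ρ, h1, h2, h3⟩ := exists_rho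
  set a := p.coeff 2
  let r : PowerSeries ℂ := PowerSeries.mk fun j => p.coeff (2 + 3 * j)
  have hq3 : ∀ τ : ℍ, qq 3 τ ^ 3 = qq 1 τ := fun τ => by
    rw [qq_one, qq, ← eC_nat_mul]; congr 1; push_cast; ring
  have hr : HasQ 1 (fun τ => F τ / qq 3 τ ^ 2) r := fun τ => by
    have hi : Function.Injective fun j : ℕ => 2 + 3 * j := fun i j h => by simp only at h; omega
    have := (hi.hasSum_iff (fun m hm => ?_)).2 (hF τ)
    · have := this.div_const (qq 3 τ ^ 2)
      refine this.congr_fun fun j => ?_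
      simp only [Function.comp, r, PowerSeries.coeff_mk]
      rw [pow_add, pow_mul, hq3]
      have := qq_ne (h := 3) τ
      field_simp
    · rw [hp, zero_mul]
      intro h
      exact hm ⟨m / 3, by simp only; omega⟩
  have hX : HasQ 1 (fun τ => F τ ^ 3) (PowerSeries.X ^ 2 * (r * r * r)) := fun τ => by
    have := ((hasQ_monomial (h := 1) 1 2).mul ((hr.mul hr).mul hr)) τ
    rw [← PowerSeries.X_pow_eq] at this
    convert this using 1
    have := qq_ne (h := 3) τ
    beta_reduce; rw [← hq3]; field_simp
  have h4 : HasQ 1 (fun τ => E₄ τ) e4 := mf_hasQ E₄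
  let E := e4 * e4 * e4
  have hG := fun d : ℂ => (hX.sub (((disc_hasQ.mul disc_hasQ).mul ((h4.mul h4).mul h4)).const_mul (a ^ 3))).sub
    (((disc_hasQ.mul disc_hasQ).mul disc_hasQ).const_mul d)
  obtain ⟨a0, a1, a2, -⟩ := e4_vals
  obtain ⟨d0, d1, d2, d3⟩ := dd_vals
  have r0 : r.coeff 0 = a := by simp [r, a]
  have hz : ∃ d : ℂ, PowerSeries.X ^ 2 * (r * r * r) - PowerSeries.C (a ^ 3) * (dd * dd * (e4 * e4 * e4)) - PowerSeries.C d * (dd * dd * dd) = 0 := by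
    refine ⟨3 * a ^ 2 * r.coeff 1 - a ^ 3 * 672, modular_zero_q (K := 36) (M := 4) (hG _) ?_ ?_ (by norm_num)⟩
    · intro τ
      beta_reduce
      rw [hS, disc_S, mf_S]
      norm_cast
      ring
    · intro m hm
      rw [map_sub, map_sub, PowerSeries.coeff_C_mul, PowerSeries.coeff_C_mul, PowerSeries.coeff_X_pow_mul']
      interval_cases m <;>
      · simp only [ps_mul_coeff, Finset.sum_range_succ, Finset.sum_range_zero, Nat.reduceAdd, Nat.reduceSub, Nat.sub_zero, Nat.sub_self, a0, a1, a2, d0, d1, d2, d3, r0]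
        norm_num
        try ring
  obtain ⟨d, hd⟩ := hz
  have hd0 : d = 0 := by
    have hGz : F ρ ^ 3 - a ^ 3 * (discriminant ρ * discriminant ρ * (E₄ ρ * E₄ ρ * E₄ ρ)) - d * (discriminant ρ * discriminant ρ * discriminant ρ) = 0 := by
      have := hG d ρ
      rw [hd] at this
      exact this.unique (by simpa using hasSum_zero)
    have hFr : F ρ = 0 := by
      have := hS ρ
      rw [h1, hT, show (12 : ℕ) = 3 * 4 by norm_num, pow_mul, h2, one_pow, one_mul] at this
      have h5 : eC (2 / 3) ≠ 1 := by
        have := ch_int 2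
        intro h
        push_cast at this
        rw [h, ch_two] at this
        have s := ch_sum
        have t : ch 1 ^ 3 = 1 := by
          rw [← AddChar.map_nsmul_eq_pow, show (3 : ℕ) • (1 : ZMod 3) = 0 by decide, AddChar.map_zero_eq_one]
        have u : ch 1 = 1 := by
          calc ch 1 = ch 1 ^ 3 := by rw [pow_succ, this, one_mul]
            _ = 1 := t
        rw [ch_two, this, u] at s; norm_num at s
      have : (eC (2 / 3) - 1) * F ρ = 0 := by linear_combination this
      exact (mul_eq_zero.1 this).resolve_left (sub_ne_zero.2 h5)
    have hE : E₄ ρ = 0 := by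
      have := mf_S E₄ ρ
      rw [h1, mf_T] at this
      norm_cast at this
      rw [pow_succ, h2, one_mul] at this
      have : ((ρ : ℂ) - 1) * E₄ ρ = 0 := by linear_combination -this
      exact (mul_eq_zero.1 this).resolve_left (sub_ne_zero.2 h3)
    rw [hFr, hE] at hGz
    have := discriminant_ne_zero ρ
    simpa [this] using hGz
  have c3 := congrArg (PowerSeries.coeff 3) hd
  have c4 := congrArg (PowerSeries.coeff 4) hd
  rw [hd0, map_zero, zero_mul, sub_zero, map_sub, PowerSeries.coeff_C_mul, PowerSeries.coeff_X_pow_mul'] at c3 c4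
  simp only [ps_mul_coeff, Finset.sum_range_succ, Finset.sum_range_zero, Nat.reduceAdd, Nat.reduceSub, Nat.sub_zero, Nat.sub_self, a0, a1, a2, d0, d1, d2, d3, r0] at c3 c4
  norm_num at c3 c4
  have r1 : r.coeff 1 = 224 * a := by
    apply mul_left_cancel₀ (pow_ne_zero 2 h0)
    linear_combination c3 / 3
  rw [r1] at c4
  have r2 : r.coeff 2 = -1576 * a := by
    apply mul_left_cancel₀ (pow_ne_zero 2 h0)
    linear_combination c4 / 3
  simp only [r, PowerSeries.coeff_mk] at r1 r2
  exact ⟨r1, r2⟩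

theorem Setup.exists_form (H : Setup B O2 O5 Oa Ob Oc) : ∃ c : V3 → ℂ, IsSingularJacobiCharWith B 3 16 (PH B c) (fco B c) ∧
    (∀ x : LV, c (red 3 x) ≠ 0 → b3 B (red 3 x) (red 3 x) = 1) ∧
    (∀ x ∈ TF B 2, c (red 3 x) = 1) ∧ (∀ x ∈ TF B 5, c (red 3 x) = 77 / 8096) ∧ (∀ x ∈ Oa, c (red 3 x) = 1) ∧ (∀ x ∈ Ob, c (red 3 x) = -4 / 8096) ∧
    (∀ x ∈ Oc, c (red 3 x) = 77 / 8096) := by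
  have hB := H.hB
  obtain ⟨A', C', D', hA', -⟩ := H.struct (g := fun x => hh B (red 3 x)) (hh_cg hB) (fun x y h => by simp only [h])
  obtain ⟨u, hu⟩ : (TF B 2).Nonempty := Finset.card_pos.1 (by rw [(card_TF hB).1]; norm_num)
  have hA0 : A' ≠ 0 := by rw [← hA' u hu]; exact hh_T2 hB hu
  let c : V3 → ℂ := fun x => hh B x / A'
  have hG : ∀ σ ∈ ConwayGroup B, ∀ x, c (red 3 (σ.mulVec x)) = c (red 3 x) := fun σ hσ x => by simp only [c, hh_cg hB σ hσ x]
  have hF : ∀ x, FF B c x = c x := fun x => by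
    simp only [c]
    conv_rhs => rw [← hh_FF hB x]
    simp only [FF, Finset.mul_sum, Finset.sum_div]
    exact Finset.sum_congr rfl fun _ _ => by ring
  have hc : ∀ x : LV, c (red 3 x) ≠ 0 → b3 B (red 3 x) (red 3 x) = 1 := fun x h => hh_supp x fun h' => h (by simp only [c, h', zero_div])
  obtain ⟨A, C, D, hA, hC, ha, hb, hcc⟩ := H.struct (g := fun x => c (red 3 x)) hG (fun x y h => by simp only [h])
  have hA1 : A = 1 := by rw [← hA u hu]; simp only [c]; rw [hA' u hu, div_self hA0]
  subst hA1
  have hq := PH_hasQ hB c 0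
  simp only [pairC_zero_right, eC_zero, mul_one] at hq
  have p2 : ∑ v ∈ TF B 2, c (red 3 v) = 196560 := by
    rw [Finset.sum_congr rfl hA, Finset.sum_const, (card_TF hB).1]; norm_num
  have p5 : ∑ v ∈ TF B 5, c (red 3 v) = 4629381120 * C := by
    rw [Finset.sum_congr rfl hC, Finset.sum_const, (card_TF hB).2.2.2.1]; norm_num
  have p8 := H.sum8 ha hb hcc
  have := ratio hq (fun m hm => by
      rw [PowerSeries.coeff_mk]
      refine Finset.sum_eq_zero fun v hv => ?_
      by_contra h
      have := nQ_mod hB (hc v h)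
      rw [(mem_TF' hB).1 hv] at this
      exact hm this) (fun τ => by
      have := PH_S hB c τ 0
      rw [show FF B c = c from funext hF] at this
      simpa [pairC_zero_right] using this) (fun τ => PH_T hB c hc τ 0) (by rw [PowerSeries.coeff_mk, p2]; norm_num)
  simp only [PowerSeries.coeff_mk, p2, p5, p8] at this
  have eC' : C = 77 / 8096 := by linear_combination (1 / 4629381120) * this.1
  have eD : D = -4 / 8096 := by rw [eC'] at this; linear_combination (1 / 805620816000) * this.2
  subst eC' eD
  exact ⟨c, PH_form hB hF hc hG, hc, hA, hC, ha, hb, hcc⟩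
end coefs

section uniq
open ModularGroup
variable {B : MZ} {O2 O5 Oa Ob Oc : Set LV}

lemma torus_zero {b : LV → ℂ} (hb : Summable b)
    (h : ∀ x : Fin 24 → ℝ, HasSum (fun n => b n * cexp (2 * π * Complex.I * ∑ i, (n i : ℂ) * (x i : ℂ))) 0) (k : LV) : b k = 0 := by
  have h1 : Summable fun n : LV => b n • UnitAddTorus.mFourier (d := Fin 24) n := by
    refine Summable.of_norm ?_
    simpa only [norm_smul, UnitAddTorus.mFourier_norm, mul_one] using hb.norm
  have h2 : HasSum (fun n : LV => b n • UnitAddTorus.mFourier (d := Fin 24) n) 0 := by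
    convert h1.hasSum
    symm
    ext y
    obtain ⟨x, rfl⟩ : ∃ x : Fin 24 → ℝ, (fun i => (x i : UnitAddCircle)) = y := by
      choose x hx using fun i => QuotientAddGroup.mk_surjective (y i)
      exact ⟨x, funext hx⟩
    refine (ContinuousMap.hasSum_apply h1.hasSum _).unique ?_
    refine (h x).congr_fun fun n => ?_
    rw [ContinuousMap.smul_apply, mFourier_coe, smul_eq_mul]
  let _ : MeasureTheory.MeasureSpace UnitAddCircle := ⟨AddCircle.haarAddCircle⟩
  have _ : MeasureTheory.IsProbabilityMeasure (MeasureTheory.volume : MeasureTheory.Measure UnitAddCircle) :=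
    inferInstanceAs (MeasureTheory.IsProbabilityMeasure AddCircle.haarAddCircle)
  have h3 : HasSum (fun n : LV => b n • UnitAddTorus.mFourierLp (d := Fin 24) 2 n) 0 := by
    have := h2.mapL (ContinuousMap.toLp 2 (MeasureTheory.volume : MeasureTheory.Measure (UnitAddTorus (Fin 24))) ℂ)
    rw [map_zero] at this
    refine this.congr_fun fun n => ?_
    rw [map_smul]
  have h4 := h3.mapL (innerSL ℂ (UnitAddTorus.mFourierLp (d := Fin 24) 2 k))
  rw [map_zero] at h4
  have ho := orthonormal_iff_ite.1 (UnitAddTorus.orthonormal_mFourier (d := Fin 24))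
  refine (hasSum_ite_eq k (b k)).unique (h4.congr_fun fun n => ?_)
  rw [map_smul, innerSL_apply_apply, ho k n, smul_eq_mul]
  by_cases hk : n = k
  · subst hk; simp
  · simp [hk, Ne.symm hk]

lemma four_zero (hB : IsLeech B) {a : LV → ℂ} (h : ∀ z : CV, HasSum (fun ℓ => a ℓ * eC (pairC B (liftC ℓ) z)) 0) (k : LV) : a k = 0 := by
  have h0 := (h 0).summable
  simp only [pairC_zero_right, eC_zero, mul_one] at h0
  have := torus_zero (b := fun n => a (hB.eqv.symm n)) (hB.eqv.symm.summable_iff.2 h0) (fun x => by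
    have := hB.eqv.symm.hasSum_iff.2 (h fun i => (x i : ℂ))
    refine this.congr_fun fun n => ?_
    simp only [Function.comp]
    congr 2
    obtain ⟨m, rfl⟩ := hB.eqv.surjective n
    rw [Equiv.symm_apply_apply, hB.commC]
    show _ = 2 * π * Complex.I * pairC B _ _
    congr 1
    simp only [pairC, dotProduct, mulVec, liftC, IsLeech.eqv, Equiv.ofBijective_apply, Matrix.map_apply]
    refine Finset.sum_congr rfl fun i _ => ?_
    push_cast
    rw [mul_comm]) (hB.eqv k)
  simpa using this

lemma four_unique (hB : IsLeech B) {a b : LV → ℂ} {τ : ℂ} {f : CV → ℂ} (h : ∀ z : CV, HasSum (fun ℓ => a ℓ * thT B τ z ℓ) (f z))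
    (h' : ∀ z : CV, HasSum (fun ℓ => b ℓ * thT B τ z ℓ) (f z)) (k : LV) : a k = b k := by
  have := four_zero hB (a := fun ℓ => (a ℓ - b ℓ) * eC τ ^ nQ B ℓ) (fun z => by
    have := (h z).sub (h' z)
    rw [sub_self] at this
    refine this.congr_fun fun ℓ => ?_
    rw [thT_eq hB]; ring) k
  exact sub_eq_zero.1 ((mul_eq_zero.1 this).resolve_right (pow_ne_zero _ (eC_ne_zero _)))

structure Red (B : MZ) (t : ℕ) (d : ℤ) (ψ : ℍ → CV → ℂ) (c : LV → ℂ) : Prop where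
  sum : ∀ (τ : ℍ) z, HasSum (fun ℓ => c ℓ * thT B ((τ : ℂ) / t) z ℓ) (ψ τ z)
  supp : ∀ ℓ, c ℓ ≠ 0 → ∃ j : ℤ, 24 * (nQ B ℓ : ℤ) = t * (d + 24 * j)
  inv : ∀ σ ∈ ConwayGroup B, ∀ x, c (σ.mulVec x) = c x
  per : ∀ x y, red t x = red t y → c x = c y

lemma IsSingularJacobiCharWith.toRed (hB : IsLeech B) {t : ℕ} {d : ℤ} {ψ : ℍ → CV → ℂ} {g : ℤ → LV → ℂ} (ht : 1 ≤ t)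
    (h : IsSingularJacobiCharWith B t d ψ g) : ∃ c, Red B t d ψ c := by
  let J : LV → ℤ := fun ℓ => (24 * (nQ B ℓ : ℤ) / t - d) / 24
  have hJ : ∀ j ℓ, g j ℓ ≠ 0 → J ℓ = j ∧ 24 * (nQ B ℓ : ℤ) = t * (d + 24 * j) := fun j ℓ hg => by
    have h1 := (h.support j ℓ hg).2
    rw [hB.two_nQ] at h1
    have h2 : 24 * (nQ B ℓ : ℤ) = t * (d + 24 * j) := by linarith
    refine ⟨?_, h2⟩
    simp only [J]
    rw [h2, Int.mul_ediv_cancel_left _ (by omega)]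
    omega
  have ht0 : (t : ℂ) ≠ 0 := by norm_cast; omega
  have hs : ∀ (τ : ℍ) z, HasSum (fun ℓ => g (J ℓ) ℓ * thT B ((τ : ℂ) / t) z ℓ) (ψ τ z) := fun τ z => by
    have hi : Function.Injective fun ℓ : LV => (J ℓ, ℓ) := fun a b hab => (Prod.ext_iff.1 hab).2
    have := (hi.hasSum_iff (fun p hp => ?_)).2 (h.expansion τ z)
    · refine this.congr_fun fun ℓ => ?_
      simp only [Function.comp]
      by_cases h0 : g (J ℓ) ℓ = 0
      · rw [h0, zero_mul, zero_mul]
      rw [ftermQ, thT_eq hB, mul_comm (eC (pairC B _ _)), ← eC_nat_mul]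
      congr 3
      have h1 := (hJ _ _ h0).2
      have h2 : 24 * (nQ B ℓ : ℂ) = t * ((d + 24 * J ℓ : ℤ) : ℂ) := by exact_mod_cast h1
      field_simp
      linear_combination (τ : ℂ) * h2
    · by_contra h0
      have := (hJ p.1 p.2 (left_ne_zero_of_mul h0)).1
      exact hp ⟨p.2, by simp only [this]⟩
  refine ⟨fun ℓ => g (J ℓ) ℓ, hs, fun ℓ h0 => ⟨_, (hJ _ _ h0).2⟩, fun σ hσ x => ?_, fun x y hxy => ?_⟩
  · refine four_unique hB (τ := (UpperHalfPlane.I : ℂ) / t) (a := fun x => g (J (σ.mulVec x)) (σ.mulVec x)) (b := fun x => g (J x) x) (fun z => ?_) (hs UpperHalfPlane.I) x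
    have := (cgE hB hσ).hasSum_iff.2 (hs UpperHalfPlane.I (actC σ z))
    rw [h.conway_invar σ hσ] at this
    refine this.congr_fun fun v => ?_
    show _ = g (J (σ.mulVec v)) (σ.mulVec v) * thT B _ _ (σ.mulVec v)
    rw [thT, thT, cg_pair hσ, cg_pairC hσ]
  · obtain ⟨u, hu⟩ := red_eq_iff.1 hxy
    have hx : x = y + (t : ℤ) • u := by rw [← hu]; abel
    rw [hx]
    refine (four_unique hB (τ := (UpperHalfPlane.I : ℂ) / t) (a := fun x => g (J (x + (t : ℤ) • u)) (x + (t : ℤ) • u)) (b := fun x => g (J x) x) ?_ (hs UpperHalfPlane.I) y)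
    intro z
    have h1 := (Equiv.addRight ((t : ℤ) • u)).hasSum_iff.2 (hs UpperHalfPlane.I (z - ((UpperHalfPlane.I : ℍ) : ℂ) • liftC u))
    have h2 := h.quasi_periodic u 0 UpperHalfPlane.I (z - ((UpperHalfPlane.I : ℍ) : ℂ) • liftC u)
    have e : z - ((UpperHalfPlane.I : ℍ) : ℂ) • liftC u + ((UpperHalfPlane.I : ℍ) : ℂ) • liftC u + liftC 0 = z := by
      ext i; simp [liftC]
    rw [e] at h2
    rw [h2]
    refine (h1.mul_left _).congr_fun fun v => ?_
    simp only [Function.comp, Equiv.coe_addRight]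
    rw [mul_left_comm, thT, thT, ← Complex.exp_add]
    congr 2
    simp only [pairC_sub_right, pairC_add_left, pairC_smul_right, pairC_smul_left, pairC_lift, liftC_add, liftC_smul, pairZ_add_left,
      pairZ_add_right, pairZ_smul_left, pairZ_smul_right, hB.comm u v]
    push_cast
    field_simp
    ring
end uniq

section final
open ModularGroup
variable {B : MZ} {O2 O5 Oa Ob Oc : Set LV} {t : ℕ} {d : ℤ} {ψ : ℍ → CV → ℂ} {g : ℤ → LV → ℂ} {c : LV → ℂ}

lemma form_S (h : IsSingularJacobiCharWith B t d ψ g) (τ : ℍ) :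
    ψ (S • τ) 0 = (etaF (S • τ) / etaF τ) ^ d * (τ : ℂ) ^ (12 - d / 2) * ψ τ 0 := by
  have := h.modular S τ 0
  rw [(jf_S τ).1, smul_zero, pairC_zero_right] at this
  simpa using this

lemma form_T (h : IsSingularJacobiCharWith B t d ψ g) (τ : ℍ) :
    ψ ((1 : ℝ) +ᵥ τ) 0 = eC (1 / 24) ^ d * ψ τ 0 := by
  have := h.modular T τ 0
  rw [(jf_T τ).1, (jf_T τ).2, smul_zero, pairC_zero_right, UpperHalfPlane.modular_T_smul, etaF_T, mul_div_assoc, div_self (etaF_ne τ), mul_one] at this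
  simpa using this

lemma eC24 (k : ℤ) : eC (1 / 24) ^ (24 * k) = 1 := by
  rw [_root_.zpow_mul]
  have : eC (1 / 24) ^ (24 : ℤ) = 1 := by
    rw [show (24 : ℤ) = ((24 : ℕ) : ℤ) by norm_num, zpow_natCast, ← eC_nat_mul]
    exact (congrArg eC (by norm_num)).trans (eC_int 1)
  rw [this, _root_.one_zpow]

lemma eta24 (τ : ℍ) (k : ℤ) : (etaF (S • τ) / etaF τ) ^ (24 * k) = (τ : ℂ) ^ (12 * k) := by
  rw [_root_.zpow_mul, _root_.zpow_mul, show (24 : ℤ) = ((24 : ℕ) : ℤ) by norm_num, zpow_natCast, etaF_S24]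
  norm_cast

lemma Red.hasQ (hB : IsLeech B) (R : Red B t d ψ c) : HasQ t (fun τ => ψ τ 0) (PowerSeries.mk fun m => ∑ v ∈ TF B m, c v) :=
  hasQ_of_lv hB fun τ => (R.sum τ 0).congr_fun fun v => by
    rw [thT_eq hB, pairC_zero_right, eC_zero, one_mul]; rfl

lemma Red.vanish (hB : IsLeech B) (ht : 0 < t) (hd : Even d) (h : IsSingularJacobiCharWith B t d ψ g) (R : Red B t d ψ c) {M : ℕ}
    (hM : ∀ m < M, ∑ v ∈ TF B m, c v = 0) (hMt : 13 * t ≤ 12 * M) (m : ℕ) : ∑ v ∈ TF B m, c v = 0 := by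
  obtain ⟨e, he⟩ := hd
  have hQ := R.hasQ hB
  have hz : ∀ τ, ψ τ 0 ^ 12 = 0 := fun τ => by
    refine modular_zero (F := fun τ => ψ τ 0 ^ 12) (K := 144) (M := 13) ((hQ.pow 12).mdiff ht) (fun τ => ?_) (fun τ => ?_) ?_ (by norm_num) τ
    · beta_reduce
      rw [form_S h, mul_pow]
      congr 1
      have h0 := τ.ne_zero
      rw [mul_pow, ← zpow_natCast, ← zpow_natCast, ← _root_.zpow_mul, ← _root_.zpow_mul,
        show d * ((12 : ℕ) : ℤ) = 24 * e by push_cast; omega, eta24, ← zpow_add₀ h0]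
      congr 1
      push_cast; omega
    · beta_reduce
      rw [form_T h, mul_pow, ← zpow_natCast, ← _root_.zpow_mul, show d * ((12 : ℕ) : ℤ) = 24 * e by push_cast; omega, eC24, one_mul]
    · obtain ⟨C, hC⟩ := (hQ.pow 12).bound ht (M := 13 * t) (by
        have h1 : PowerSeries.X ^ M ∣ (PowerSeries.mk fun m => ∑ v ∈ TF B m, c v) :=
          PowerSeries.X_pow_dvd_iff.2 fun m hm => by rw [PowerSeries.coeff_mk, hM m hm]
        have h2 := pow_dvd_pow_of_dvd h1 12
        rw [← pow_mul] at h2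
        intro m hm
        exact PowerSeries.X_pow_dvd_iff.1 h2 m (by omega))
      refine ⟨C, fun τ hτ => (hC τ hτ).trans_eq ?_⟩
      congr 2
      have : (t : ℝ) ≠ 0 := by positivity
      push_cast; field_simp
  have h0 : (fun τ => ψ τ 0) = fun _ => 0 := funext fun τ => pow_eq_zero_iff (by norm_num) |>.1 (hz τ)
  rw [h0] at hQ
  have := congrArg (PowerSeries.coeff m) (hQ.eq_zero ht)
  simpa using this

lemma sum_const_zero {m n : ℕ} (hc : (TF B m).card = n) (hn : 0 < n) {C : ℂ} (h : ∀ x ∈ TF B m, c x = C) (h0 : ∑ x ∈ TF B m, c x = 0) :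
    ∀ x ∈ TF B m, c x = 0 := by
  rw [Finset.sum_congr rfl h, Finset.sum_const, hc, nsmul_eq_mul] at h0
  have : (n : ℂ) ≠ 0 := by exact_mod_cast hn.ne'
  intro x hx
  rw [h x hx]; exact (mul_eq_zero.1 h0).resolve_left this

lemma Red.zero_of (R : Red B t d ψ c) (h : ∀ x, c x = 0) (τ : ℍ) (z : CV) : ψ τ z = 0 :=
  (R.sum τ z).unique (by simpa only [h, zero_mul] using hasSum_zero)

lemma Red.t1 (R : Red B 1 d ψ c) (hd : ¬ 24 ∣ d) (x : LV) : c x = 0 := by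
  by_contra h
  obtain ⟨j, hj⟩ := R.supp x h
  push_cast at hj
  omega

lemma Red.t2 (H : Setup B O2 O5 Oa Ob Oc) (hd : Even d) (hd' : ¬ 24 ∣ d) (h : IsSingularJacobiCharWith B 2 d ψ g) (R : Red B 2 d ψ c) (x : LV) : c x = 0 := by
  have hB := H.hB
  have hs : ∀ x, c x ≠ 0 → nQ B x % 2 = 1 := fun x hx => by
    obtain ⟨j, hj⟩ := R.supp x hx
    push_cast at hj
    omega
  have hs' : ∀ m, m % 2 = 0 → ∀ x ∈ TF B m, c x = 0 := fun m hm x hx => by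
    by_contra h0
    have := hs x h0
    rw [(mem_TF' hB).1 hx] at this; omega
  obtain ⟨C, hC⟩ := orb_const hB H.h5 R.inv
  rw [H.e5] at hC
  have h3 : ∀ x ∈ TF B 3, c x = C := fun x hx => by
    obtain ⟨y, hy, e⟩ := T3_T5 hB hx
    rw [R.per x y e]; exact hC y hy
  have hv := R.vanish hB two_pos hd h (M := 3) (fun m hm => ?_) (by norm_num) 3
  · have h30 := sum_const_zero (card_TF hB).2.1 (by norm_num) h3 hv
    obtain ⟨w, hw, e⟩ := mod2_cover hB x
    rw [R.per x w e]
    rcases hw with hw | hw | hw | hw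
    · exact hs' 0 rfl w hw
    · exact hs' 2 rfl w hw
    · exact h30 w hw
    · exact hs' 4 rfl w hw
  · refine Finset.sum_eq_zero fun x hx => ?_
    interval_cases m
    · exact hs' 0 rfl x hx
    · rw [TF_one hB] at hx; simp at hx
    · exact hs' 2 rfl x hx

lemma b3_nQ (hB : IsLeech B) (x : LV) : b3 B (red 3 x) (red 3 x) = 2 * (nQ B x : ZMod 3) := red_val hB ((mem_TF' hB).2 rfl)

lemma b3_nQ' (hB : IsLeech B) {x : LV} {k : ℕ} (h : nQ B x % 3 = k) : b3 B (red 3 x) (red 3 x) = 2 * (k : ZMod 3) := by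
  rw [b3_nQ hB, ← h, ZMod.natCast_mod]

lemma Red.t3a (H : Setup B O2 O5 Oa Ob Oc) (hd : Even d) (hd' : d % 24 ≠ 16) (hd24 : ¬ 24 ∣ d) (h : IsSingularJacobiCharWith B 3 d ψ g) (R : Red B 3 d ψ c) (x : LV) : c x = 0 := by
  have hB := H.hB
  have hs : ∀ x, c x ≠ 0 → nQ B x % 3 = 1 := fun x hx => by
    obtain ⟨j, hj⟩ := R.supp x hx
    push_cast at hj
    omega
  have hs' : ∀ m, m % 3 ≠ 1 → ∀ x ∈ TF B m, c x = 0 := fun m hm x hx => by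
    by_contra h0
    have := hs x h0
    rw [(mem_TF' hB).1 hx] at this; omega
  obtain ⟨C, hC⟩ := T4_const H R.inv
  obtain ⟨D, hD⟩ := T7_const H R.inv R.per
  have hv := R.vanish hB three_pos hd h (M := 4) (fun m hm => by
    refine Finset.sum_eq_zero fun x hx => ?_
    interval_cases m
    · exact hs' 0 (by norm_num) x hx
    · rw [TF_one hB] at hx; simp at hx
    · exact hs' 2 (by norm_num) x hx
    · exact hs' 3 (by norm_num) x hx) (by norm_num)
  by_contra h0
  obtain ⟨w, hw, e⟩ := cover1 hB (v := x) (by rw [b3_nQ' hB (hs x h0)]; rfl)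
  rw [R.per x w e] at h0
  rcases hw with hw | hw
  · exact h0 (sum_const_zero (card_TF hB).2.2.1 (by norm_num) hC (hv 4) w hw)
  · exact h0 (sum_const_zero (card_TF hB).2.2.2.2.1 (by norm_num) hD (hv 7) w hw)

lemma Red.t3b (H : Setup B O2 O5 Oa Ob Oc) (hd : d % 24 = 16) (h : IsSingularJacobiCharWith B 3 d ψ g) (R : Red B 3 d ψ c) :
    ∃ A, (∀ x ∈ TF B 2, c x = A) ∧ (∀ x ∈ TF B 5, c x = 77 / 8096 * A) ∧ (∀ x ∈ Ob, c x = -4 / 8096 * A) ∧ (∀ x, c x ≠ 0 → b3 B (red 3 x) (red 3 x) = 1) := by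
  have hB := H.hB
  have hs : ∀ x, c x ≠ 0 → nQ B x % 3 = 2 := fun x hx => by
    obtain ⟨j, hj⟩ := R.supp x hx
    push_cast at hj
    omega
  have hs' : ∀ m, m % 3 ≠ 2 → ∑ x ∈ TF B m, c x = 0 := fun m hm => Finset.sum_eq_zero fun x hx => by
    by_contra h0
    have := hs x h0
    rw [(mem_TF' hB).1 hx] at this; omega
  obtain ⟨A, C, D, hA, hC, ha, hb, hcc⟩ := H.struct R.inv R.per
  have p2 : ∑ v ∈ TF B 2, c v = 196560 * A := by
    rw [Finset.sum_congr rfl hA, Finset.sum_const, (card_TF hB).1]; norm_num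
  have p5 : ∑ v ∈ TF B 5, c v = 4629381120 * C := by
    rw [Finset.sum_congr rfl hC, Finset.sum_const, (card_TF hB).2.2.2.1]; norm_num
  have p8 := H.sum8 ha hb hcc
  have key : 4629381120 * C = 224 * (196560 * A) ∧ 196560 * A + 805620816000 * D + 9258762240 * C = -1576 * (196560 * A) := by
    by_cases hA0 : A = 0
    · subst hA0
      have hv := R.vanish hB three_pos (by rw [Int.even_iff]; omega) h (M := 5) (fun m hm => by
        interval_cases m
        · exact hs' 0 (by norm_num)
        · exact hs' 1 (by norm_num)
        · rw [p2, mul_zero]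
        · exact hs' 3 (by norm_num)
        · exact hs' 4 (by norm_num)) (by norm_num)
      rw [← p5, ← p8, hv, hv]; simp
    · obtain ⟨k, hk⟩ : ∃ k, d = 16 + 24 * k := ⟨d / 24, by omega⟩
      have := ratio (R.hasQ hB) (fun m hm => by rw [PowerSeries.coeff_mk, hs' m hm]) (fun τ => by
          have h0 := τ.ne_zero
          have h1 : etaF (S • τ) / etaF τ ≠ 0 := div_ne_zero (etaF_ne _) (etaF_ne _)
          have h16 : (etaF (S • τ) / etaF τ) ^ (16 : ℤ) = (τ : ℂ) ^ (8 : ℤ) := by exact_mod_cast etaF_S τ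
          beta_reduce
          rw [form_S h, hk, zpow_add₀ h1, eta24, h16, ← zpow_add₀ h0, ← zpow_add₀ h0]
          congr 1
          rw [show 8 + 12 * k + (12 - (16 + 24 * k) / 2) = ((12 : ℕ) : ℤ) by push_cast; omega, zpow_natCast]) (fun τ => by
          beta_reduce
          rw [form_T h, hk, zpow_add₀ (eC_ne_zero _), eC24, mul_one, show (16 : ℤ) = ((16 : ℕ) : ℤ) by norm_num, zpow_natCast, ← eC_nat_mul]
          congr 2; norm_num) (by rw [PowerSeries.coeff_mk, p2]; simpa using hA0)
      simpa only [PowerSeries.coeff_mk, p2, p5, p8] using this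
  refine ⟨A, hA, fun x hx => ?_, fun x hx => ?_, fun x hx => ?_⟩
  · rw [hC x hx]; linear_combination (1 / 4629381120) * key.1
  · rw [hb x hx]; linear_combination (1 / 805620816000) * key.2 - 9258762240 / 805620816000 / 4629381120 * key.1
  · rw [b3_nQ' hB (hs x hx)]; rfl

end final

open scoped Classical in
/-- Theorem (Sun–Wang): Up to a scalar multiple there is exactly one nonzero Conway invariant
holomorphic Jacobi form of singular weight 12, index `t ≤ 3` and non-trivial character
`v_η^d` (`d` even, `24 ∤ d`): it occurs for index 3 and character `v_η^{16}`, with Fourier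
expansion beginning `(q^{2/3}/8096)(8096·O₂ + 77·O₅·q + (8096·O_{8a} − 4·O_{8b} + 77·O_{8c})q²
+ O(q³))`. In particular no such form exists for indices 1 and 2. -/
theorem unique_singular_weight_character_form
    (B : Matrix (Fin 24) (Fin 24) ℤ) (hB : IsLeech B)
    (O2 O5 O8a O8b O8c : Set LV)
    (h2 : OrbitData B O2 2 (3 * 65520)) (h5 : OrbitData B O5 5 (70656 * 65520))
    (h8a : OrbitData B O8a 8 (3 * 65520)) (h8b : OrbitData B O8b 8 (12295800 * 65520))
    (h8c : OrbitData B O8c 8 (141312 * 65520)) :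
    ∃ (φ : UpperHalfPlane → CV → ℂ) (f : ℤ → LV → ℂ),
      IsSingularJacobiCharWith B 3 16 φ f ∧
      (∃ (τ : UpperHalfPlane) (z : CV), φ τ z ≠ 0) ∧
      (∀ j : ℤ, j < 0 → ∀ ℓ : LV, f j ℓ = 0) ∧
      (∀ ℓ : LV, f 0 ℓ = if ℓ ∈ O2 then 1 else 0) ∧
      (∀ ℓ : LV, f 1 ℓ = if ℓ ∈ O5 then 77 / 8096 else 0) ∧
      (∀ ℓ : LV, f 2 ℓ = if ℓ ∈ O8a then 1 else if ℓ ∈ O8b then -4 / 8096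
        else if ℓ ∈ O8c then 77 / 8096 else 0) ∧
      (∀ t : ℕ, 1 ≤ t → t ≤ 2 → ∀ d : ℤ, Even d → ¬ (24 ∣ d) →
        ∀ (ψ : UpperHalfPlane → CV → ℂ) (g : ℤ → LV → ℂ),
          IsSingularJacobiCharWith B t d ψ g → ∀ (τ : UpperHalfPlane) (z : CV), ψ τ z = 0) ∧
      (∀ t : ℕ, 1 ≤ t → t ≤ 3 → ∀ d : ℤ, Even d → ¬ (24 ∣ d) →
        ∀ (ψ : UpperHalfPlane → CV → ℂ) (g : ℤ → LV → ℂ),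
          IsSingularJacobiCharWith B t d ψ g →
            ∃ c : ℂ, ∀ (τ : UpperHalfPlane) (z : CV), ψ τ z = c * φ τ z) := by
  have H : Setup B O2 O5 O8a O8b O8c := ⟨hB, h2, h5, h8a, h8b, h8c⟩
  obtain ⟨c, hc, hsupp, c2, c5, ca, cb, cc⟩ := H.exists_form
  have hz : ∀ t : ℕ, 1 ≤ t → t ≤ 2 → ∀ d : ℤ, Even d → ¬ (24 ∣ d) →
        ∀ (ψ : UpperHalfPlane → CV → ℂ) (g : ℤ → LV → ℂ),
          IsSingularJacobiCharWith B t d ψ g → ∀ (τ : UpperHalfPlane) (z : CV), ψ τ z = 0 := by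
    intro t ht1 ht2 d hd hd' ψ g h
    obtain ⟨a, R⟩ := h.toRed hB ht1
    obtain rfl | rfl : t = 1 ∨ t = 2 := by omega
    · exact R.zero_of (R.t1 hd')
    · exact R.zero_of (R.t2 H hd hd' h)
  obtain ⟨u, hu⟩ : (TF B 2).Nonempty := Finset.card_pos.1 (by rw [(card_TF hB).1]; norm_num)
  have hj : ∀ (j : ℤ) (k : ℕ) (ℓ : LV), 2 + 3 * j = k → fco B c j ℓ = if ℓ ∈ TF B k then c (red 3 ℓ) else 0 := fun j k ℓ h => by
    rw [fco, h]
    simp only [Nat.cast_inj, mem_TF' hB]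
  refine ⟨PH B c, fco B c, hc, ?_, ?_, ?_, ?_, ?_, hz, ?_⟩
  · by_contra h0
    push Not at h0
    have hq := PH_hasQ hB c 0
    simp only [pairC_zero_right, eC_zero, mul_one, h0] at hq
    have := congrArg (PowerSeries.coeff 2) (hq.eq_zero three_pos)
    rw [PowerSeries.coeff_mk, map_zero, Finset.sum_congr rfl c2, Finset.sum_const, (card_TF hB).1] at this
    norm_num at this
  · intro j hj ℓ
    rw [fco, if_neg (by omega)]
  · intro ℓ
    rw [hj 0 2 ℓ (by norm_num), H.e2]
    simp only [Finset.mem_coe]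
    split_ifs with h
    · exact c2 ℓ h
    · rfl
  · intro ℓ
    rw [hj 1 5 ℓ (by norm_num), H.e5]
    simp only [Finset.mem_coe]
    split_ifs with h
    · exact c5 ℓ h
    · rfl
  · intro ℓ
    rw [hj 2 8 ℓ (by norm_num)]
    have e8 : ℓ ∈ TF B 8 ↔ (ℓ ∈ O8a ∨ ℓ ∈ O8b) ∨ ℓ ∈ O8c := by
      rw [← Finset.mem_coe, ← H.e8]; rfl
    simp only [e8]
    by_cases ha : ℓ ∈ O8a
    · simp only [ha, true_or, if_true]; exact ca ℓ ha
    by_cases hb : ℓ ∈ O8b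
    · simp only [ha, hb, true_or, or_true, if_true, if_false]; exact cb ℓ hb
    by_cases hcc : ℓ ∈ O8c
    · simp only [ha, hb, hcc, or_true, if_true, if_false]; exact cc ℓ hcc
    · simp only [ha, hb, hcc, or_false, if_false]
  · intro t ht1 ht3 d hd hd' ψ g h
    rcases Nat.lt_or_ge 2 t with ht | ht
    · obtain rfl : t = 3 := by omega
      obtain ⟨a, R⟩ := h.toRed hB ht1
      by_cases hd16 : d % 24 = 16
      · obtain ⟨A, hA, hC, hD, hs⟩ := R.t3b H hd16 h
        refine ⟨A, fun τ z => (R.sum τ z).unique ?_⟩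
        refine ((PH_hasSum hB c τ z).mul_left A).congr_fun fun ℓ => ?_
        have key : a ℓ = A * c (red 3 ℓ) := by
          by_cases hb : b3 B (red 3 ℓ) (red 3 ℓ) = 1
          · obtain ⟨w, hw, e⟩ := H.cover2 hb
            rw [R.per ℓ w e, e]
            rcases hw with hw | hw | hw
            · rw [hA w hw, c2 w hw, mul_one]
            · rw [hC w hw, c5 w hw, mul_comm]
            · rw [hD w hw, cb w hw, mul_comm]
          · have h1 : a ℓ = 0 := by by_contra h'; exact hb (hs ℓ h')
            have h2 : c (red 3 ℓ) = 0 := by by_contra h'; exact hb (hsupp ℓ h')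
            rw [h1, h2, mul_zero]
        rw [key, mul_assoc]; norm_cast
      · exact ⟨0, fun τ z => by rw [R.zero_of (R.t3a H hd hd16 hd' h), zero_mul]⟩
    · exact ⟨0, fun τ z => by rw [hz t ht1 ht d hd hd' ψ g h τ z, zero_mul]⟩

end
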